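/- The functors E_i^Λ and F_i^Λ are exact (they carry short exact sequences of modules to short exact sequences), and both send finitely generated projective modules to finitely generated projective modules. -/

import Mathlib

/- ## Scaffold: Khovanov–Lauda–Rouquier algebras -/

open scoped TensorProduct

/-- A symmetrizable Cartan datum together with the structure constants of the
family of polynomials `Q`. -/
structure CartanDatum (k : Type) [Field k] (I : Type) [Fintype I] [DecidableEq I] : Type where
  a : I → I → ℤ
  d : I → ℤ
  t : I → I → ℕ → ℕ → k
  a_diag : ∀ i, a i i = 2
  a_nonpos : ∀ i j, i ≠ j → a i j ≤ 0
  a_zero_iff : ∀ i j, a i j = 0 ↔ a j i = 0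
  d_pos : ∀ i, 0 < d i
  symmetrize : ∀ i j, d i * a i j = d j * a j i
  t_symm : ∀ i j p q, t i j p q = t j i q p
  t_lead : ∀ i j, i ≠ j → t i j (-(a i j)).toNat 0 ≠ 0

namespace KLR

variable {k : Type} [Field k] {I : Type} [Fintype I] [DecidableEq I]

/-- The symmetric bilinear form `(α_i, α_j) = d_i a_{ij}`. -/
def B (C : CartanDatum k I) (i j : I) : ℤ := C.d i * C.a i j

/-- Generators of the KLR algebra `R(n)`. -/
inductive Gen (I : Type) (n : ℕ) : Type
  | e (ν : Fin n → I) : Gen I n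
  | x (a : Fin n) : Gen I n
  | tau (l : ℕ) (h : l + 1 < n) : Gen I n

variable (k) in
/-- The free algebra on the generators. -/
abbrev FA (I : Type) (n : ℕ) : Type := FreeAlgebra k (Gen I n)

variable (k) in
def ge {n : ℕ} (ν : Fin n → I) : FA k I n := FreeAlgebra.ι k (Gen.e ν)

variable (k) in
def gx {n : ℕ} (a : Fin n) : FA k I n := FreeAlgebra.ι k (Gen.x a)

variable (k) in
def gt {n : ℕ} (l : ℕ) (h : l + 1 < n) : FA k I n := FreeAlgebra.ι k (Gen.tau l h)

/-- The polynomial `Q_{ij}(u,v)` evaluated on two elements of an algebra. -/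
def Qel (C : CartanDatum k I) {A : Type} [Ring A] [Algebra k A] (i j : I) (u v : A) : A :=
  if i = j then 0 else
    ∑ p ∈ Finset.range ((-(C.a i j)).toNat + 1), ∑ q ∈ Finset.range ((-(C.a j i)).toNat + 1),
      if C.d i * (p : ℤ) + C.d j * (q : ℤ) = -(C.d i * C.a i j) then
        C.t i j p q • (u ^ p * v ^ q) else 0

/-- The divided difference `(Q_{ij}(u,v) - Q_{ij}(w,v))/(u - w)` evaluated on elements. -/
def Qdiff (C : CartanDatum k I) {A : Type} [Ring A] [Algebra k A] (i j : I) (u v w : A) : A :=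
  if i = j then 0 else
    ∑ p ∈ Finset.range ((-(C.a i j)).toNat + 1), ∑ q ∈ Finset.range ((-(C.a j i)).toNat + 1),
      if C.d i * (p : ℤ) + C.d j * (q : ℤ) = -(C.d i * C.a i j) then
        C.t i j p q • ((∑ c ∈ Finset.range p, u ^ c * w ^ (p - 1 - c)) * v ^ q) else 0

/-- The defining relations of the KLR algebra `R(n)`. -/
inductive Rel (C : CartanDatum k I) (n : ℕ) : FA k I n → FA k I n → Prop
  | ee : ∀ ν ν' : Fin n → I, Rel C n (ge k ν * ge k ν') (if ν = ν' then ge k ν else 0)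
  | esum : Rel C n (∑ ν : Fin n → I, ge k ν) 1
  | xx : ∀ a b : Fin n, Rel C n (gx k a * gx k b) (gx k b * gx k a)
  | xe : ∀ (a : Fin n) (ν : Fin n → I), Rel C n (gx k a * ge k ν) (ge k ν * gx k a)
  | taue : ∀ (l : ℕ) (h : l + 1 < n) (ν : Fin n → I),
      Rel C n (gt k l h * ge k ν)
        (ge k (ν ∘ Equiv.swap (⟨l, Nat.lt_of_succ_lt h⟩ : Fin n) ⟨l + 1, h⟩) * gt k l h)
  | tautau : ∀ (l : ℕ) (h : l + 1 < n) (l' : ℕ) (h' : l' + 1 < n),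
      (l + 1 < l' ∨ l' + 1 < l) →
      Rel C n (gt k l h * gt k l' h') (gt k l' h' * gt k l h)
  | tausq : ∀ (l : ℕ) (h : l + 1 < n) (ν : Fin n → I),
      Rel C n (gt k l h ^ 2 * ge k ν)
        (Qel C (ν ⟨l, Nat.lt_of_succ_lt h⟩) (ν ⟨l + 1, h⟩)
          (gx k ⟨l, Nat.lt_of_succ_lt h⟩) (gx k ⟨l + 1, h⟩) * ge k ν)
  | taux : ∀ (l : ℕ) (h : l + 1 < n) (m : Fin n) (ν : Fin n → I),
      Rel C n ((gt k l h * gx k m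
          - gx k (Equiv.swap (⟨l, Nat.lt_of_succ_lt h⟩ : Fin n) ⟨l + 1, h⟩ m) * gt k l h) * ge k ν)
        (if m = ⟨l, Nat.lt_of_succ_lt h⟩ ∧ ν ⟨l, Nat.lt_of_succ_lt h⟩ = ν ⟨l + 1, h⟩ then
            -(ge k ν)
          else if m = (⟨l + 1, h⟩ : Fin n) ∧ ν ⟨l, Nat.lt_of_succ_lt h⟩ = ν ⟨l + 1, h⟩ then
            ge k ν
          else 0)
  | braid : ∀ (l : ℕ) (h2 : l + 2 < n) (ν : Fin n → I),
      Rel C n ((gt k (l + 1) h2 * gt k l (Nat.lt_of_succ_lt h2) * gt k (l + 1) h2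
          - gt k l (Nat.lt_of_succ_lt h2) * gt k (l + 1) h2 * gt k l (Nat.lt_of_succ_lt h2))
          * ge k ν)
        (if ν ⟨l, Nat.lt_of_succ_lt (Nat.lt_of_succ_lt h2)⟩ = ν ⟨l + 2, h2⟩ then
            Qdiff C (ν ⟨l, Nat.lt_of_succ_lt (Nat.lt_of_succ_lt h2)⟩)
              (ν ⟨l + 1, Nat.lt_of_succ_lt h2⟩)
              (gx k ⟨l, Nat.lt_of_succ_lt (Nat.lt_of_succ_lt h2)⟩)
              (gx k ⟨l + 1, Nat.lt_of_succ_lt h2⟩)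
              (gx k ⟨l + 2, h2⟩) * ge k ν
          else 0)

/-- The Khovanov–Lauda–Rouquier algebra `R(n)`. -/
abbrev Alg (C : CartanDatum k I) (n : ℕ) : Type := RingQuot (Rel C n)

variable (C : CartanDatum k I)

/-- The generator `e(ν)` of `R(n)`. -/
noncomputable def Ee {n : ℕ} (ν : Fin n → I) : Alg C n :=
  RingQuot.mkAlgHom k (Rel C n) (ge k ν)

/-- The generator `x_a` of `R(n)`. -/
noncomputable def Xx {n : ℕ} (a : Fin n) : Alg C n :=
  RingQuot.mkAlgHom k (Rel C n) (gx k a)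

/-- The generator `τ_l` of `R(n)`. -/
noncomputable def Tt {n : ℕ} (l : ℕ) (h : l + 1 < n) : Alg C n :=
  RingQuot.mkAlgHom k (Rel C n) (gt k l h)

variable (I) in
/-- The height of `β = Σ k_i α_i`. -/
def ht (β : I → ℕ) : ℕ := ∑ i, β i

/-- The content of a sequence `ν`. -/
def content {m : ℕ} (ν : Fin m → I) : I → ℕ :=
  fun i => (Finset.univ.filter (fun a => ν a = i)).card

/-- The set `I^β` of sequences of length `m` with content `β`. -/
def seqs (β : I → ℕ) (m : ℕ) : Finset (Fin m → I) :=
  Finset.univ.filter (fun ν => content ν = β)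

/-- The central idempotent `e(β)` in `R(n)`. -/
noncomputable def eIdem (n : ℕ) (β : I → ℕ) : Alg C n := ∑ ν ∈ seqs β n, Ee C ν

/-- `β + α_i`. -/
def addA (β : I → ℕ) (i : I) : I → ℕ := fun j => β j + if j = i then 1 else 0

/-- The idempotent `e(β, α_i)` of `R(n+1)` (sum over `ν ∈ I^{β+α_i}` with `ν_{n+1} = i`). -/
noncomputable def eR (n : ℕ) (β : I → ℕ) (i : I) : Alg C (n + 1) :=
  ∑ ν ∈ (seqs (addA β i) (n + 1)).filter (fun ν => ν (Fin.last n) = i), Ee C ν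

/-- The idempotent `e(α_i, β)` of `R(n+1)` (sum over `ν ∈ I^{β+α_i}` with `ν_1 = i`). -/
noncomputable def eL (n : ℕ) (β : I → ℕ) (i : I) : Alg C (n + 1) :=
  ∑ ν ∈ (seqs (addA β i) (n + 1)).filter (fun ν => ν 0 = i), Ee C ν

/-- The idempotent `e(β - α_i, α_i)` of `R(n)`: sum over `ν ∈ I^β` with last entry `i`;
this is `0` when the coefficient of `α_i` in `β` is `0` or `n = 0`. -/
noncomputable def eD (n : ℕ) (β : I → ℕ) (i : I) : Alg C n :=
  ∑ ν ∈ (seqs β n).filter (fun ν => if h : 0 < n then ν ⟨n - 1, Nat.sub_lt h one_pos⟩ = i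
      else False), Ee C ν

/-- The relations defining `R(β) = R(n)e(β)` (a unital ring with unit the image of
`e(β)`): the KLR relations together with the relation `e(β) = 1`. -/
inductive URel (n : ℕ) (β : I → ℕ) : FA k I n → FA k I n → Prop
  | base : ∀ {x y : FA k I n}, Rel C n x y → URel n β x y
  | unit : URel n β (∑ ν ∈ seqs β n, ge k ν) 1

/-- The algebra `R(β)`, realized as the quotient of `R(n)` identifying `e(β)` with `1`. -/
abbrev bAlg (n : ℕ) (β : I → ℕ) : Type := RingQuot (URel C n β)

/-- The canonical projection `R(n) → R(β)`. -/
noncomputable def toB {n : ℕ} {β : I → ℕ} : Alg C n →ₐ[k] bAlg C n β :=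
  RingQuot.liftAlgHom (S := k)
    ⟨RingQuot.mkAlgHom k (URel C n β),
      fun _ _ h => RingQuot.mkAlgHom_rel k (URel.base h)⟩

/-- The element `a^Λ(x_1)` at the level of the free algebra. -/
noncomputable def aLamF (Λ : I → ℕ) (n : ℕ) (β : I → ℕ) : FA k I n :=
  if h : 0 < n then
    ∑ ν ∈ seqs β n, (gx k (⟨0, h⟩ : Fin n)) ^ (Λ (ν ⟨0, h⟩)) * ge k ν
  else 0

/-- The element `a^Λ(x_1)` of `R(β)`. -/
noncomputable def aLam (Λ : I → ℕ) (n : ℕ) (β : I → ℕ) : bAlg C n β :=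
  RingQuot.mkAlgHom k (URel C n β) (aLamF Λ n β)

/-- The relations defining the cyclotomic quotient `R^Λ(β)`. -/
inductive CRel (Λ : I → ℕ) (n : ℕ) (β : I → ℕ) : FA k I n → FA k I n → Prop
  | base : ∀ {x y : FA k I n}, Rel C n x y → CRel Λ n β x y
  | unit : CRel Λ n β (∑ ν ∈ seqs β n, ge k ν) 1
  | cyc : CRel Λ n β (aLamF Λ n β) 0

/-- The cyclotomic KLR algebra `R^Λ(β)`. -/
abbrev cAlg (Λ : I → ℕ) (n : ℕ) (β : I → ℕ) : Type := RingQuot (CRel C Λ n β)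

/-- The canonical projection `R(β) → R^Λ(β)`. -/
noncomputable def toC {Λ : I → ℕ} {n : ℕ} {β : I → ℕ} : bAlg C n β →ₐ[k] cAlg C Λ n β :=
  RingQuot.liftAlgHom (S := k)
    ⟨RingQuot.mkAlgHom k (CRel C Λ n β),
      fun _ _ h => by
        cases h with
        | base hb => exact RingQuot.mkAlgHom_rel k (CRel.base hb)
        | unit => exact RingQuot.mkAlgHom_rel k CRel.unit⟩

/-- The canonical projection `R(n) → R^Λ(β)`. -/
noncomputable def toCB (Λ : I → ℕ) {n : ℕ} {β : I → ℕ} : Alg C n →ₐ[k] cAlg C Λ n β :=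
  (toC C).comp (toB C)

end KLR
namespace KLR

variable {k : Type} [Field k] {I : Type} [Fintype I] [DecidableEq I] (C : CartanDatum k I)

section Homs

/-- Characterization of the non-unital algebra homomorphism `R(n) → R(n+1)` adding `i`
on the right: `e(ν) ↦ e(ν∗(i))`, `x_a ↦ x_a e(…,α_i)`, `τ_l ↦ τ_l e(…,α_i)`,
where the relevant idempotent is supplied as `e`. -/
def IsUpR {n : ℕ} (i : I) (e : Alg C (n + 1)) (φ : Alg C n →ₙₐ[k] Alg C (n + 1)) : Prop :=
  (∀ ν : Fin n → I, φ (Ee C ν) = Ee C (Fin.snoc ν i)) ∧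
  (∀ a : Fin n, φ (Xx C a) = Xx C a.castSucc * e) ∧
  (∀ (l : ℕ) (h : l + 1 < n), φ (Tt C l h) = Tt C l (Nat.lt_succ_of_lt h) * e)

/-- Characterization of the non-unital algebra homomorphism `R(n) → R(n+1)` adding `i`
on the left: `e(ν) ↦ e((i)∗ν)`, `x_a ↦ x_{a+1} e(α_i,…)`, `τ_l ↦ τ_{l+1} e(α_i,…)`. -/
def IsUpL {n : ℕ} (i : I) (e : Alg C (n + 1)) (φ : Alg C n →ₙₐ[k] Alg C (n + 1)) : Prop :=
  (∀ ν : Fin n → I, φ (Ee C ν) = Ee C (Fin.cons i ν)) ∧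
  (∀ a : Fin n, φ (Xx C a) = Xx C a.succ * e) ∧
  (∀ (l : ℕ) (h : l + 1 < n), φ (Tt C l h) = Tt C (l + 1) (Nat.succ_lt_succ h) * e)

/-- Characterization of the non-unital homomorphism `R(β) → R(β+α_i)` (right version). -/
def IsUpRb {n : ℕ} {β γ' : I → ℕ} (i : I)
    (φ : bAlg C n β →ₙₐ[k] bAlg C (n + 1) γ') : Prop :=
  (∀ ν : Fin n → I, φ (toB C (Ee C ν)) = toB C (Ee C (Fin.snoc ν i))) ∧
  (∀ a : Fin n, φ (toB C (Xx C a)) = toB C (Xx C a.castSucc * eR C n β i)) ∧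
  (∀ (l : ℕ) (h : l + 1 < n),
    φ (toB C (Tt C l h)) = toB C (Tt C l (Nat.lt_succ_of_lt h) * eR C n β i))

/-- Characterization of the non-unital homomorphism `R(β) → R(β+α_i)` (left version). -/
def IsUpLb {n : ℕ} {β γ' : I → ℕ} (i : I)
    (φ : bAlg C n β →ₙₐ[k] bAlg C (n + 1) γ') : Prop :=
  (∀ ν : Fin n → I, φ (toB C (Ee C ν)) = toB C (Ee C (Fin.cons i ν))) ∧
  (∀ a : Fin n, φ (toB C (Xx C a)) = toB C (Xx C a.succ * eL C n β i)) ∧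
  (∀ (l : ℕ) (h : l + 1 < n),
    φ (toB C (Tt C l h)) = toB C (Tt C (l + 1) (Nat.succ_lt_succ h) * eL C n β i))

/-- Characterization of the non-unital homomorphism `R^Λ(β) → R^Λ(β+α_i)` (right version). -/
def IsUpRc (Λ : I → ℕ) {n : ℕ} {β γ' : I → ℕ} (i : I)
    (φ : cAlg C Λ n β →ₙₐ[k] cAlg C Λ (n + 1) γ') : Prop :=
  (∀ ν : Fin n → I, φ (toCB C Λ (Ee C ν)) = toCB C Λ (Ee C (Fin.snoc ν i))) ∧
  (∀ a : Fin n, φ (toCB C Λ (Xx C a)) = toCB C Λ (Xx C a.castSucc * eR C n β i)) ∧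
  (∀ (l : ℕ) (h : l + 1 < n),
    φ (toCB C Λ (Tt C l h)) = toCB C Λ (Tt C l (Nat.lt_succ_of_lt h) * eR C n β i))

end Homs

section Tensor

open scoped TensorProduct

variable (S B M : Type) [Ring S] [Algebra k S] [Ring B] [Algebra k B]
  [AddCommGroup M] [Module k M] [Module S M] [IsScalarTower k S M]

variable (k) in
/-- The relation submodule defining the balanced tensor product `B ⊗_S M` where `S`
acts on `B` on the right through the (non-unital) homomorphism `φ : S → B`. -/
def TRel (φ : S →ₙₐ[k] B) : Submodule B (B ⊗[k] M) :=
  Submodule.span B {z | ∃ (b : B) (r : S) (m : M), z = (b * φ r) ⊗ₜ[k] m - b ⊗ₜ[k] (r • m)}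

variable (k) in
/-- The balanced tensor product `B ⊗_S M` (over the homomorphism `φ : S → B`). -/
abbrev OT (φ : S →ₙₐ[k] B) : Type := (B ⊗[k] M) ⧸ TRel k S B M φ

variable (k) in
/-- The canonical projection onto the balanced tensor product. -/
def OTmk (φ : S →ₙₐ[k] B) (z : B ⊗[k] M) : OT k S B M φ := Submodule.Quotient.mk z

end Tensor

section ESub

variable (A : Type) [Ring A] [Algebra k A] (N : Type) [AddCommGroup N] [Module k N]
  [Module A N] [IsScalarTower k A N]

variable (k) in
/-- Multiplication by `e` as a `k`-linear endomorphism of an `A`-module. -/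
def eMap (e : A) : N →ₗ[k] N where
  toFun x := e • x
  map_add' x y := smul_add e x y
  map_smul' c x := by
    simp only [RingHom.id_apply]
    rw [← algebraMap_smul A c x, ← mul_smul, ← Algebra.commutes, mul_smul, algebraMap_smul]

variable (k) in
/-- The `k`-submodule `eN` of an `A`-module `N`. -/
def eSub (e : A) : Submodule k N := LinearMap.range (eMap k A N e)

end ESub

section Grading

variable {A M : Type}

variable (k) in
/-- `𝒜` is an algebra grading of `A`. -/
def IsAlgGrading [Ring A] [Algebra k A] (𝒜 : ℤ → Submodule k A) : Prop :=
  (1 : A) ∈ 𝒜 0 ∧ (∀ {c₁ c₂ : ℤ} {a b : A}, a ∈ 𝒜 c₁ → b ∈ 𝒜 c₂ → a * b ∈ 𝒜 (c₁ + c₂)) ∧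
    DirectSum.IsInternal 𝒜

variable (k) in
/-- `gr` is a grading of the `A`-module `M` compatible with the algebra grading `𝒜`. -/
def IsModGrading [Ring A] [Algebra k A] [AddCommGroup M] [Module k M] [Module A M]
    (𝒜 : ℤ → Submodule k A) (gr : ℤ → Submodule k M) : Prop :=
  DirectSum.IsInternal gr ∧
    ∀ {c m : ℤ} {a : A} {x : M}, a ∈ 𝒜 c → x ∈ gr m → a • x ∈ gr (c + m)

end Grading

section KLRGrading

/-- The canonical grading property for `R(n)`-type quotients: images of `e(ν)` have degree 0,
`x_a e(ν)` has degree `(α_{ν_a}, α_{ν_a})`, and `τ_l e(ν)` has degree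
`-(α_{ν_l}, α_{ν_{l+1}})`.  Here `p : R(n) → A` is the canonical projection onto the
quotient under consideration. -/
def IsKLRGrading {n : ℕ} {A : Type} [Ring A] [Algebra k A] (p : Alg C n →ₐ[k] A)
    (𝒜 : ℤ → Submodule k A) : Prop :=
  IsAlgGrading k 𝒜 ∧
  (∀ ν : Fin n → I, p (Ee C ν) ∈ 𝒜 0) ∧
  (∀ (a : Fin n) (ν : Fin n → I), p (Xx C a * Ee C ν) ∈ 𝒜 (B C (ν a) (ν a))) ∧
  (∀ (l : ℕ) (h : l + 1 < n) (ν : Fin n → I),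
    p (Tt C l h * Ee C ν) ∈ 𝒜 (-(B C (ν ⟨l, Nat.lt_of_succ_lt h⟩) (ν ⟨l + 1, h⟩))))

end KLRGrading

end KLR
namespace KLR

open scoped TensorProduct

variable {k : Type} [Field k] {I : Type} [Fintype I] [DecidableEq I] (C : CartanDatum k I)

section IndGrading

variable (S B M : Type) [Ring S] [Algebra k S] [Ring B] [Algebra k B]
  [AddCommGroup M] [Module k M] [Module S M] [IsScalarTower k S M]

variable (k) in
/-- The induced grading on the balanced tensor product `B ⊗_S M`. -/
def otGr (φ : S →ₙₐ[k] B) (𝒜 : ℤ → Submodule k B) (gr : ℤ → Submodule k M)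
    (c : ℤ) : Submodule k (OT k S B M φ) :=
  Submodule.span k {z | ∃ (c₁ c₂ : ℤ) (b : B) (m : M),
    c₁ + c₂ = c ∧ b ∈ 𝒜 c₁ ∧ m ∈ gr c₂ ∧ z = OTmk k S B M φ (b ⊗ₜ[k] m)}

end IndGrading

section ESubGrading

variable (A N : Type) [Ring A] [Algebra k A] [AddCommGroup N] [Module k N]
  [Module A N] [IsScalarTower k A N]

variable (k) in
/-- The induced grading on the submodule `eN ⊆ N`. -/
def eSubGr (e : A) (gr : ℤ → Submodule k N) (c : ℤ) : Submodule k ↥(eSub k A N e) :=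
  (gr c).comap (eSub k A N e).subtype

end ESubGrading

section Instances

variable (n : ℕ) (β : I → ℕ) (Λ : I → ℕ)

noncomputable instance : Module (bAlg C n β) (cAlg C Λ n β) :=
  Module.compHom _ (toC C (Λ := Λ) (n := n) (β := β)).toRingHom

instance : IsScalarTower k (bAlg C n β) (cAlg C Λ n β) := by
  constructor
  intro c s m
  show (toC C (c • s)) * m = c • (toC C s * m)
  rw [map_smul, Algebra.smul_mul_assoc]

end Instances


end KLR
namespace KLR

open scoped TensorProduct

variable {k : Type} [Field k] {I : Type} [Fintype I] [DecidableEq I] (C : CartanDatum k I)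

/-- `⟨h_i, β⟩ = Σ_j k_j a_{ij}`. -/
def pairH (i : I) (β : I → ℕ) : ℤ := ∑ j, (β j : ℤ) * C.a i j

/-- `(α_i, β) = Σ_j k_j (α_i, α_j)`. -/
def pairB (i : I) (β : I → ℕ) : ℤ := ∑ j, (β j : ℤ) * B C i j

/-- The ordered product `τ_1 τ_2 ⋯ τ_n` in `R(β+α_i)`-type quotients. -/
noncomputable def tauProd (n : ℕ) (γ : I → ℕ) : bAlg C (n + 1) γ :=
  (List.ofFn (fun l : Fin n => toB C (Tt C l.val (Nat.succ_lt_succ l.isLt)))).prod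

/-- The right ideal `Ae` as a `k`-submodule. -/
noncomputable def rId {A : Type} [Ring A] [Algebra k A] (e : A) : Submodule k A :=
  LinearMap.range (LinearMap.mulRight k e)

/-- The left ideal `eA` as a `k`-submodule. -/
noncomputable def lId {A : Type} [Ring A] [Algebra k A] (e : A) : Submodule k A :=
  LinearMap.range (LinearMap.mulLeft k e)

variable (k) in
/-- Characterization of the module structure on `eN` over `S'` acting through
the (non-unital) homomorphism `φ : S' → A`. -/
def IsEAction {A N S' : Type} [Ring A] [Algebra k A] [AddCommGroup N] [Module k N]
    [Module A N] [IsScalarTower k A N] [Ring S'] [Algebra k S']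
    (e : A) (φ : S' →ₙₐ[k] A) (inst : Module S' ↥(eSub k A N e)) : Prop :=
  letI := inst
  ∀ (r : S') (x : ↥(eSub k A N e)), ((r • x : ↥(eSub k A N e)) : N) = φ r • (x : N)

end KLR

namespace KLR

variable {k : Type} [Field k] {I : Type} [Fintype I] [DecidableEq I] (C : CartanDatum k I)

/-- The image of `e(β,α_i)` in `R(β+α_i)`. -/
noncomputable def eRb (n : ℕ) (β : I → ℕ) (i : I) : bAlg C (n + 1) (addA β i) :=
  toB C (eR C n β i)

/-- The image of `e(α_i,β)` in `R(β+α_i)`. -/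
noncomputable def eLb (n : ℕ) (β : I → ℕ) (i : I) : bAlg C (n + 1) (addA β i) :=
  toB C (eL C n β i)

/-- The image of `e(β-α_i,α_i)` in `R(β)`. -/
noncomputable def eDb (n : ℕ) (β : I → ℕ) (i : I) : bAlg C n β :=
  toB C (eD C n β i)

/-- The image of `e(β,α_i)` in `R^Λ(β+α_i)`. -/
noncomputable def eRc (Λ : I → ℕ) (n : ℕ) (β : I → ℕ) (i : I) :
    cAlg C Λ (n + 1) (addA β i) :=
  toCB C Λ (eR C n β i)

/-- The image of `e(β-α_i,α_i)` in `R^Λ(β)`. -/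
noncomputable def eDc (Λ : I → ℕ) (n : ℕ) (β : I → ℕ) (i : I) : cAlg C Λ n β :=
  toCB C Λ (eD C n β i)

end KLR



namespace KLR
open Finset

variable {k : Type} [Field k] {I : Type} [Fintype I] [DecidableEq I]

section Qmaps
variable (C : CartanDatum k I) {A B' : Type} [Ring A] [Algebra k A] [Ring B'] [Algebra k B']

lemma Qel_map (f : A →ₐ[k] B') (i j : I) (u v : A) :
    f (Qel C i j u v) = Qel C i j (f u) (f v) := by
  unfold Qel
  split_ifs
  · simp
  · rw [map_sum]
    refine Finset.sum_congr rfl fun p _ => ?_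
    rw [map_sum]
    refine Finset.sum_congr rfl fun q _ => ?_
    split_ifs <;> simp

lemma Qdiff_map (f : A →ₐ[k] B') (i j : I) (u v w : A) :
    f (Qdiff C i j u v w) = Qdiff C i j (f u) (f v) (f w) := by
  unfold Qdiff
  split_ifs
  · simp
  · rw [map_sum]
    refine Finset.sum_congr rfl fun p _ => ?_
    rw [map_sum]
    refine Finset.sum_congr rfl fun q _ => ?_
    split_ifs <;> simp

end Qmaps

/-- A representation of the KLR relations in an algebra, in terms of local idempotents. -/
structure Rep (C : CartanDatum k I) (n : ℕ) (A : Type) [Ring A] [Algebra k A] where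
  ε : ℕ → I → A
  x : ℕ → A
  τ : ℕ → A
  εε : ∀ a < n, ∀ b < n, ∀ i j, ε a i * ε b j = ε b j * ε a i
  εmul : ∀ a < n, ∀ i j, ε a i * ε a j = if i = j then ε a i else 0
  εsum : ∀ a < n, ∑ j, ε a j = 1
  xx : ∀ a < n, ∀ b < n, x a * x b = x b * x a
  xε : ∀ a < n, ∀ b < n, ∀ j, x a * ε b j = ε b j * x a
  τε : ∀ l, l + 1 < n → ∀ a < n, a ≠ l → a ≠ l + 1 → ∀ j, τ l * ε a j = ε a j * τ l
  τε0 : ∀ l, l + 1 < n → ∀ j, τ l * ε l j = ε (l + 1) j * τ l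
  τε1 : ∀ l, l + 1 < n → ∀ j, τ l * ε (l + 1) j = ε l j * τ l
  ττ : ∀ l l', l + 1 < l' → l' + 1 < n → τ l * τ l' = τ l' * τ l
  τsq : ∀ l, l + 1 < n → ∀ i j, τ l * τ l * (ε l i * ε (l + 1) j) =
    Qel C i j (x l) (x (l + 1)) * (ε l i * ε (l + 1) j)
  τx : ∀ l, l + 1 < n → ∀ a < n, a ≠ l → a ≠ l + 1 → τ l * x a = x a * τ l
  τx0 : ∀ l, l + 1 < n → ∀ i j, (τ l * x l - x (l + 1) * τ l) * (ε l i * ε (l + 1) j) =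
    if i = j then -(ε l i * ε (l + 1) j) else 0
  τx1 : ∀ l, l + 1 < n → ∀ i j, (τ l * x (l + 1) - x l * τ l) * (ε l i * ε (l + 1) j) =
    if i = j then (ε l i * ε (l + 1) j) else 0
  braid : ∀ l, l + 2 < n → ∀ i j i',
    (τ (l + 1) * τ l * τ (l + 1) - τ l * τ (l + 1) * τ l) *
      (ε l i * ε (l + 1) j * ε (l + 2) i') =
    if i = i' then Qdiff C i j (x l) (x (l + 1)) (x (l + 2)) *
      (ε l i * ε (l + 1) j * ε (l + 2) i') else 0

/-! ### A wrapper for the KLR algebra -/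

/-- The KLR algebra, with sealed instances. -/
def KA (C : CartanDatum k I) (n : ℕ) : Type := Alg C n

noncomputable instance (C : CartanDatum k I) (n : ℕ) : Ring (KA C n) :=
  inferInstanceAs (Ring (Alg C n))
noncomputable instance (C : CartanDatum k I) (n : ℕ) : Algebra k (KA C n) :=
  inferInstanceAs (Algebra k (Alg C n))

/-- the quotient map -/
noncomputable def qK (C : CartanDatum k I) (n : ℕ) : FA k I n →ₐ[k] KA C n :=
  RingQuot.mkAlgHom k (Rel C n)

lemma qK_rel (C : CartanDatum k I) {n : ℕ} {a b : FA k I n} (h : Rel C n a b) :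
    qK C n a = qK C n b := RingQuot.mkAlgHom_rel k h

section Gens
variable (C : CartanDatum k I) {n : ℕ}
/-- generator -/
noncomputable def kE (ν : Fin n → I) : KA C n := qK C n (ge k ν)
/-- generator -/
noncomputable def kX (a : Fin n) : KA C n := qK C n (gx k a)
/-- generator -/
noncomputable def kT (l : ℕ) (h : l + 1 < n) : KA C n := qK C n (gt k l h)
end Gens

/-! ### The canonical representation of `Alg` in itself -/
section Canon
variable (C : CartanDatum k I) {n : ℕ}

lemma Ee_mul (ν ν' : Fin n → I) : kE C ν * kE C ν' = if ν = ν' then kE C ν else 0 := by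
  have := qK_rel C (Rel.ee (C := C) ν ν')
  rw [map_mul] at this
  unfold kE; rw [this]; split_ifs <;> simp

lemma Ee_sum : ∑ ν : Fin n → I, kE C ν = 1 := by
  have := qK_rel C (Rel.esum (C := C) (n := n))
  rw [map_sum, map_one] at this
  exact this

lemma alg_ext {a b : KA C n} (h : ∀ ν, a * kE C ν = b * kE C ν) : a = b := by
  rw [← mul_one a, ← mul_one b, ← Ee_sum C, Finset.mul_sum, Finset.mul_sum]
  exact Finset.sum_congr rfl fun ν _ => h ν

variable (n) in
/-- total version of `x` -/
noncomputable def X (a : ℕ) : KA C n := if h : a < n then kX C ⟨a, h⟩ else 0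
variable (n) in
/-- total version of `τ` -/
noncomputable def Ta (l : ℕ) : KA C n := if h : l + 1 < n then kT C l h else 0
variable (n) in
/-- local idempotents -/
noncomputable def Ep (a : ℕ) (j : I) : KA C n :=
  ∑ ν : Fin n → I, if h : a < n then (if ν ⟨a, h⟩ = j then kE C ν else 0) else 0

lemma X_eq {a : ℕ} (h : a < n) : X C n a = kX C ⟨a, h⟩ := by simp [X, h]
lemma Ta_eq {l : ℕ} (h : l + 1 < n) : Ta C n l = kT C l h := by simp [Ta, h]

lemma Ep_mul_Ee {a : ℕ} (h : a < n) (j : I) (ν : Fin n → I) :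
    Ep C n a j * kE C ν = if ν ⟨a, h⟩ = j then kE C ν else 0 := by
  unfold Ep
  rw [Finset.sum_mul, Finset.sum_eq_single ν]
  · simp only [h, dite_true]; split_ifs <;> simp [Ee_mul]
  · intro μ _ hμ; simp only [h, dite_true]; split_ifs <;> simp [Ee_mul, hμ]
  · simp

lemma Ee_mul_Ep {a : ℕ} (h : a < n) (j : I) (ν : Fin n → I) :
    kE C ν * Ep C n a j = if ν ⟨a, h⟩ = j then kE C ν else 0 := by
  unfold Ep
  rw [Finset.mul_sum, Finset.sum_eq_single ν]
  · simp only [h, dite_true]; split_ifs <;> simp [Ee_mul]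
  · intro μ _ hμ; simp only [h, dite_true]; split_ifs <;> simp [Ee_mul, hμ.symm]
  · simp

lemma Xx_Ee (a : Fin n) (ν : Fin n → I) : kX C a * kE C ν = kE C ν * kX C a := by
  have := qK_rel C (Rel.xe (C := C) a ν)
  rw [map_mul, map_mul] at this; exact this

lemma X_Ee (a : ℕ) (ν : Fin n → I) : X C n a * kE C ν = kE C ν * X C n a := by
  unfold X; split_ifs
  · exact Xx_Ee C _ _
  · simp

lemma Xx_Xx (a b : Fin n) : kX C a * kX C b = kX C b * kX C a := by
  have := qK_rel C (Rel.xx (C := C) a b)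
  rw [map_mul, map_mul] at this; exact this

lemma Tt_Ee (l : ℕ) (h : l + 1 < n) (ν : Fin n → I) :
    kT C l h * kE C ν = kE C (ν ∘ Equiv.swap (⟨l, Nat.lt_of_succ_lt h⟩ : Fin n) ⟨l + 1, h⟩)
      * kT C l h := by
  have := qK_rel C (Rel.taue (C := C) l h ν)
  rw [map_mul, map_mul] at this; exact this

lemma Tt_Tt (l : ℕ) (h : l + 1 < n) (l' : ℕ) (h' : l' + 1 < n) (hl : l + 1 < l') :
    kT C l h * kT C l' h' = kT C l' h' * kT C l h := by
  have := qK_rel C (Rel.tautau (C := C) l h l' h' (Or.inl hl))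
  rw [map_mul, map_mul] at this; exact this

lemma Tt_sq (l : ℕ) (h : l + 1 < n) (ν : Fin n → I) :
    kT C l h * kT C l h * kE C ν = Qel C (ν ⟨l, Nat.lt_of_succ_lt h⟩) (ν ⟨l + 1, h⟩)
      (kX C ⟨l, Nat.lt_of_succ_lt h⟩) (kX C ⟨l + 1, h⟩) * kE C ν := by
  have := qK_rel C (Rel.tausq (C := C) l h ν)
  rw [map_mul, map_mul, map_pow, Qel_map, sq] at this
  exact this

lemma Tt_Xx (l : ℕ) (h : l + 1 < n) (m : Fin n) (ν : Fin n → I) :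
    (kT C l h * kX C m - kX C (Equiv.swap (⟨l, Nat.lt_of_succ_lt h⟩ : Fin n) ⟨l + 1, h⟩ m) *
      kT C l h) * kE C ν =
     (if m = ⟨l, Nat.lt_of_succ_lt h⟩ ∧ ν ⟨l, Nat.lt_of_succ_lt h⟩ = ν ⟨l + 1, h⟩ then
            -(kE C ν)
          else if m = (⟨l + 1, h⟩ : Fin n) ∧ ν ⟨l, Nat.lt_of_succ_lt h⟩ = ν ⟨l + 1, h⟩ then
            kE C ν
          else 0) := by
  have := qK_rel C (Rel.taux (C := C) l h m ν)
  rw [map_mul, map_sub, map_mul, map_mul] at this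
  unfold kT kX kE
  rw [this]
  split_ifs <;> simp

lemma Tt_braid (l : ℕ) (h2 : l + 2 < n) (ν : Fin n → I) :
    (kT C (l + 1) h2 * kT C l (Nat.lt_of_succ_lt h2) * kT C (l + 1) h2
          - kT C l (Nat.lt_of_succ_lt h2) * kT C (l + 1) h2 * kT C l (Nat.lt_of_succ_lt h2))
          * kE C ν =
        (if ν ⟨l, Nat.lt_of_succ_lt (Nat.lt_of_succ_lt h2)⟩ = ν ⟨l + 2, h2⟩ then
            Qdiff C (ν ⟨l, Nat.lt_of_succ_lt (Nat.lt_of_succ_lt h2)⟩)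
              (ν ⟨l + 1, Nat.lt_of_succ_lt h2⟩)
              (kX C ⟨l, Nat.lt_of_succ_lt (Nat.lt_of_succ_lt h2)⟩)
              (kX C ⟨l + 1, Nat.lt_of_succ_lt h2⟩)
              (kX C ⟨l + 2, h2⟩) * kE C ν
          else 0) := by
  have := qK_rel C (Rel.braid (C := C) l h2 ν)
  simp only [map_mul, map_sub] at this
  unfold kT kX kE
  rw [this]
  split_ifs <;> simp [Qdiff_map]

lemma Ep_comm_Ee (a : ℕ) (h : a < n) (j : I) (ν : Fin n → I) :
    Ep C n a j * kE C ν = kE C ν * Ep C n a j := by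
  rw [Ep_mul_Ee C h, Ee_mul_Ep C h]

variable (n) in
/-- the canonical representation of the KLR algebra in itself -/
noncomputable def canon : Rep C n (KA C n) where
  ε := Ep C n
  x := X C n
  τ := Ta C n
  εε a ha b hb i j := by
    refine alg_ext C fun ν => ?_
    simp only [mul_assoc, Ep_mul_Ee C ha, Ep_mul_Ee C hb]
    split_ifs <;> simp [Ep_mul_Ee C ha, Ep_mul_Ee C hb, *]
  εmul a ha i j := by
    refine alg_ext C fun ν => ?_
    by_cases hij : i = j
    · simp only [mul_assoc, Ep_mul_Ee C ha, hij]
      split_ifs <;> simp [Ep_mul_Ee C ha, *]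
    · simp only [mul_assoc, Ep_mul_Ee C ha, hij, if_false, zero_mul]
      split_ifs with h1
      · subst h1; simp [Ep_mul_Ee C ha, Ne.symm hij]
      · simp
  εsum a ha := by
    refine alg_ext C fun ν => ?_
    rw [Finset.sum_mul]
    simp [Ep_mul_Ee C ha]
  xx a ha b hb := by rw [X_eq C ha, X_eq C hb, Xx_Xx]
  xε a ha b hb j := by
    refine alg_ext C fun ν => ?_
    rw [mul_assoc, mul_assoc, X_Ee, ← mul_assoc (Ep C n b j), Ep_mul_Ee C hb]
    split_ifs <;> simp [X_Ee]
  τε l hl a ha h1 h2 j := by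
    refine alg_ext C fun ν => ?_
    have hs : Equiv.swap (⟨l, Nat.lt_of_succ_lt hl⟩ : Fin n) ⟨l + 1, hl⟩ ⟨a, ha⟩ = ⟨a, ha⟩ :=
      Equiv.swap_apply_of_ne_of_ne (by simpa using h1) (by simpa using h2)
    rw [mul_assoc, mul_assoc, Ta_eq C hl, Tt_Ee, ← mul_assoc (Ep C n _ j), Ep_mul_Ee C ha, Ep_mul_Ee C ha]
    simp only [Function.comp, hs]
    split_ifs <;> simp [Tt_Ee, Function.comp_def]
  τε0 l hl j := by
    refine alg_ext C fun ν => ?_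
    have h0 := Nat.lt_of_succ_lt hl
    have hs : Equiv.swap (⟨l, Nat.lt_of_succ_lt hl⟩ : Fin n) ⟨l + 1, hl⟩ ⟨l + 1, hl⟩ = ⟨l, h0⟩ :=
      Equiv.swap_apply_right _ _
    rw [mul_assoc, mul_assoc, Ta_eq C hl, Tt_Ee, ← mul_assoc (Ep C n _ j), Ep_mul_Ee C hl, Ep_mul_Ee C h0]
    simp only [Function.comp, hs]
    split_ifs <;> simp [Tt_Ee, Function.comp_def]
  τε1 l hl j := by
    refine alg_ext C fun ν => ?_
    have h0 := Nat.lt_of_succ_lt hl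
    have hs : Equiv.swap (⟨l, Nat.lt_of_succ_lt hl⟩ : Fin n) ⟨l + 1, hl⟩ ⟨l, h0⟩ = ⟨l + 1, hl⟩ :=
      Equiv.swap_apply_left _ _
    rw [mul_assoc, mul_assoc, Ta_eq C hl, Tt_Ee, ← mul_assoc (Ep C n _ j), Ep_mul_Ee C hl, Ep_mul_Ee C h0]
    simp only [Function.comp, hs]
    split_ifs <;> simp [Tt_Ee, Function.comp_def]
  ττ l l' h h' := by
    have hl : l + 1 < n := by omega
    rw [Ta_eq C hl, Ta_eq C h', Tt_Tt _ _ _ _ _ h]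
  τsq l hl i j := by
    refine alg_ext C fun ν => ?_
    have h0 := Nat.lt_of_succ_lt hl
    simp only [mul_assoc, Ep_mul_Ee C hl]
    split_ifs with h1
    · subst h1
      simp only [Ep_mul_Ee C h0]
      split_ifs with h2
      · subst h2
        rw [Ta_eq C hl, X_eq C h0, X_eq C hl, ← Tt_sq C l hl ν, mul_assoc]
      · simp
    · simp
  τx l hl a ha h1 h2 := by
    refine alg_ext C fun ν => ?_
    have hs : Equiv.swap (⟨l, Nat.lt_of_succ_lt hl⟩ : Fin n) ⟨l + 1, hl⟩ ⟨a, ha⟩ = ⟨a, ha⟩ :=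
      Equiv.swap_apply_of_ne_of_ne (by simpa using h1) (by simpa using h2)
    have := Tt_Xx C l hl ⟨a, ha⟩ ν
    rw [hs, if_neg (by simp [h1]), if_neg (by simp [h2]), sub_mul, sub_eq_zero] at this
    rw [X_eq C ha, Ta_eq C hl, this]
  τx0 l hl i j := by
    refine alg_ext C fun ν => ?_
    have h0 := Nat.lt_of_succ_lt hl
    have hs : Equiv.swap (⟨l, Nat.lt_of_succ_lt hl⟩ : Fin n) ⟨l + 1, hl⟩ ⟨l, h0⟩ = ⟨l + 1, hl⟩ :=
      Equiv.swap_apply_left _ _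
    have := Tt_Xx C l hl ⟨l, h0⟩ ν
    rw [hs] at this
    rw [X_eq C h0, X_eq C hl, Ta_eq C hl]
    simp only [mul_assoc, Ep_mul_Ee C hl, Ep_mul_Ee C h0, ite_mul, neg_mul, zero_mul]
    split_ifs with h1 h2 h3 
    · subst h1
      simp only [Ep_mul_Ee C h0]
      split_ifs with h3
      · subst h3; rw [this]; simp [h2]
      · simp
    · subst h1
      simp only [Ep_mul_Ee C h0]
      split_ifs with h3
      · subst h3; rw [this]; simp [h2]
      · simp
    · simp
    · simp
  τx1 l hl i j := by
    refine alg_ext C fun ν => ?_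
    have h0 := Nat.lt_of_succ_lt hl
    have hs : Equiv.swap (⟨l, Nat.lt_of_succ_lt hl⟩ : Fin n) ⟨l + 1, hl⟩ ⟨l + 1, hl⟩ = ⟨l, h0⟩ :=
      Equiv.swap_apply_right _ _
    have := Tt_Xx C l hl ⟨l + 1, hl⟩ ν
    rw [hs] at this
    rw [X_eq C h0, X_eq C hl, Ta_eq C hl]
    simp only [mul_assoc, Ep_mul_Ee C hl, Ep_mul_Ee C h0, ite_mul, neg_mul, zero_mul]
    split_ifs with h1 h2 h3 
    · subst h1
      simp only [Ep_mul_Ee C h0]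
      split_ifs with h3
      · subst h3; rw [this]; simp [h2]
      · simp
    · subst h1
      simp only [Ep_mul_Ee C h0]
      split_ifs with h3
      · subst h3; rw [this]; simp [h2]
      · simp
    · simp
    · simp
  braid l h2 i j i' := by
    refine alg_ext C fun ν => ?_
    have hl : l + 1 < n := by omega
    have h0 : l < n := by omega
    have := Tt_braid C l h2 ν
    rw [X_eq C h0, X_eq C hl, X_eq C h2, Ta_eq C hl, Ta_eq C (l := l+1) h2, ite_mul, zero_mul]
    simp only [mul_assoc (Ep C n l i * _), mul_assoc (Ep C n l i), Ep_mul_Ee C h2,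
      mul_assoc _ _ (kE C ν), Ep_mul_Ee C hl]
    by_cases e1 : ν ⟨l + 2, h2⟩ = i'
    · by_cases e2 : ν ⟨l + 1, hl⟩ = j
      · by_cases e3 : ν ⟨l, h0⟩ = i
        · subst e1 e2 e3
          simp only [if_true, Ep_mul_Ee C hl, Ep_mul_Ee C h0]
          rw [this]
        · simp [e1, e2, e3, Ep_mul_Ee C hl, Ep_mul_Ee C h0]
      · simp [e1, e2, Ep_mul_Ee C hl]
    · simp [e1]

end Canon
end KLR


namespace KLR
open Finset

variable {k : Type} [Field k] {I : Type} [Fintype I] [DecidableEq I]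

lemma exists_e {A : Type} [Ring A] [Algebra k A] (n : ℕ) : ∀ (ε : ℕ → I → A)
    (_ : ∀ a < n, ∀ b < n, ∀ i j, ε a i * ε b j = ε b j * ε a i)
    (_ : ∀ a < n, ∀ i j, ε a i * ε a j = if i = j then ε a i else 0)
    (_ : ∀ a < n, ∑ j, ε a j = 1),
    ∃ e : (Fin n → I) → A, (∑ ν, e ν = 1) ∧
      (∀ ν (a : Fin n) j, e ν * ε a j = if ν a = j then e ν else 0) ∧
      (∀ ν (a : Fin n) j, ε a j * e ν = if ν a = j then e ν else 0) ∧
      (∀ S : Subalgebra k A, (∀ a < n, ∀ j, ε a j ∈ S) → ∀ ν, e ν ∈ S) ∧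
      (∀ z : A, (∀ a < n, ∀ j, z * ε a j = ε a j * z) → ∀ ν, z * e ν = e ν * z) := by
  induction n with
  | zero =>
    intro ε _ _ _
    exact ⟨fun _ => 1, by simp, fun _ a => a.elim0, fun _ a => a.elim0,
      fun S _ _ => S.one_mem, fun z _ _ => by simp⟩
  | succ n ih =>
    intro ε h1 h2 h3
    obtain ⟨e, e1, e2, e3, e4, e5⟩ := ih (fun a => ε (a + 1))
      (fun a ha b hb => h1 (a + 1) (by omega) (b + 1) (by omega))
      (fun a ha => h2 (a + 1) (by omega)) (fun a ha => h3 (a + 1) (by omega))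
    have hc : ∀ i ν, ε 0 i * e ν = e ν * ε 0 i := fun i ν =>
      e5 (ε 0 i) (fun a ha j => h1 0 (by omega) (a + 1) (by omega) i j) ν
    refine ⟨fun ν => ε 0 (ν 0) * e (Fin.tail ν), ?_, ?_, ?_, ?_, ?_⟩
    · rw [← (Fin.consEquiv (fun _ : Fin (n + 1) => I)).sum_comp]
      rw [Fintype.sum_prod_type]
      have : ∀ (x : I) (y : Fin n → I), ε 0 ((Fin.consEquiv (fun _ : Fin (n + 1) => I)) (x, y) 0) *
          e (Fin.tail ((Fin.consEquiv (fun _ : Fin (n + 1) => I)) (x, y))) = ε 0 x * e y :=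
        fun x y => rfl
      simp only [this]
      simp only [← Finset.mul_sum, e1, mul_one]
      exact h3 0 (by omega)
    · intro ν a j
      refine Fin.cases ?_ (fun a => ?_) a
      · show ε 0 (ν 0) * e (Fin.tail ν) * ε 0 j = _
        rw [mul_assoc, ← hc, ← mul_assoc, h2 0 (by omega)]
        split_ifs <;> simp
      · show ε 0 (ν 0) * e (Fin.tail ν) * ε (a + 1) j = _
        rw [mul_assoc, e2 (Fin.tail ν) a j]
        show _ = if Fin.tail ν a = j then _ else _
        split_ifs <;> simp
    · intro ν a j
      refine Fin.cases ?_ (fun a => ?_) a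
      · show ε 0 j * (ε 0 (ν 0) * e (Fin.tail ν)) = _
        rw [← mul_assoc, h2 0 (by omega)]
        by_cases h : j = ν 0
        · simp [h]
        · simp [h, Ne.symm h]
      · show ε (a + 1) j * (ε 0 (ν 0) * e (Fin.tail ν)) = _
        rw [← mul_assoc, h1 (a + 1) (by omega) 0 (by omega), mul_assoc, e3 (Fin.tail ν) a j]
        show _ = if Fin.tail ν a = j then _ else _
        split_ifs <;> simp
    · intro S hS ν
      exact S.mul_mem (hS 0 (by omega) _) (e4 S (fun a ha => hS (a + 1) (by omega)) _)
    · intro z hz ν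
      rw [← mul_assoc, hz 0 (by omega), mul_assoc,
        e5 z (fun a ha => hz (a + 1) (by omega)), mul_assoc]

namespace Rep
variable {C : CartanDatum k I} {n : ℕ} {A : Type} [Ring A] [Algebra k A] (r : Rep C n A)

/-- full idempotents -/
noncomputable def e : (Fin n → I) → A := (exists_e (k := k) n r.ε r.εε r.εmul r.εsum).choose

lemma e_sum : ∑ ν, r.e ν = 1 := (exists_e (k := k) n r.ε r.εε r.εmul r.εsum).choose_spec.1
lemma e_ε (ν) (a : Fin n) (j) : r.e ν * r.ε a j = if ν a = j then r.e ν else 0 :=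
  (exists_e (k := k) n r.ε r.εε r.εmul r.εsum).choose_spec.2.1 ν a j
lemma ε_e (ν) (a : Fin n) (j) : r.ε a j * r.e ν = if ν a = j then r.e ν else 0 :=
  (exists_e (k := k) n r.ε r.εε r.εmul r.εsum).choose_spec.2.2.1 ν a j
lemma e_mem (S : Subalgebra k A) (h : ∀ a < n, ∀ j, r.ε a j ∈ S) (ν) : r.e ν ∈ S :=
  (exists_e (k := k) n r.ε r.εε r.εmul r.εsum).choose_spec.2.2.2.1 S h ν
lemma e_comm (z : A) (h : ∀ a < n, ∀ j, z * r.ε a j = r.ε a j * z) (ν) :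
    z * r.e ν = r.e ν * z :=
  (exists_e (k := k) n r.ε r.εε r.εmul r.εsum).choose_spec.2.2.2.2 z h ν

lemma sandwich (ν μ : Fin n → I) (σ : Fin n → Fin n) (z : A)
    (hz : ∀ (a : Fin n) j, z * r.ε a j = r.ε (σ a) j * z) (h : ν ∘ σ ≠ μ) :
    r.e ν * z * r.e μ = 0 := by
  obtain ⟨a, ha⟩ := Function.ne_iff.mp h
  have h1 : r.e μ = r.ε a (μ a) * r.e μ := by rw [r.ε_e]; simp
  rw [h1, mul_assoc, ← mul_assoc z, hz, mul_assoc, ← mul_assoc, r.e_ε]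
  rw [if_neg (by simpa using ha)]
  simp

lemma e_mul (ν ν' : Fin n → I) : r.e ν * r.e ν' = if ν = ν' then r.e ν else 0 := by
  have key : ∀ μ, μ ≠ ν → r.e μ * r.e ν = 0 := fun μ h => by
    have := r.sandwich μ ν id 1 (by simp) (by simpa using h)
    simpa using this
  split_ifs with h
  · subst h
    conv_rhs => rw [← one_mul (r.e ν), ← r.e_sum, Finset.sum_mul]
    rw [Finset.sum_eq_single ν]
    · intro μ _ hμ; exact key μ hμ
    · simp
  · have := r.sandwich ν ν' id 1 (by simp) (by simpa using h)
    simpa using this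

lemma twist (σ : Equiv.Perm (Fin n)) (z : A)
    (hz : ∀ (a : Fin n) j, z * r.ε a j = r.ε (σ a) j * z) (ν : Fin n → I) :
    z * r.e ν = r.e (ν ∘ σ.symm) * z := by
  have h1 : z * r.e ν = r.e (ν ∘ σ.symm) * z * r.e ν := by
    conv_lhs => rw [← one_mul z, ← r.e_sum, Finset.sum_mul, Finset.sum_mul]
    rw [Finset.sum_eq_single (ν ∘ σ.symm)]
    · intro μ _ hμ
      refine r.sandwich μ ν σ z hz fun h => hμ ?_
      rw [← h]; ext a; simp
    · simp
  have h2 : r.e (ν ∘ σ.symm) * z = r.e (ν ∘ σ.symm) * z * r.e ν := by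
    conv_lhs => rw [← mul_one (_ * z), ← r.e_sum, Finset.mul_sum]
    rw [Finset.sum_eq_single ν]
    · intro μ _ hμ
      refine r.sandwich _ μ σ z hz fun h => hμ ?_
      rw [← h]; ext a; simp
    · simp
  rw [h1, ← h2]

lemma τε_swap (l : ℕ) (h : l + 1 < n) (a : Fin n) (j : I) : r.τ l * r.ε a j =
    r.ε (Equiv.swap (⟨l, Nat.lt_of_succ_lt h⟩ : Fin n) ⟨l + 1, h⟩ a) j * r.τ l := by
  by_cases h1 : a = ⟨l, Nat.lt_of_succ_lt h⟩
  · subst h1; rw [Equiv.swap_apply_left]; exact r.τε0 l h j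
  by_cases h2 : a = ⟨l + 1, h⟩
  · subst h2; rw [Equiv.swap_apply_right]; exact r.τε1 l h j
  rw [Equiv.swap_apply_of_ne_of_ne h1 h2]
  exact r.τε l h a a.2 (fun h' => h1 (Fin.ext h')) (fun h' => h2 (Fin.ext h')) j

/-- the map on generators -/
noncomputable def gmap : Gen I n → A
  | .e ν => r.e ν
  | .x a => r.x a
  | .tau l _ => r.τ l

/-- lift to the free algebra -/
noncomputable def fl : FA k I n →ₐ[k] A := FreeAlgebra.lift k r.gmap

@[simp] lemma fl_ge (ν) : r.fl (ge k ν) = r.e ν := by simp [fl, ge, gmap]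
@[simp] lemma fl_gx (a) : r.fl (gx k a) = r.x a := by simp [fl, gx, gmap]
@[simp] lemma fl_gt (l h) : r.fl (gt k l h) = r.τ l := by simp [fl, gt, gmap]

lemma ee2 (ν : Fin n → I) (a b : Fin n) : r.e ν = r.ε a (ν a) * r.ε b (ν b) * r.e ν := by
  rw [mul_assoc, r.ε_e, if_pos rfl, r.ε_e, if_pos rfl]
lemma ee3 (ν : Fin n → I) (a b c : Fin n) :
    r.e ν = r.ε a (ν a) * r.ε b (ν b) * r.ε c (ν c) * r.e ν := by
  rw [mul_assoc, mul_assoc, r.ε_e, if_pos rfl, r.ε_e, if_pos rfl, r.ε_e, if_pos rfl]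

lemma fl_rel {a b : FA k I n} (h : Rel C n a b) : r.fl a = r.fl b := by
  cases h with
  | ee ν ν' => rw [map_mul, fl_ge, fl_ge, r.e_mul]; split_ifs <;> simp
  | esum => simp [r.e_sum]
  | xx a b => simp [r.xx a a.2 b b.2]
  | xe a ν =>
    simp only [map_mul, fl_gx, fl_ge]
    exact r.e_comm _ (fun b hb j => r.xε a a.2 b hb j) ν
  | taue l h ν =>
    simp only [map_mul, fl_gt, fl_ge]
    rw [r.twist _ _ (r.τε_swap l h), Equiv.symm_swap]
  | tautau l h l' h' hl =>
    simp only [map_mul, fl_gt]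
    rcases hl with hl | hl
    · exact r.ττ l l' hl h'
    · exact (r.ττ l' l hl h).symm
  | tausq l h ν =>
    simp only [map_mul, map_pow, fl_gt, fl_ge, Qel_map, fl_gx]
    rw [r.ee2 ν ⟨l, Nat.lt_of_succ_lt h⟩ ⟨l + 1, h⟩, ← mul_assoc, sq, r.τsq l h, mul_assoc]
  | taux l h m ν =>
    have h0 := Nat.lt_of_succ_lt h
    rw [map_mul, map_sub]
    simp only [map_mul, fl_gt, fl_gx, fl_ge]
    by_cases h1 : m = ⟨l, h0⟩
    · subst h1
      rw [Equiv.swap_apply_left, r.ee2 ν ⟨l, Nat.lt_of_succ_lt h⟩ ⟨l + 1, h⟩, ← mul_assoc,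
        r.τx0 l h]
      by_cases h2 : ν ⟨l, h0⟩ = ν ⟨l + 1, h⟩
      · rw [if_pos h2, if_pos ⟨rfl, h2⟩, neg_mul, ← r.ee2 ν ⟨l, h0⟩ ⟨l + 1, h⟩, map_neg, fl_ge]
      · rw [if_neg h2, if_neg (by simp [h2]), if_neg (by simp [h2])]; simp
    by_cases h2 : m = ⟨l + 1, h⟩
    · subst h2
      rw [Equiv.swap_apply_right, r.ee2 ν ⟨l, Nat.lt_of_succ_lt h⟩ ⟨l + 1, h⟩, ← mul_assoc,
        r.τx1 l h]
      by_cases h2 : ν ⟨l, h0⟩ = ν ⟨l + 1, h⟩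
      · rw [if_pos h2, if_neg (by simp), if_pos ⟨rfl, h2⟩, ← r.ee2 ν ⟨l, h0⟩ ⟨l + 1, h⟩, fl_ge]
      · rw [if_neg h2, if_neg (by simp), if_neg (by simp [h2])]; simp
    rw [Equiv.swap_apply_of_ne_of_ne h1 h2, if_neg (by simp [h1]), if_neg (by simp [h2]),
      r.τx l h m m.2 (fun h' => h1 (Fin.ext h')) (fun h' => h2 (Fin.ext h'))]
    simp
  | braid l h2 ν =>
    have h1 : l + 1 < n := Nat.lt_of_succ_lt h2
    have h0 : l < n := Nat.lt_of_succ_lt h1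
    rw [map_mul, map_sub]
    simp only [map_mul, fl_gt, fl_ge]
    rw [r.ee3 ν ⟨l, h0⟩ ⟨l + 1, h1⟩ ⟨l + 2, h2⟩, ← mul_assoc, r.braid l h2]
    split_ifs with h
    · rw [map_mul, Qdiff_map, fl_gx, fl_gx, fl_gx, fl_ge, mul_assoc, ← r.ee3 ν ⟨l, h0⟩ ⟨l + 1, h1⟩ ⟨l + 2, h2⟩]
    · simp

/-- the induced algebra morphism from the KLR algebra -/
noncomputable def lift : KA C n →ₐ[k] A :=
  RingQuot.liftAlgHom (S := k) ⟨r.fl, fun _ _ h => r.fl_rel h⟩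

lemma lift_q (z : FA k I n) : r.lift (qK C n z) = r.fl z :=
  RingQuot.liftAlgHom_mkAlgHom_apply k r.fl _ z

@[simp] lemma lift_kE (ν) : r.lift (kE C ν) = r.e ν := by simp [kE, lift_q]

lemma lift_X {a : ℕ} (h : a < n) : r.lift (X C n a) = r.x a := by
  rw [X_eq C h, kX, lift_q, fl_gx]
lemma lift_Ta {l : ℕ} (h : l + 1 < n) : r.lift (Ta C n l) = r.τ l := by
  rw [Ta_eq C h, kT, lift_q, fl_gt]
lemma lift_Ep {a : ℕ} (h : a < n) (j) : r.lift (Ep C n a j) = r.ε a j := by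
  unfold Ep
  rw [map_sum]
  conv_rhs => rw [← one_mul (r.ε a j), ← r.e_sum, Finset.sum_mul]
  refine Finset.sum_congr rfl fun ν _ => ?_
  have := r.e_ε ν ⟨a, h⟩ j
  simp only at this
  rw [this]
  simp only [h, dite_true]
  split_ifs <;> simp

end Rep

section
variable (C : CartanDatum k I) {n : ℕ}

lemma canon_e (ν : Fin n → I) : (canon C n).e ν = kE C ν := by
  refine alg_ext C fun μ => ?_
  rw [Ee_mul]
  by_cases h : μ = ν
  · subst h
    rw [if_pos rfl]
    have h2 : ∀ μ', μ' ≠ μ → (canon C n).e μ' * kE C μ = 0 := fun μ' h => by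
      obtain ⟨a, ha⟩ := Function.ne_iff.mp h
      have h3 : kE C μ = Ep C n a (μ a) * kE C μ := by rw [Ep_mul_Ee C a.2]; simp
      rw [h3, ← mul_assoc]
      have h4 : (canon C n).e μ' * Ep C n a (μ a) = _ := (canon C n).e_ε μ' a (μ a)
      rw [h4, if_neg ha, zero_mul]
    conv_rhs => rw [← one_mul (kE C μ), ← (canon C n).e_sum, Finset.sum_mul]
    rw [Finset.sum_eq_single μ]
    · intro b _ hb; exact h2 b hb
    · simp
  · rw [if_neg (Ne.symm h)]
    obtain ⟨a, ha⟩ := Function.ne_iff.mp h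
    have h3 : kE C μ = Ep C n a (μ a) * kE C μ := by rw [Ep_mul_Ee C a.2]; simp
    rw [h3, ← mul_assoc]
    have h4 : (canon C n).e ν * Ep C n a (μ a) = _ := (canon C n).e_ε ν a (μ a)
    rw [h4, if_neg (Ne.symm ha), zero_mul]

lemma qK_surj : Function.Surjective (qK C n) := RingQuot.mkAlgHom_surjective k (Rel C n)

/-- `KA` is generated by the local generators. -/
lemma KA_top (S : Subalgebra k (KA C n)) (hE : ∀ a < n, ∀ j, Ep C n a j ∈ S)
    (hX : ∀ a < n, X C n a ∈ S) (hT : ∀ l, l + 1 < n → Ta C n l ∈ S) (z : KA C n) : z ∈ S := by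
  obtain ⟨w, rfl⟩ := qK_surj C z
  induction w using FreeAlgebra.induction with
  | grade0 c => simpa using S.algebraMap_mem c
  | grade1 g =>
    cases g with
    | e ν =>
      have : qK C n (FreeAlgebra.ι k (Gen.e ν)) = (canon C n).e ν := by rw [canon_e]; rfl
      rw [this]; exact (canon C n).e_mem S hE ν
    | x a =>
      have := hX a a.2
      rw [X_eq C a.2] at this; exact this
    | tau l h =>
      have := hT l h
      rw [Ta_eq C h] at this; exact this
  | mul a b ha hb => rw [map_mul]; exact S.mul_mem ha hb
  | add a b ha hb => rw [map_add]; exact S.add_mem ha hb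

lemma KA_hom_ext {A : Type} [Ring A] [Algebra k A] {f g : KA C n →ₐ[k] A}
    (hE : ∀ a < n, ∀ j, f (Ep C n a j) = g (Ep C n a j))
    (hX : ∀ a < n, f (X C n a) = g (X C n a))
    (hT : ∀ l, l + 1 < n → f (Ta C n l) = g (Ta C n l)) : f = g := by
  ext z
  exact KA_top C (AlgHom.equalizer f g) (by simpa using hE) (by simpa using hX)
    (by simpa using hT) z

end
end KLR


namespace KLR
open Finset

variable {k : Type} [Field k] {I : Type} [Fintype I] [DecidableEq I]

section Qprops
variable (C : CartanDatum k I) {A : Type} [CommRing A] [Algebra k A]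

lemma Qel_symm (i j : I) (u v : A) : Qel C i j u v = Qel C j i v u := by
  unfold Qel
  by_cases h : i = j
  · simp [h]
  rw [if_neg h, if_neg (Ne.symm h), Finset.sum_comm]
  refine Finset.sum_congr rfl fun q _ => Finset.sum_congr rfl fun p _ => ?_
  have hs := C.symmetrize i j
  have : (C.d i * (p : ℤ) + C.d j * (q : ℤ) = -(C.d i * C.a i j)) ↔
      (C.d j * (q : ℤ) + C.d i * (p : ℤ) = -(C.d j * C.a j i)) := by
    rw [hs, add_comm]
  rw [C.t_symm i j p q, mul_comm (u ^ p)]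
  simp only [this]

lemma Qdiff_spec (i j : I) (u v w : A) :
    (u - w) * Qdiff C i j u v w = Qel C i j u v - Qel C i j w v := by
  unfold Qel Qdiff
  by_cases h : i = j
  · simp [h]
  simp only [if_neg h]
  rw [Finset.mul_sum, ← Finset.sum_sub_distrib]
  refine Finset.sum_congr rfl fun p _ => ?_
  rw [Finset.mul_sum, ← Finset.sum_sub_distrib]
  refine Finset.sum_congr rfl fun q _ => ?_
  split_ifs
  · rw [mul_smul_comm, ← smul_sub, ← mul_assoc, mul_comm (u - w), (Commute.all u w).geom_sum₂_mul,
      sub_mul]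
  · simp

variable (I) in
/-- an auxiliary ordering -/
noncomputable def ord (i : I) : ℕ := (Fintype.equivFin I i : ℕ)

lemma ord_inj {i j : I} (h : ord I i = ord I j) : i = j :=
  (Fintype.equivFin I).injective (Fin.ext h)

open Classical in
/-- half of `Q` -/
noncomputable def Pp (i j : I) (u v : A) : A := if ord I i < ord I j then Qel C i j u v else 1

lemma Pp_mul {i j : I} (h : i ≠ j) (u v : A) : Pp C i j u v * Pp C j i v u = Qel C i j u v := by
  unfold Pp
  have : ord I i ≠ ord I j := fun h' => h (ord_inj h')
  split_ifs <;> try omega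
  · simp
  · simp [Qel_symm C i j]
end Qprops

/-- Points of the function representation. -/
structure Pt (C : CartanDatum k I) (L : Type) [Field L] [Algebra k L] (n : ℕ) where
  ν : ℕ → I
  z : ℕ → L
  inj : ∀ a < n, ∀ b < n, z a = z b → a = b
  ne : ∀ a < n, ∀ b < n, ν a ≠ ν b → Qel C (ν a) (ν b) (z a) (z b) ≠ 0

namespace Pt
variable {C : CartanDatum k I} {L : Type} [Field L] [Algebra k L] {n : ℕ}

lemma ext' {ω ω' : Pt C L n} (h1 : ∀ a, ω.ν a = ω'.ν a) (h2 : ∀ a, ω.z a = ω'.z a) : ω = ω' := by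
  cases ω; cases ω'
  have e1 := funext h1
  have e2 := funext h2
  simp only at e1 e2
  subst e1 e2; rfl

/-- action of simple transpositions -/
def sw (l : ℕ) (h : l + 1 < n) (ω : Pt C L n) : Pt C L n where
  ν a := ω.ν (Equiv.swap l (l + 1) a)
  z a := ω.z (Equiv.swap l (l + 1) a)
  inj a ha b hb hab := by
    have key : ∀ a < n, Equiv.swap l (l + 1) a < n := fun a ha => by
      rw [Equiv.swap_apply_def]; split_ifs <;> omega
    exact (Equiv.swap l (l + 1)).injective (ω.inj _ (key a ha) _ (key b hb) hab)
  ne a ha b hb hab := by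
    have key : ∀ a < n, Equiv.swap l (l + 1) a < n := fun a ha => by
      rw [Equiv.swap_apply_def]; split_ifs <;> omega
    exact ω.ne _ (key a ha) _ (key b hb) hab

variable (l : ℕ) (h : l + 1 < n) (ω : Pt C L n)

@[simp] lemma sw_sw : (ω.sw l h).sw l h = ω := by
  apply ext' <;> intro a <;> simp [sw]
lemma sw_comm (l' : ℕ) (h' : l' + 1 < n) (hl : l + 1 < l') :
    (ω.sw l h).sw l' h' = (ω.sw l' h').sw l h := by
  have : ∀ a, Equiv.swap l (l + 1) (Equiv.swap l' (l' + 1) a) =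
    Equiv.swap l' (l' + 1) (Equiv.swap l (l + 1) a) := by
    intro a
    simp only [Equiv.swap_apply_def]
    split_ifs <;> omega
  apply ext' <;> intro a <;> simp [sw, this]
lemma sw_braid (h' : l + 1 + 1 < n) : ((ω.sw l h).sw (l + 1) h').sw l h =
    ((ω.sw (l + 1) h').sw l h).sw (l + 1) h' := by
  have : ∀ a, Equiv.swap l (l + 1) (Equiv.swap (l + 1) (l + 1 + 1) (Equiv.swap l (l + 1) a)) =
    Equiv.swap (l + 1) (l + 1 + 1) (Equiv.swap l (l + 1) (Equiv.swap (l + 1) (l + 1 + 1) a)) := by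
    intro a
    simp only [Equiv.swap_apply_def]
    split_ifs <;> omega
  apply ext' <;> intro a <;> simp [sw, this]

@[simp] lemma sw_ν0 : (ω.sw l h).ν l = ω.ν (l + 1) := by simp [sw]
@[simp] lemma sw_ν1 : (ω.sw l h).ν (l + 1) = ω.ν l := by simp [sw]
@[simp] lemma sw_z0 : (ω.sw l h).z l = ω.z (l + 1) := by simp [sw]
@[simp] lemma sw_z1 : (ω.sw l h).z (l + 1) = ω.z l := by simp [sw]
lemma sw_νn {a : ℕ} (h1 : a ≠ l) (h2 : a ≠ l + 1) : (ω.sw l h).ν a = ω.ν a := by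
  simp [sw, Equiv.swap_apply_of_ne_of_ne h1 h2]
lemma sw_zn {a : ℕ} (h1 : a ≠ l) (h2 : a ≠ l + 1) : (ω.sw l h).z a = ω.z a := by
  simp [sw, Equiv.swap_apply_of_ne_of_ne h1 h2]
@[simp] lemma sw_ν2 : (ω.sw l h).ν (l + 2) = ω.ν (l + 2) := sw_νn _ _ _ (by omega) (by omega)
@[simp] lemma sw_z2 : (ω.sw l h).z (l + 2) = ω.z (l + 2) := sw_zn _ _ _ (by omega) (by omega)
@[simp] lemma sw_ν2' : (ω.sw l h).ν (l + 1 + 1) = ω.ν (l + 2) := sw_νn _ _ _ (by omega) (by omega)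
@[simp] lemma sw_z2' : (ω.sw l h).z (l + 1 + 1) = ω.z (l + 2) := sw_zn _ _ _ (by omega) (by omega)
@[simp] lemma sw'_ν2 (h : l + 1 + 1 < n) : (ω.sw (l + 1) h).ν (l + 2) = ω.ν (l + 1) := by simp [sw]
@[simp] lemma sw'_z2 (h : l + 1 + 1 < n) : (ω.sw (l + 1) h).z (l + 2) = ω.z (l + 1) := by simp [sw]
@[simp] lemma sw'_ν (h : l + 1 + 1 < n) : (ω.sw (l + 1) h).ν l = ω.ν l :=
  sw_νn _ _ _ (by omega) (by omega)
@[simp] lemma sw'_z (h : l + 1 + 1 < n) : (ω.sw (l + 1) h).z l = ω.z l :=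
  sw_zn _ _ _ (by omega) (by omega)
end Pt

section FRep
variable (C : CartanDatum k I) (L : Type) [Field L] [Algebra k L] (n : ℕ)

/-- multiplication operators -/
noncomputable abbrev mulOp : (Pt C L n → L) →ₐ[k] Module.End k (Pt C L n → L) :=
  Algebra.lmul k (Pt C L n → L)

/-- value of `τ` -/
noncomputable def tauV (l : ℕ) (F : Pt C L n → L) (ω : Pt C L n) : L :=
  if h : l + 1 < n then
    if ω.ν l = ω.ν (l + 1) then (F (ω.sw l h) - F ω) / (ω.z l - ω.z (l + 1))
    else Pp C (ω.ν l) (ω.ν (l + 1)) (ω.z l) (ω.z (l + 1)) * F (ω.sw l h)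
  else 0

/-- the operator `τ` -/
noncomputable def tauOp (l : ℕ) : Module.End k (Pt C L n → L) where
  toFun := tauV C L n l
  map_add' F G := by
    ext ω
    simp only [tauV, Pi.add_apply]
    split_ifs <;> ring
  map_smul' c F := by
    ext ω
    simp only [tauV, Pi.smul_apply, RingHom.id_apply, Algebra.smul_def]
    split_ifs <;> ring

variable {C L n}

lemma tauOp_apply {l : ℕ} (h : l + 1 < n) (F : Pt C L n → L) (ω : Pt C L n) :
    tauOp C L n l F ω = 
    if ω.ν l = ω.ν (l + 1) then (F (ω.sw l h) - F ω) / (ω.z l - ω.z (l + 1))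
    else Pp C (ω.ν l) (ω.ν (l + 1)) (ω.z l) (ω.z (l + 1)) * F (ω.sw l h) := by
  show tauV C L n l F ω = _
  rw [tauV, dif_pos h]

lemma tau_sq_apply {l : ℕ} (h : l + 1 < n) (F : Pt C L n → L) (ω : Pt C L n) :
    tauOp C L n l (tauOp C L n l F) ω =
      Qel C (ω.ν l) (ω.ν (l + 1)) (ω.z l) (ω.z (l + 1)) * F ω := by
  have hz : ω.z l - ω.z (l + 1) ≠ 0 := fun h' => by
    have := ω.inj l (by omega) (l + 1) h (sub_eq_zero.mp h'); omega
  have hz' : ω.z (l + 1) - ω.z l ≠ 0 := fun h' => hz (by rw [← neg_sub, h', neg_zero])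
  by_cases h1 : ω.ν l = ω.ν (l + 1)
  · simp only [tauOp_apply h, h1, Pt.sw_ν0, Pt.sw_ν1, Pt.sw_z0, Pt.sw_z1, Pt.sw_sw, if_true]
    simp only [Qel, if_true]
    field_simp
    ring
  · simp only [tauOp_apply h, h1, Ne.symm h1, Pt.sw_ν0, Pt.sw_ν1, Pt.sw_z0, Pt.sw_z1, Pt.sw_sw,
      if_false]
    rw [← mul_assoc, Pp_mul C h1]

lemma tau_braid_apply {l : ℕ} (h2 : l + 2 < n) (F : Pt C L n → L) (ω : Pt C L n) :
    tauOp C L n (l + 1) (tauOp C L n l (tauOp C L n (l + 1) F)) ω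
      - tauOp C L n l (tauOp C L n (l + 1) (tauOp C L n l F)) ω =
      if ω.ν l = ω.ν (l + 2) then
        Qdiff C (ω.ν l) (ω.ν (l + 1)) (ω.z l) (ω.z (l + 1)) (ω.z (l + 2)) * F ω else 0 := by
  have h1 : l + 1 < n := by omega
  have h2' : l + 1 + 1 < n := h2
  have z01 : ω.z l - ω.z (l + 1) ≠ 0 := fun h' => by
    have := ω.inj l (by omega) (l + 1) h1 (sub_eq_zero.mp h'); omega
  have z02 : ω.z l - ω.z (l + 2) ≠ 0 := fun h' => by
    have := ω.inj l (by omega) (l + 2) h2 (sub_eq_zero.mp h'); omega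
  have z12 : ω.z (l + 1) - ω.z (l + 2) ≠ 0 := fun h' => by
    have := ω.inj (l + 1) (by omega) (l + 2) h2 (sub_eq_zero.mp h'); omega
  have z10 : ω.z (l + 1) - ω.z l ≠ 0 := fun h' => z01 (by rw [← neg_sub, h', neg_zero])
  have z20 : ω.z (l + 2) - ω.z l ≠ 0 := fun h' => z02 (by rw [← neg_sub, h', neg_zero])
  have z21 : ω.z (l + 2) - ω.z (l + 1) ≠ 0 := fun h' => z12 (by rw [← neg_sub, h', neg_zero])
  have hQ := Qdiff_spec C (ω.ν l) (ω.ν (l + 1)) (ω.z l) (ω.z (l + 1)) (ω.z (l + 2))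
  have e2 : ∀ (f : ℕ → L), f (l + 1 + 1) = f (l + 2) := fun _ => rfl
  have e3 : ∀ (f : ℕ → I), f (l + 1 + 1) = f (l + 2) := fun _ => rfl
  have ha : ω.ν (l + 1 + 1) = ω.ν (l + 2) := rfl
  have hb : ω.z (l + 1 + 1) = ω.z (l + 2) := rfl
  simp only [tauOp_apply h1, tauOp_apply h2', e2 (Pt.z _), e3 (Pt.ν _), Pt.sw_ν0, Pt.sw_ν1, Pt.sw_z0, Pt.sw_z1,
    Pt.sw_ν2, Pt.sw_z2, Pt.sw'_ν2, Pt.sw'_z2, Pt.sw'_ν, Pt.sw'_z, Pt.sw_sw, Pt.sw_braid _ _ _ h2']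
  generalize F ω = F0
  generalize F (ω.sw l h1) = F1
  generalize F (ω.sw (l + 1) h2') = F2
  generalize F ((ω.sw l h1).sw (l + 1) h2') = F3
  generalize F ((ω.sw (l + 1) h2').sw l h1) = F4
  generalize F (((ω.sw (l + 1) h2').sw l h1).sw (l + 1) h2') = F5
  generalize ω.z l = u at *
  generalize ω.z (l + 1) = v at *
  generalize ω.z (l + 2) = w at *
  generalize ω.ν l = a at *
  generalize ω.ν (l + 1) = b at *
  generalize ω.ν (l + 2) = c at *
  by_cases hab : a = b
  · subst hab
    by_cases hac : a = c
    · subst hac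
      simp only [if_true, Qdiff]
      field_simp
      ring
    · simp only [if_true, hac, Ne.symm hac, if_false]
      field_simp
      ring
  · by_cases hbc : b = c
    · subst hbc
      simp only [if_true, hab, Ne.symm hab, if_false]
      field_simp
      ring
    · by_cases hac : a = c
      · subst hac
        simp only [if_true, hab, Ne.symm hab, if_false]
        rw [← Pp_mul C hab, ← Pp_mul C hab] at hQ
        generalize Qdiff C a b u v w = D at *
        field_simp
        linear_combination (-F0) * hQ
      · simp only [hab, hbc, hac, Ne.symm hab, Ne.symm hbc, Ne.symm hac, if_false]
        ring

variable (C L n) in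
open Classical in
/-- indicator functions -/
noncomputable def ind (a : ℕ) (j : I) : Pt C L n → L := fun ω => if ω.ν a = j then 1 else 0

lemma mulOp_apply' (f F : Pt C L n → L) (ω) : (mulOp C L n f : Module.End k (Pt C L n → L)) F ω = f ω * F ω := rfl

lemma Qel_mulOp (i j : I) (f g F : Pt C L n → L) (ω) :
    Qel C i j (mulOp C L n f) (mulOp C L n g) F ω = Qel C i j (f ω) (g ω) * F ω := by
  rw [← Qel_map, mulOp_apply']
  congr 1
  exact Qel_map C (Pi.evalAlgHom k (fun _ : Pt C L n => L) ω) i j f g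

lemma Qdiff_mulOp (i j : I) (f g h F : Pt C L n → L) (ω) :
    Qdiff C i j (mulOp C L n f) (mulOp C L n g) (mulOp C L n h) F ω =
      Qdiff C i j (f ω) (g ω) (h ω) * F ω := by
  rw [← Qdiff_map, mulOp_apply']
  congr 1
  exact Qdiff_map C (Pi.evalAlgHom k (fun _ : Pt C L n => L) ω) i j f g h

lemma tau_comm_mul {l : ℕ} (h : l + 1 < n) (f g : Pt C L n → L) (hf : ∀ ω, f ω = g (ω.sw l h))
    (hg : ∀ ω : Pt C L n, ω.ν l = ω.ν (l + 1) → f ω = g ω) :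
    tauOp C L n l * mulOp C L n g = mulOp C L n f * tauOp C L n l := by
  apply LinearMap.ext; intro F; funext ω
  simp only [Module.End.mul_apply, mulOp_apply', tauOp_apply h, ← hf]
  split_ifs with h1
  · rw [← hg ω h1]; ring
  · ring

variable (C L n) in
/-- the function representation -/
noncomputable def fRep : Rep C n (Module.End k (Pt C L n → L)) where
  ε a j := mulOp C L n (ind C L n a j)
  x a := mulOp C L n (fun ω => ω.z a)
  τ l := tauOp C L n l
  εε a _ b _ i j := by rw [← map_mul, ← map_mul, mul_comm]
  εmul a _ i j := by
    rw [← map_mul]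
    split_ifs with h
    · congr 1; ext ω; simp only [ind, Pi.mul_apply]; subst h; split_ifs <;> simp
    · have : ind C L n a i * ind C L n a j = (0 : Pt C L n → L) := by
        ext ω; simp only [ind, Pi.mul_apply, Pi.zero_apply]
        by_cases h1 : ω.ν a = i
        · rw [if_neg (c := ω.ν a = j) (fun h2 => h (h1.symm.trans h2)), mul_zero]
        · rw [if_neg h1, zero_mul]
      rw [this, map_zero]
  εsum a _ := by
    have : (∑ j, ind C L n a j) = (1 : Pt C L n → L) := by ext ω; simp [ind]
    rw [← map_sum, this, map_one]
  xx a _ b _ := by rw [← map_mul, ← map_mul, mul_comm]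
  xε a _ b _ j := by rw [← map_mul, ← map_mul, mul_comm]
  τε l h a _ h1 h2 j := by
    refine tau_comm_mul h _ _ (fun ω => ?_) fun ω _ => rfl
    simp [ind, Pt.sw_νn _ _ _ h1 h2]
  τε0 l h j := by
    refine tau_comm_mul h _ _ (fun ω => ?_) fun ω h => ?_
    · simp [ind]
    · simp [ind, h]
  τε1 l h j := by
    refine tau_comm_mul h _ _ (fun ω => ?_) fun ω h => ?_
    · simp [ind]
    · simp [ind, h]
  ττ l l' h1 h2 := by
    have h0 : l + 1 < n := by omega
    apply LinearMap.ext; intro F; funext ω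
    simp only [Module.End.mul_apply, tauOp_apply h0, tauOp_apply h2]
    rw [Pt.sw_νn _ _ _ (show l' ≠ l by omega) (show l' ≠ l + 1 by omega),
      Pt.sw_νn _ _ _ (show l' + 1 ≠ l by omega) (show l' + 1 ≠ l + 1 by omega),
      Pt.sw_zn _ _ _ (show l' ≠ l by omega) (show l' ≠ l + 1 by omega),
      Pt.sw_zn _ _ _ (show l' + 1 ≠ l by omega) (show l' + 1 ≠ l + 1 by omega),
      Pt.sw_νn _ _ _ (show l ≠ l' by omega) (show l ≠ l' + 1 by omega),
      Pt.sw_νn _ _ _ (show l + 1 ≠ l' by omega) (show l + 1 ≠ l' + 1 by omega),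
      Pt.sw_zn _ _ _ (show l ≠ l' by omega) (show l ≠ l' + 1 by omega),
      Pt.sw_zn _ _ _ (show l + 1 ≠ l' by omega) (show l + 1 ≠ l' + 1 by omega),
      Pt.sw_comm _ _ _ _ h2 h1]
    split_ifs <;> ring
  τsq l h i j := by
    apply LinearMap.ext; intro F; funext ω
    simp only [Module.End.mul_apply, tau_sq_apply h, Qel_mulOp, mulOp_apply', ind]
    split_ifs with h1 h2
    · subst h1 h2; rfl
    all_goals simp
  τx l h a _ h1 h2 := by
    refine tau_comm_mul h _ _ (fun ω => ?_) fun ω _ => rfl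
    rw [Pt.sw_zn _ _ _ h1 h2]
  τx0 l h i j := by
    apply LinearMap.ext; intro F; funext ω
    have hz : ω.z l - ω.z (l + 1) ≠ 0 := fun h' => by
      have := ω.inj l (by omega) (l + 1) h (sub_eq_zero.mp h'); omega
    rw [Module.End.mul_apply, LinearMap.sub_apply]
    simp only [Pi.sub_apply, Module.End.mul_apply]
    generalize hG : (mulOp C L n (ind C L n l i) : Module.End k (Pt C L n → L))
      ((mulOp C L n (ind C L n (l + 1) j) : Module.End k (Pt C L n → L)) F) = G
    have e1 : (if i = j then -((mulOp C L n (ind C L n l i) : Module.End k (Pt C L n → L)) *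
      (mulOp C L n (ind C L n (l + 1) j) : Module.End k (Pt C L n → L))) else 0) F ω =
      if i = j then - G ω else 0 := by
      split_ifs
      · simp [← hG, Module.End.mul_apply]
      · simp
    rw [e1]
    have e2 : G ω = (if ω.ν l = i then 1 else 0) * ((if ω.ν (l + 1) = j then 1 else 0) * F ω) := by
      rw [← hG, mulOp_apply', mulOp_apply']; rfl
    simp only [mulOp_apply', tauOp_apply h, Pt.sw_z0]
    by_cases h1 : ω.ν l = i
    · by_cases h2 : ω.ν (l + 1) = j
      · subst h1 h2
        split_ifs
        · field_simp; ring
        · ring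
      · have : G ω = 0 := by rw [e2]; simp [h2]
        simp only [this]
        split_ifs <;> ring
    · have : G ω = 0 := by rw [e2]; simp [h1]
      simp only [this]
      split_ifs <;> ring
  τx1 l h i j := by
    apply LinearMap.ext; intro F; funext ω
    have hz : ω.z l - ω.z (l + 1) ≠ 0 := fun h' => by
      have := ω.inj l (by omega) (l + 1) h (sub_eq_zero.mp h'); omega
    rw [Module.End.mul_apply, LinearMap.sub_apply]
    simp only [Pi.sub_apply, Module.End.mul_apply]
    generalize hG : (mulOp C L n (ind C L n l i) : Module.End k (Pt C L n → L))
      ((mulOp C L n (ind C L n (l + 1) j) : Module.End k (Pt C L n → L)) F) = G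
    have e1 : (if i = j then ((mulOp C L n (ind C L n l i) : Module.End k (Pt C L n → L)) *
      (mulOp C L n (ind C L n (l + 1) j) : Module.End k (Pt C L n → L))) else 0) F ω =
      if i = j then G ω else 0 := by
      split_ifs
      · simp [← hG, Module.End.mul_apply]
      · simp
    rw [e1]
    have e2 : G ω = (if ω.ν l = i then 1 else 0) * ((if ω.ν (l + 1) = j then 1 else 0) * F ω) := by
      rw [← hG, mulOp_apply', mulOp_apply']; rfl
    simp only [mulOp_apply', tauOp_apply h, Pt.sw_z1]
    by_cases h1 : ω.ν l = i
    · by_cases h2 : ω.ν (l + 1) = j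
      · subst h1 h2
        split_ifs
        · field_simp; ring
        · ring
      · have : G ω = 0 := by rw [e2]; simp [h2]
        simp only [this]
        split_ifs <;> ring
    · have : G ω = 0 := by rw [e2]; simp [h1]
      simp only [this]
      split_ifs <;> ring
  braid l h i j i' := by
    apply LinearMap.ext; intro F; funext ω
    rw [Module.End.mul_apply, LinearMap.sub_apply]
    simp only [Pi.sub_apply, Module.End.mul_apply, tau_braid_apply h]
    rw [mulOp_apply', mulOp_apply', mulOp_apply']
    by_cases h1 : ω.ν l = i
    · by_cases h2 : ω.ν (l + 1) = j
      · by_cases h3 : ω.ν (l + 2) = i'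
        · subst h1 h2 h3
          split_ifs
          · rw [Module.End.mul_apply, Qdiff_mulOp, Module.End.mul_apply, Module.End.mul_apply,
              mulOp_apply', mulOp_apply', mulOp_apply']
          · rfl
        · split_ifs
          · simp only [Module.End.mul_apply, Qdiff_mulOp, mulOp_apply', ind, h3, if_false, zero_mul, mul_zero]
          · simp only [Module.End.mul_apply, mulOp_apply', ind, h3, if_false, zero_mul, mul_zero, LinearMap.zero_apply, Pi.zero_apply]
          · simp only [Module.End.mul_apply, Qdiff_mulOp, mulOp_apply', ind, h3, if_false, zero_mul, mul_zero]
          · simp only [Module.End.mul_apply, mulOp_apply', ind, h3, if_false, zero_mul, mul_zero, LinearMap.zero_apply, Pi.zero_apply]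
      · split_ifs
        · simp only [Module.End.mul_apply, Qdiff_mulOp, mulOp_apply', ind, h2, if_false, zero_mul, mul_zero]
        · simp only [Module.End.mul_apply, mulOp_apply', ind, h2, if_false, zero_mul, mul_zero, LinearMap.zero_apply, Pi.zero_apply]
        · simp only [Module.End.mul_apply, Qdiff_mulOp, mulOp_apply', ind, h2, if_false, zero_mul, mul_zero]
        · simp only [Module.End.mul_apply, mulOp_apply', ind, h2, if_false, zero_mul, mul_zero, LinearMap.zero_apply, Pi.zero_apply]
    · split_ifs
      · simp only [Module.End.mul_apply, Qdiff_mulOp, mulOp_apply', ind, h1, if_false, zero_mul, mul_zero]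
      · simp only [Module.End.mul_apply, mulOp_apply', ind, h1, if_false, zero_mul, mul_zero, LinearMap.zero_apply, Pi.zero_apply]
      · simp only [Module.End.mul_apply, Qdiff_mulOp, mulOp_apply', ind, h1, if_false, zero_mul, mul_zero]
      · simp only [Module.End.mul_apply, mulOp_apply', ind, h1, if_false, zero_mul, mul_zero, LinearMap.zero_apply, Pi.zero_apply]

end FRep
end KLR


namespace KLR
open Finset

variable {k : Type} [Field k] {I : Type} [Fintype I] [DecidableEq I]

section Qnc
variable (C : CartanDatum k I) {A : Type} [Ring A] [Algebra k A]

lemma Qel_symm' (i j : I) {u v : A} (huv : Commute u v) : Qel C i j u v = Qel C j i v u := by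
  unfold Qel
  by_cases h : i = j
  · simp [h]
  rw [if_neg h, if_neg (Ne.symm h), Finset.sum_comm]
  refine Finset.sum_congr rfl fun q _ => Finset.sum_congr rfl fun p _ => ?_
  have hs := C.symmetrize i j
  have : (C.d i * (p : ℤ) + C.d j * (q : ℤ) = -(C.d i * C.a i j)) ↔
      (C.d j * (q : ℤ) + C.d i * (p : ℤ) = -(C.d j * C.a j i)) := by
    rw [hs, add_comm]
  rw [C.t_symm i j p q, (huv.pow_pow p q).eq]
  simp only [this]

lemma Qdiff_symm (i j : I) {u v w : A} (huw : Commute u w) :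
    Qdiff C i j u v w = Qdiff C i j w v u := by
  unfold Qdiff
  split_ifs
  · rfl
  refine Finset.sum_congr rfl fun p _ => Finset.sum_congr rfl fun q _ => ?_
  rw [huw.geom_sum₂_comm]

lemma Qel_op (i j : I) {u v : A} (huv : Commute u v) :
    Qel C i j (MulOpposite.op u) (MulOpposite.op v) = MulOpposite.op (Qel C i j u v) := by
  unfold Qel
  split_ifs
  · simp
  · rw [Finset.op_sum]
    refine Finset.sum_congr rfl fun p _ => ?_
    rw [Finset.op_sum]
    refine Finset.sum_congr rfl fun q _ => ?_
    split_ifs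
    · rw [MulOpposite.op_smul, (huv.pow_pow p q).eq, MulOpposite.op_mul, MulOpposite.op_pow,
        MulOpposite.op_pow]
    · simp

lemma Qdiff_op (i j : I) {u v w : A} (huv : Commute u v) (huw : Commute u w) (hvw : Commute v w) :
    Qdiff C i j (MulOpposite.op u) (MulOpposite.op v) (MulOpposite.op w) =
      MulOpposite.op (Qdiff C i j u v w) := by
  unfold Qdiff
  split_ifs
  · simp
  · rw [Finset.op_sum]
    refine Finset.sum_congr rfl fun p _ => ?_
    rw [Finset.op_sum]
    refine Finset.sum_congr rfl fun q _ => ?_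
    split_ifs
    · have h1 : Commute (∑ c ∈ Finset.range p, u ^ c * w ^ (p - 1 - c)) (v ^ q) :=
        Commute.sum_left _ _ _ fun c _ => (huv.pow_pow c q).mul_left (hvw.symm.pow_pow _ q)
      rw [MulOpposite.op_smul, h1.eq, MulOpposite.op_mul, MulOpposite.op_pow, Finset.op_sum]
      congr 2
      refine Finset.sum_congr rfl fun c _ => ?_
      rw [(huw.pow_pow c _).eq, MulOpposite.op_mul, MulOpposite.op_pow, MulOpposite.op_pow]
    · simp

lemma Qel_comm (i j : I) {u v z : A} (hu : Commute z u) (hv : Commute z v) :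
    Commute z (Qel C i j u v) := by
  unfold Qel
  split_ifs
  · exact Commute.zero_right _
  refine Commute.sum_right _ _ _ fun p _ => Commute.sum_right _ _ _ fun q _ => ?_
  split_ifs
  · exact ((hu.pow_right p).mul_right (hv.pow_right q)).smul_right _
  · exact Commute.zero_right _

lemma Qdiff_comm (i j : I) {u v w z : A} (hu : Commute z u) (hv : Commute z v)
    (hw : Commute z w) : Commute z (Qdiff C i j u v w) := by
  unfold Qdiff
  split_ifs
  · exact Commute.zero_right _
  refine Commute.sum_right _ _ _ fun p _ => Commute.sum_right _ _ _ fun q _ => ?_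
  split_ifs
  · exact ((Commute.sum_right _ _ _ fun c _ =>
      ((hu.pow_right c).mul_right (hw.pow_right _))).mul_right (hv.pow_right q)).smul_right _
  · exact Commute.zero_right _
end Qnc

lemma swap3 (l a : ℕ) :
    Equiv.swap l (l + 1) (Equiv.swap (l + 1) (l + 1 + 1) (Equiv.swap l (l + 1) a)) =
      Equiv.swap (l + 1) (l + 1 + 1) (Equiv.swap l (l + 1) (Equiv.swap (l + 1) (l + 1 + 1) a)) := by
  simp only [Equiv.swap_apply_def]
  split_ifs <;> omega

lemma swap3_0 (l : ℕ) :
    Equiv.swap l (l + 1) (Equiv.swap (l + 1) (l + 1 + 1) (Equiv.swap l (l + 1) l)) = l + 2 := by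
  simp only [Equiv.swap_apply_def]
  split_ifs <;> omega
lemma swap3_1 (l : ℕ) : Equiv.swap l (l + 1)
    (Equiv.swap (l + 1) (l + 1 + 1) (Equiv.swap l (l + 1) (l + 1))) = l + 1 := by
  simp only [Equiv.swap_apply_def]
  split_ifs <;> omega
lemma swap3_2 (l : ℕ) :
    Equiv.swap l (l + 1) (Equiv.swap (l + 1) (l + 1 + 1) (Equiv.swap l (l + 1) (l + 2))) = l := by
  simp only [Equiv.swap_apply_def]
  split_ifs <;> omega

lemma swap_lt {n m a : ℕ} (hm : m + 1 < n) (ha : a < n) : Equiv.swap m (m + 1) a < n := by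
  rw [Equiv.swap_apply_def]; split_ifs <;> omega

namespace Rep
variable {C : CartanDatum k I} {n : ℕ} {A : Type} [Ring A] [Algebra k A] (r : Rep C n A)

lemma sc (l : ℕ) (h : l + 1 < n) (a : ℕ) (ha : a < n) (j : I) :
    SemiconjBy (r.τ l) (r.ε a j) (r.ε (Equiv.swap l (l + 1) a) j) := by
  unfold SemiconjBy
  by_cases h1 : a = l
  · subst h1; simpa using r.τε0 a h j
  · by_cases h2 : a = l + 1
    · subst h2; simpa using r.τε1 l h j
    · rw [Equiv.swap_apply_of_ne_of_ne h1 h2]; exact r.τε l h a ha h1 h2 j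

/-- indicator of equal labels -/
noncomputable def E (l : ℕ) : A := ∑ j, r.ε l j * r.ε (l + 1) j

lemma ext2 {l m : ℕ} (hl : l < n) (hm : m < n) {y z : A}
    (h : ∀ i j, y * (r.ε l i * r.ε m j) = z * (r.ε l i * r.ε m j)) : y = z := by
  have h1 : ∑ i, ∑ j, r.ε l i * r.ε m j = 1 := by
    rw [← Finset.sum_mul_sum, r.εsum l hl, r.εsum m hm, one_mul]
  rw [← mul_one y, ← mul_one z, ← h1]
  simp only [Finset.mul_sum]
  exact Finset.sum_congr rfl fun i _ => Finset.sum_congr rfl fun j _ => h i j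

lemma ext3 {l m p : ℕ} (hl : l < n) (hm : m < n) (hp : p < n) {y z : A}
    (h : ∀ i j i', y * (r.ε l i * r.ε m j * r.ε p i') = z * (r.ε l i * r.ε m j * r.ε p i')) :
    y = z := by
  refine r.ext2 hl hm fun i j => ?_
  rw [← mul_one (r.ε l i * r.ε m j), ← r.εsum p hp]
  simp only [Finset.mul_sum]
  exact Finset.sum_congr rfl fun i' _ => h i j i'

lemma E_mul {l : ℕ} (h : l + 1 < n) (i j : I) : r.E l * (r.ε l i * r.ε (l + 1) j) =
    if i = j then r.ε l i * r.ε (l + 1) j else 0 := by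
  unfold E
  rw [Finset.sum_mul]
  have : ∀ m, r.ε l m * r.ε (l + 1) m * (r.ε l i * r.ε (l + 1) j) =
      (if m = i then if m = j then r.ε l m * r.ε (l + 1) m else 0 else 0) := fun m => by
    rw [mul_assoc, ← mul_assoc (r.ε (l + 1) m), r.εε (l + 1) h l (by omega), mul_assoc,
      ← mul_assoc, r.εmul l (by omega), r.εmul (l + 1) h]
    split_ifs <;> simp
  simp only [this]
  split_ifs with h1
  · subst h1; simp
  · apply Finset.sum_eq_zero; intro m _; split_ifs with h2 h3
    · exact absurd (h2.symm.trans h3) h1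
    all_goals rfl

lemma τx0' {l : ℕ} (h : l + 1 < n) : r.τ l * r.x l = r.x (l + 1) * r.τ l - r.E l := by
  have : r.τ l * r.x l - r.x (l + 1) * r.τ l = -r.E l := by
    refine r.ext2 (l := l) (by omega) h fun i j => ?_
    rw [r.τx0 l h, neg_mul, r.E_mul h]; split_ifs <;> simp
  rw [sub_eq_iff_eq_add.mp this]; noncomm_ring

lemma τx1' {l : ℕ} (h : l + 1 < n) : r.τ l * r.x (l + 1) = r.x l * r.τ l + r.E l := by
  have : r.τ l * r.x (l + 1) - r.x l * r.τ l = r.E l := by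
    refine r.ext2 (l := l) (by omega) h fun i j => ?_
    rw [r.τx1 l h, r.E_mul h]
  rw [sub_eq_iff_eq_add.mp this, add_comm]

/-- the braid defect -/
noncomputable def Br (l : ℕ) : A := r.τ (l + 1) * r.τ l * r.τ (l + 1) - r.τ l * r.τ (l + 1) * r.τ l

lemma Br_sc {l : ℕ} (h : l + 2 < n) (i j i' : I) :
    r.Br l * (r.ε l i * r.ε (l + 1) j * r.ε (l + 2) i') =
      r.ε l i' * r.ε (l + 1) j * r.ε (l + 2) i * r.Br l := by
  have key : ∀ a < n, ∀ j, SemiconjBy (r.Br l) (r.ε a j)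
      (r.ε (Equiv.swap l (l + 1) (Equiv.swap (l + 1) (l + 1 + 1) (Equiv.swap l (l + 1) a))) j) := by
    intro a ha j
    have h0 : l + 1 < n := by omega
    have h1 : l + 1 + 1 < n := h
    have e1 := (r.sc (l + 1) h1 _ (swap_lt h0 (swap_lt h1 ha)) j).mul_left
      ((r.sc l h0 _ (swap_lt h1 ha) j).mul_left (r.sc (l + 1) h1 a ha j))
    have e2 := (r.sc l h0 _ (swap_lt h1 (swap_lt h0 ha)) j).mul_left
      ((r.sc (l + 1) h1 _ (swap_lt h0 ha) j).mul_left (r.sc l h0 a ha j))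
    have e3 := swap3 l a
    unfold Br
    rw [mul_assoc, mul_assoc]
    rw [← e3] at e1
    exact e1.sub_left e2
  have k0 : SemiconjBy (r.Br l) (r.ε l i) (r.ε (l + 2) i) := by
    have := key l (by omega) i
    rwa [swap3_0] at this
  have k1 : SemiconjBy (r.Br l) (r.ε (l + 1) j) (r.ε (l + 1) j) := by
    have := key (l + 1) (by omega) j
    rwa [swap3_1] at this
  have k2 : SemiconjBy (r.Br l) (r.ε (l + 2) i') (r.ε l i') := by
    have := key (l + 2) (by omega) i'
    rwa [swap3_2] at this
  rw [((k0.mul_right k1).mul_right k2).eq]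
  congr 1
  rw [r.εε (l + 2) h (l + 1) (by omega), mul_assoc, r.εε (l + 2) h l (by omega), ← mul_assoc,
    r.εε (l + 1) (by omega) l (by omega)]

lemma E_comm_x {l a : ℕ} (h : l + 1 < n) (ha : a < n) : Commute (r.x a) (r.E l) :=
  Commute.sum_right _ _ _ fun j _ =>
    (show Commute (r.x a) _ from r.xε a ha l (by omega) j).mul_right (r.xε a ha (l + 1) h j)

lemma E_comm_ε {l a : ℕ} (h : l + 1 < n) (ha : a < n) (i) : Commute (r.ε a i) (r.E l) :=
  Commute.sum_right _ _ _ fun j _ =>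
    (show Commute (r.ε a i) _ from r.εε a ha l (by omega) i j).mul_right (r.εε a ha (l + 1) h i j)

lemma E_comm_τ {l : ℕ} (h : l + 1 < n) : Commute (r.τ l) (r.E l) := by
  refine Commute.sum_right _ _ _ fun j _ => ?_
  show r.τ l * (r.ε l j * r.ε (l + 1) j) = _
  rw [← mul_assoc, r.τε0 l h, mul_assoc, r.τε1 l h, ← mul_assoc, r.εε (l + 1) h l (by omega)]

/-- restriction to the first strands -/
def restrict {n : ℕ} (r : Rep C (n + 1) A) : Rep C n A where
  ε := r.ε
  x := r.x
  τ := r.τ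
  εε a ha b hb i j := r.εε a (by omega) b (by omega) i j
  εmul a ha i j := r.εmul a (by omega) i j
  εsum a ha := r.εsum a (by omega)
  xx a ha b hb := r.xx a (by omega) b (by omega)
  xε a ha b hb j := r.xε a (by omega) b (by omega) j
  τε l h a ha h1 h2 j := r.τε l (by omega) a (by omega) h1 h2 j
  τε0 l h j := r.τε0 l (by omega) j
  τε1 l h j := r.τε1 l (by omega) j
  ττ l l' h1 h2 := r.ττ l l' h1 (by omega)
  τsq l h i j := r.τsq l (by omega) i j
  τx l h a ha h1 h2 := r.τx l (by omega) a (by omega) h1 h2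
  τx0 l h i j := r.τx0 l (by omega) i j
  τx1 l h i j := r.τx1 l (by omega) i j
  braid l h i j i' := r.braid l (by omega) i j i'

/-- flipping the strands -/
def flip (r : Rep C n A) : Rep C n A where
  ε a := r.ε (n - 1 - a)
  x a := r.x (n - 1 - a)
  τ l := - r.τ (n - 2 - l)
  εε a ha b hb i j := r.εε _ (by omega) _ (by omega) i j
  εmul a ha i j := r.εmul _ (by omega) i j
  εsum a ha := r.εsum _ (by omega)
  xx a ha b hb := r.xx _ (by omega) _ (by omega)
  xε a ha b hb j := r.xε _ (by omega) _ (by omega) j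
  τε l h a ha h1 h2 j := by
    rw [neg_mul, r.τε _ (by omega) _ (by omega) (by omega) (by omega), mul_neg]
  τε0 l h j := by
    have := r.τε1 (n - 2 - l) (by omega) j
    rw [show n - 2 - l + 1 = n - 1 - l by omega] at this
    rw [neg_mul, this, mul_neg, show n - 1 - (l + 1) = n - 2 - l by omega]
  τε1 l h j := by
    have := r.τε0 (n - 2 - l) (by omega) j
    rw [show n - 2 - l + 1 = n - 1 - l by omega] at this
    rw [show n - 1 - (l + 1) = n - 2 - l by omega, neg_mul, this, mul_neg]
  ττ l l' h1 h2 := by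
    rw [neg_mul_neg, neg_mul_neg]
    exact (r.ττ _ _ (by omega) (by omega)).symm
  τsq l h i j := by
    have := r.τsq (n - 2 - l) (by omega) j i
    rw [show n - 2 - l + 1 = n - 1 - l by omega] at this
    rw [neg_mul_neg, show n - 1 - (l + 1) = n - 2 - l by omega,
      r.εε _ (by omega) _ (by omega), this, Qel_symm' C j i]
    exact r.xx _ (by omega) _ (by omega)
  τx l h a ha h1 h2 := by
    rw [neg_mul, r.τx _ (by omega) _ (by omega) (by omega) (by omega), mul_neg]
  τx0 l h i j := by
    have := r.τx1 (n - 2 - l) (by omega) j i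
    rw [show n - 2 - l + 1 = n - 1 - l by omega] at this
    rw [show n - 1 - (l + 1) = n - 2 - l by omega, r.εε _ (by omega) _ (by omega),
      neg_mul, mul_neg, ← neg_sub', neg_mul, this]
    by_cases hij : i = j
    · subst hij; simp
    · simp [hij, Ne.symm hij]
  τx1 l h i j := by
    have := r.τx0 (n - 2 - l) (by omega) j i
    rw [show n - 2 - l + 1 = n - 1 - l by omega] at this
    rw [show n - 1 - (l + 1) = n - 2 - l by omega, r.εε _ (by omega) _ (by omega),
      neg_mul, mul_neg, ← neg_sub', neg_mul, this]
    by_cases hij : i = j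
    · subst hij; simp
    · simp [hij, Ne.symm hij]
  braid l h i j i' := by
    have := r.braid (n - 3 - l) (by omega) i' j i
    rw [show n - 3 - l + 1 = n - 2 - l by omega, show n - 3 - l + 2 = n - 1 - l by omega] at this
    rw [show n - 1 - (l + 1) = n - 2 - l by omega, show n - 1 - (l + 2) = n - 3 - l by omega,
      show n - 2 - (l + 1) = n - 3 - l by omega]
    have e1 : r.ε (n - 1 - l) i * r.ε (n - 2 - l) j * r.ε (n - 3 - l) i' =
        r.ε (n - 3 - l) i' * r.ε (n - 2 - l) j * r.ε (n - 1 - l) i := by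
      rw [r.εε (n - 1 - l) (by omega) (n - 2 - l) (by omega), mul_assoc,
        r.εε (n - 1 - l) (by omega) (n - 3 - l) (by omega), ← mul_assoc,
        r.εε (n - 2 - l) (by omega) (n - 3 - l) (by omega)]
    rw [e1, neg_mul_neg, neg_mul_neg, mul_neg, mul_neg, neg_sub_neg, this]
    by_cases hij : i = i'
    · subst hij
      rw [if_pos rfl, if_pos rfl, Qdiff_symm]
      exact r.xx _ (by omega) _ (by omega)
    · rw [if_neg hij, if_neg (Ne.symm hij)]

open MulOpposite in
/-- the opposite representation -/
noncomputable def opp (r : Rep C n A) : Rep C n Aᵐᵒᵖ where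
  ε a j := op (r.ε a j)
  x a := op (r.x a)
  τ l := op (r.τ l)
  εε a ha b hb i j := by rw [← op_mul, ← op_mul, r.εε a ha b hb]
  εmul a ha i j := by
    rw [← op_mul, r.εmul a ha]
    by_cases hij : i = j
    · subst hij; simp
    · simp [hij, Ne.symm hij]
  εsum a ha := by rw [← Finset.op_sum, r.εsum a ha, op_one]
  xx a ha b hb := by rw [← op_mul, ← op_mul, r.xx a ha b hb]
  xε a ha b hb j := by rw [← op_mul, ← op_mul, r.xε a ha b hb]
  τε l h a ha h1 h2 j := by rw [← op_mul, ← op_mul, r.τε l h a ha h1 h2]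
  τε0 l h j := by rw [← op_mul, ← op_mul, r.τε1 l h]
  τε1 l h j := by rw [← op_mul, ← op_mul, r.τε0 l h]
  ττ l l' h1 h2 := by rw [← op_mul, ← op_mul, r.ττ l l' h1 h2]
  τsq l h i j := by
    rw [Qel_op C i j (r.xx _ (by omega) _ h)]
    simp only [← op_mul]
    congr 1
    rw [r.εε (l + 1) h l (by omega)]
    have e1 : r.ε l i * r.ε (l + 1) j * (r.τ l * r.τ l) =
        r.τ l * r.τ l * (r.ε l i * r.ε (l + 1) j) := by
      have k0 : SemiconjBy (r.τ l * r.τ l) (r.ε l i) (r.ε l i) :=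
        SemiconjBy.mul_left (r.τε1 l h i) (r.τε0 l h i)
      have k1 : SemiconjBy (r.τ l * r.τ l) (r.ε (l + 1) j) (r.ε (l + 1) j) :=
        SemiconjBy.mul_left (r.τε0 l h j) (r.τε1 l h j)
      exact (k0.mul_right k1).eq.symm
    rw [e1, r.τsq l h]
    refine (Commute.eq ?_).symm
    exact Qel_comm C i j
      ((show Commute (r.x l) _ from r.xε l (by omega) l (by omega) i).mul_right
        (r.xε l (by omega) _ h j)).symm
      ((show Commute (r.x (l + 1)) _ from r.xε (l + 1) h l (by omega) i).mul_right
        (r.xε _ h _ h j)).symm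
  τx l h a ha h1 h2 := by rw [← op_mul, ← op_mul, r.τx l h a ha h1 h2]
  τx0 l h i j := by
    simp only [← op_mul, ← op_sub]
    have e0 : r.x l * r.τ l - r.τ l * r.x (l + 1) = - r.E l := by rw [r.τx1' h]; noncomm_ring
    have e1 := ((r.E_comm_ε h (show l < n by omega) i).mul_left (r.E_comm_ε h h j)).eq
    rw [e0, r.εε (l + 1) h l (by omega), mul_neg, e1, r.E_mul h]
    split_ifs <;> simp
  τx1 l h i j := by
    simp only [← op_mul, ← op_sub]
    have e0 : r.x (l + 1) * r.τ l - r.τ l * r.x l = r.E l := by rw [r.τx0' h]; noncomm_ring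
    have e1 := ((r.E_comm_ε h (show l < n by omega) i).mul_left (r.E_comm_ε h h j)).eq
    rw [e0, r.εε (l + 1) h l (by omega), e1, r.E_mul h]
    split_ifs <;> simp
  braid l h i j i' := by
    have h0 : l < n := by omega
    have h1 : l + 1 < n := by omega
    rw [Qdiff_op C i j (r.xx _ (by omega) _ h1) (r.xx _ (by omega) _ h) (r.xx _ h1 _ h)]
    simp only [← op_mul, ← op_sub]
    have e1 : r.ε (l + 2) i' * (r.ε (l + 1) j * r.ε l i) =
      r.ε l i * r.ε (l + 1) j * r.ε (l + 2) i' := by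
      rw [r.εε (l + 1) h1 l h0, ← mul_assoc, r.εε _ h l h0, mul_assoc, r.εε _ h _ h1, mul_assoc]
    have e2 : r.τ (l + 1) * (r.τ l * r.τ (l + 1)) - r.τ l * (r.τ (l + 1) * r.τ l) = r.Br l := by
      unfold Br; rw [mul_assoc, mul_assoc]
    have e3 := r.braid l h i' j i
    rw [e1, e2, ← r.Br_sc h]
    unfold Br
    rw [e3]
    by_cases hij : i = i'
    · subst hij
      rw [if_pos rfl, if_pos rfl]
      congr 1
      refine (Commute.eq ?_).symm
      have kk : ∀ a < n, Commute (r.ε l i * r.ε (l + 1) j * r.ε (l + 2) i) (r.x a) := fun a ha =>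
        (((show Commute (r.x a) _ from r.xε a ha l h0 i).mul_right (r.xε a ha _ h1 j)).mul_right
          (r.xε a ha _ h i)).symm
      exact Qdiff_comm C i j (kk _ h0) (kk _ h1) (kk _ h)
    · rw [if_neg hij, if_neg (Ne.symm hij), op_zero]

end Rep
end KLR


namespace KLR
open Finset

variable {k : Type} [Field k] {I : Type} [Fintype I] [DecidableEq I]

section Qmem
variable (C : CartanDatum k I) {A : Type} [Ring A] [Algebra k A]
lemma Qel_mem (S : Subalgebra k A) (i j : I) {u v : A} (hu : u ∈ S) (hv : v ∈ S) :
    Qel C i j u v ∈ S := by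
  unfold Qel
  split_ifs
  · exact S.zero_mem
  refine S.sum_mem fun p _ => S.sum_mem fun q _ => ?_
  split_ifs
  · exact S.smul_mem (S.mul_mem (S.pow_mem hu _) (S.pow_mem hv _)) _
  · exact S.zero_mem
lemma Qdiff_mem (S : Subalgebra k A) (i j : I) {u v w : A} (hu : u ∈ S) (hv : v ∈ S) (hw : w ∈ S) :
    Qdiff C i j u v w ∈ S := by
  unfold Qdiff
  split_ifs
  · exact S.zero_mem
  refine S.sum_mem fun p _ => S.sum_mem fun q _ => ?_
  split_ifs
  · exact S.smul_mem (S.mul_mem (S.sum_mem fun c _ => S.mul_mem (S.pow_mem hu _) (S.pow_mem hw _))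
      (S.pow_mem hv _)) _
  · exact S.zero_mem
end Qmem

namespace Rep
variable {C : CartanDatum k I} {n : ℕ} {A : Type} [Ring A] [Algebra k A] (r : Rep C n A)

lemma τsq_mem (S : Subalgebra k A) {l : ℕ} (h : l + 1 < n) (hε : ∀ a < n, ∀ j, r.ε a j ∈ S)
    (hx : ∀ a < n, r.x a ∈ S) : r.τ l * r.τ l ∈ S := by
  have h1 : ∑ i, ∑ j, r.ε l i * r.ε (l + 1) j = 1 := by
    rw [← Finset.sum_mul_sum, r.εsum l (by omega), r.εsum _ h, one_mul]
  rw [← mul_one (r.τ l * r.τ l), ← h1]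
  simp only [Finset.mul_sum, r.τsq l h]
  exact S.sum_mem fun i _ => S.sum_mem fun j _ => S.mul_mem (Qel_mem C S _ _ (hx _ (by omega))
    (hx _ h)) (S.mul_mem (hε _ (by omega) _) (hε _ h _))

lemma Br_mem (S : Subalgebra k A) {l : ℕ} (h : l + 2 < n) (hε : ∀ a < n, ∀ j, r.ε a j ∈ S)
    (hx : ∀ a < n, r.x a ∈ S) : r.Br l ∈ S := by
  have h1 : ∑ i, ∑ j, ∑ i', r.ε l i * r.ε (l + 1) j * r.ε (l + 2) i' = 1 := by
    simp only [← Finset.mul_sum, r.εsum (l + 2) h, r.εsum (l + 1) (by omega), r.εsum l (by omega),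
      mul_one]
  rw [← mul_one (r.Br l), ← h1]
  unfold Br
  simp only [Finset.mul_sum, r.braid l h]
  refine S.sum_mem fun i _ => S.sum_mem fun j _ => S.sum_mem fun i' _ => ?_
  split_ifs
  · exact S.mul_mem (Qdiff_mem C S _ _ (hx _ (by omega)) (hx _ (by omega)) (hx _ h))
      (S.mul_mem (S.mul_mem (hε _ (by omega) _) (hε _ (by omega) _)) (hε _ h _))
  · exact S.zero_mem

lemma E_mem (S : Subalgebra k A) {l : ℕ} (h : l + 1 < n) (hε : ∀ a < n, ∀ j, r.ε a j ∈ S) :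
    r.E l ∈ S := S.sum_mem fun j _ => S.mul_mem (hε _ (by omega) _) (hε _ h _)
end Rep

section Homs
variable (C : CartanDatum k I) (n : ℕ)

/-- the inclusion -/
noncomputable def io : KA C n →ₐ[k] KA C (n + 1) := (canon C (n + 1)).restrict.lift

lemma io_X {a : ℕ} (h : a < n) : io C n (X C n a) = X C (n + 1) a := Rep.lift_X _ h
lemma io_Ta {l : ℕ} (h : l + 1 < n) : io C n (Ta C n l) = Ta C (n + 1) l := Rep.lift_Ta _ h
lemma io_Ep {a : ℕ} (h : a < n) (j : I) : io C n (Ep C n a j) = Ep C (n + 1) a j := Rep.lift_Ep _ h j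

/-- the flip -/
noncomputable def om : KA C n →ₐ[k] KA C n := (canon C n).flip.lift

lemma om_X {a : ℕ} (h : a < n) : om C n (X C n a) = X C n (n - 1 - a) := Rep.lift_X _ h
lemma om_Ta {l : ℕ} (h : l + 1 < n) : om C n (Ta C n l) = - Ta C n (n - 2 - l) := Rep.lift_Ta _ h
lemma om_Ep {a : ℕ} (h : a < n) (j : I) : om C n (Ep C n a j) = Ep C n (n - 1 - a) j :=
  Rep.lift_Ep _ h j

lemma om_om (z : KA C n) : om C n (om C n z) = z := by
  have : (om C n).comp (om C n) = AlgHom.id k _ := by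
    apply KA_hom_ext C
    · intro a h j
      simp only [AlgHom.comp_apply, AlgHom.id_apply]
      rw [om_Ep C n h, om_Ep C n (by omega), show n - 1 - (n - 1 - a) = a by omega]
    · intro a h
      simp only [AlgHom.comp_apply, AlgHom.id_apply]
      rw [om_X C n h, om_X C n (by omega), show n - 1 - (n - 1 - a) = a by omega]
    · intro a h
      simp only [AlgHom.comp_apply, AlgHom.id_apply]
      rw [om_Ta C n h, map_neg, om_Ta C n (by omega), show n - 2 - (n - 2 - a) = a by omega, neg_neg]
  exact DFunLike.congr_fun this z

/-- the shifted inclusion -/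
noncomputable def is : KA C n →ₐ[k] KA C (n + 1) := ((om C (n + 1)).comp (io C n)).comp (om C n)

lemma is_apply (z) : is C n z = om C (n + 1) (io C n (om C n z)) := rfl
lemma om_is (z) : om C (n + 1) (is C n z) = io C n (om C n z) := by rw [is_apply, om_om]
lemma om_io (z) : om C (n + 1) (io C n z) = is C n (om C n z) := by rw [is_apply, om_om]
lemma is_X {a : ℕ} (h : a < n) : is C n (X C n a) = X C (n + 1) (a + 1) := by
  rw [is_apply, om_X C n h, io_X C n (by omega), om_X C _ (by omega)]; congr 1; omega
lemma is_Ta {l : ℕ} (h : l + 1 < n) : is C n (Ta C n l) = Ta C (n + 1) (l + 1) := by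
  rw [is_apply, om_Ta C n h, map_neg, map_neg, io_Ta C n (by omega), om_Ta C _ (by omega), neg_neg]
  congr 1; omega
lemma is_Ep {a : ℕ} (h : a < n) (j : I) : is C n (Ep C n a j) = Ep C (n + 1) (a + 1) j := by
  rw [is_apply, om_Ep C n h, io_Ep C n (by omega), om_Ep C _ (by omega)]; congr 1; omega

lemma io_comm_X (z) : Commute (X C (n + 1) n) (io C n z) := by
  have := KA_top C ((Subalgebra.centralizer k {X C (n + 1) n}).comap (io C n)) ?_ ?_ ?_ z
  · exact Subalgebra.mem_centralizer_iff k |>.mp this _ rfl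
  · intro a ha j
    rw [Subalgebra.mem_comap, Subalgebra.mem_centralizer_iff, io_Ep C n ha]
    rintro _ rfl; exact (canon C (n + 1)).xε n (by omega) a (by omega) j
  · intro a ha
    rw [Subalgebra.mem_comap, Subalgebra.mem_centralizer_iff, io_X C n ha]
    rintro _ rfl; exact (canon C (n + 1)).xx n (by omega) a (by omega)
  · intro l hl
    rw [Subalgebra.mem_comap, Subalgebra.mem_centralizer_iff, io_Ta C n hl]
    rintro _ rfl
    exact ((canon C (n + 1)).τx l (by omega) n (by omega) (by omega) (by omega)).symm

lemma io_comm_Ep (i : I) (z) : Commute (Ep C (n + 1) n i) (io C n z) := by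
  have := KA_top C ((Subalgebra.centralizer k {Ep C (n + 1) n i}).comap (io C n)) ?_ ?_ ?_ z
  · exact Subalgebra.mem_centralizer_iff k |>.mp this _ rfl
  · intro a ha j
    rw [Subalgebra.mem_comap, Subalgebra.mem_centralizer_iff, io_Ep C n ha]
    rintro _ rfl; exact (canon C (n + 1)).εε n (by omega) a (by omega) i j
  · intro a ha
    rw [Subalgebra.mem_comap, Subalgebra.mem_centralizer_iff, io_X C n ha]
    rintro _ rfl; exact ((canon C (n + 1)).xε a (by omega) n (by omega) i).symm
  · intro l hl
    rw [Subalgebra.mem_comap, Subalgebra.mem_centralizer_iff, io_Ta C n hl]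
    rintro _ rfl
    exact ((canon C (n + 1)).τε l (by omega) n (by omega) (by omega) (by omega) i).symm

/-- the anti-involution -/
noncomputable def st : KA C n →ₐ[k] (KA C n)ᵐᵒᵖ := (canon C n).opp.lift
lemma st_X {a : ℕ} (h : a < n) : st C n (X C n a) = MulOpposite.op (X C n a) := Rep.lift_X _ h
lemma st_Ta {l : ℕ} (h : l + 1 < n) : st C n (Ta C n l) = MulOpposite.op (Ta C n l) :=
  Rep.lift_Ta _ h
lemma st_Ep {a : ℕ} (h : a < n) (j : I) : st C n (Ep C n a j) = MulOpposite.op (Ep C n a j) :=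
  Rep.lift_Ep _ h j

/-- evaluation of polynomials at the last strand -/
noncomputable def ev : Polynomial (KA C n) →+* KA C (n + 1) :=
  Polynomial.eval₂RingHom' (io C n).toRingHom (X C (n + 1) n) fun z => (io_comm_X C n z).symm

lemma ev_C (z) : ev C n (Polynomial.C z) = io C n z := Polynomial.eval₂_C _ _
lemma ev_X : ev C n Polynomial.X = X C (n + 1) n := Polynomial.eval₂_X _ _
lemma ev_comm_X (c) : Commute (X C (n + 1) n) (ev C n c) := by
  induction c using Polynomial.induction_on' with
  | add p q hp hq => rw [map_add]; exact hp.add_right hq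
  | monomial m z =>
    rw [← Polynomial.C_mul_X_pow_eq_monomial, map_mul, map_pow, ev_C, ev_X]
    exact (io_comm_X C n z).mul_right ((Commute.refl _).pow_right m)
lemma ev_comm_Ep (i : I) (c) : Commute (Ep C (n + 1) n i) (ev C n c) := by
  induction c using Polynomial.induction_on' with
  | add p q hp hq => rw [map_add]; exact hp.add_right hq
  | monomial m z =>
    rw [← Polynomial.C_mul_X_pow_eq_monomial, map_mul, map_pow, ev_C, ev_X]
    exact (io_comm_Ep C n i z).mul_right (Commute.pow_right
      ((canon C (n + 1)).xε n (by omega) n (by omega) i).symm m)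
end Homs
end KLR


namespace KLR
open Finset

variable {k : Type} [Field k] {I : Type} [Fintype I] [DecidableEq I]

section Span
variable (C : CartanDatum k I) (n : ℕ)

/-- `τ_{n-1} ⋯ τ_{n-m}` -/
noncomputable def td : ℕ → KA C (n + 1)
  | 0 => 1
  | m + 1 => td m * Ta C (n + 1) (n - 1 - m)

/-- `τ_{n-1} ⋯ τ_b` -/
noncomputable def tb (b : ℕ) : KA C (n + 1) := td C n (n - b)

lemma tb_n : tb C n n = 1 := by rw [tb, Nat.sub_self, td]
lemma tb_succ {b : ℕ} (h : b < n) : tb C n b = tb C n (b + 1) * Ta C (n + 1) b := by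
  rw [tb, show n - b = (n - (b + 1)) + 1 by omega, td, tb]
  congr 2; omega

/-- downward induction -/
lemma down_ind {P : ℕ → Prop} (h0 : P n) (h1 : ∀ b, b < n → P (b + 1) → P b) :
    ∀ b, b ≤ n → P b := fun b hb => Nat.decreasingInduction (motive := fun m _ => P m)
      (fun m hm h => h1 m hm h) h0 hb

lemma tb_comm_Ta {b l : ℕ} (hb : b ≤ n) (hl : l + 1 < b) :
    Commute (tb C n b) (Ta C (n + 1) l) := by
  induction hb using Nat.decreasingInduction with
  | self => rw [tb_n]; exact Commute.one_left _
  | of_succ b hb ih =>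
    rw [tb_succ C n hb]
    exact (ih (by omega)).mul_left ((canon C (n + 1)).ττ l b hl (by omega)).symm

variable (i : I)

/-- the spans `Z_b` -/
noncomputable def Zs (b : ℕ) : Submodule k (KA C (n + 1)) :=
  Submodule.span k {z | ∃ (c : Polynomial (KA C n)) (a : ℕ), b ≤ a ∧ a ≤ n ∧
    z = ev C n c * Ep C (n + 1) n i * tb C n a}

variable {C n i}

lemma Zs_gen {b : ℕ} (c) {a : ℕ} (h : b ≤ a) (h' : a ≤ n) :
    ev C n c * Ep C (n + 1) n i * tb C n a ∈ Zs C n i b :=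
  Submodule.subset_span ⟨c, a, h, h', rfl⟩

lemma Zs_mono {b b' : ℕ} (h : b ≤ b') : Zs C n i b' ≤ Zs C n i b :=
  Submodule.span_mono fun _ ⟨c, a, h1, h2, h3⟩ => ⟨c, a, h.trans h1, h2, h3⟩

lemma Zs_ind {b b' : ℕ} (y : KA C (n + 1)) (h : ∀ (c : Polynomial (KA C n)) (a : ℕ), b ≤ a → a ≤ n →
    ev C n c * Ep C (n + 1) n i * tb C n a * y ∈ Zs C n i b') :
    ∀ z ∈ Zs C n i b, z * y ∈ Zs C n i b' := by
  intro z hz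
  have : Zs C n i b ≤ (Zs C n i b').comap (LinearMap.mulRight k y) := by
    refine Submodule.span_le.mpr ?_
    rintro _ ⟨c, a, h1, h2, rfl⟩
    exact h c a h1 h2
  exact this hz

variable (C n i) in
/-- the stabilizer of `Z_b` -/
noncomputable def Sb (b : ℕ) : Subalgebra k (KA C (n + 1)) where
  carrier := {y | ∀ z ∈ Zs C n i b, z * y ∈ Zs C n i b}
  mul_mem' {y y'} h h' z hz := by rw [← mul_assoc]; exact h' _ (h _ hz)
  add_mem' {y y'} h h' z hz := by rw [mul_add]; exact Submodule.add_mem _ (h z hz) (h' z hz)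
  algebraMap_mem' c z hz := by
    rw [← Algebra.commutes, ← Algebra.smul_def]; exact Submodule.smul_mem _ _ hz

lemma mem_Sb {b : ℕ} {y} : y ∈ Sb C n i b ↔ ∀ z ∈ Zs C n i b, z * y ∈ Zs C n i b := Iff.rfl

lemma Zs_o {b : ℕ} (h : b < n) {z} (hz : z ∈ Zs C n i (b + 1)) :
    z * Ta C (n + 1) b ∈ Zs C n i b := by
  revert z; suffices h : ∀ z ∈ Zs C n i (b + 1), z * Ta C (n + 1) b ∈ Zs C n i b from fun {z} hz => h z hz
  refine Zs_ind _ fun c a h1 h2 => ?_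
  by_cases hab : a = b + 1
  · subst hab
    rw [mul_assoc, ← tb_succ C n h]
    exact Zs_gen c le_rfl h.le
  · rw [mul_assoc, (tb_comm_Ta C n h2 (show b + 1 < a by omega)).eq, ← mul_assoc,
      mul_assoc (ev C n c), ← io_Ta C n (show b + 1 < n by omega), (io_comm_Ep C n i _).eq,
      ← mul_assoc, ← ev_C, ← map_mul]
    exact Zs_gen _ (by omega) h2

lemma Zs_top_gen {y} (c) : y = ev C n c → y * Ep C (n + 1) n i ∈ Zs C n i n := by
  rintro rfl
  have := Zs_gen (i := i) c (le_refl n) le_rfl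
  rwa [tb_n, mul_one] at this

/-- polynomials stabilize -/
lemma Sb_pol {b : ℕ} (hb : b ≤ n) : (∀ a < n + 1, ∀ j, Ep C (n + 1) a j ∈ Sb C n i b) ∧
    (∀ a < n + 1, X C (n + 1) a ∈ Sb C n i b) := by
  induction hb using Nat.decreasingInduction with
  | self =>
    constructor
    · intro a ha j
      refine Zs_ind _ fun c a' h1 h2 => ?_
      obtain rfl : a' = n := by omega
      rw [tb_n, mul_one]
      by_cases han : a = a'
      · subst han
        rw [mul_assoc]
        have := (canon C (a + 1)).εmul a (by omega) i j
        change Ep C (a + 1) a i * Ep C (a + 1) a j = (if i = j then Ep C (a + 1) a i else 0) at this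
        rw [this]
        split_ifs
        · exact Zs_top_gen c rfl
        · rw [mul_zero]; exact Submodule.zero_mem _
      · rw [mul_assoc, ← io_Ep C a' (show a < a' by omega), (io_comm_Ep C a' i _).eq, ← mul_assoc]
        exact Zs_top_gen (c * Polynomial.C (Ep C a' a j)) (by rw [map_mul, ev_C])
    · intro a ha
      refine Zs_ind _ fun c a' h1 h2 => ?_
      obtain rfl : a' = n := by omega
      rw [tb_n, mul_one]
      by_cases han : a = a'
      · subst han
        have := (canon C (a + 1)).xε a (by omega) a (by omega) i
        change X C (a + 1) a * Ep C (a + 1) a i = Ep C (a + 1) a i * X C (a + 1) a at this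
        rw [mul_assoc, ← this, ← mul_assoc]
        exact Zs_top_gen (c * Polynomial.X) (by rw [map_mul, ev_X])
      · rw [mul_assoc, ← io_X C a' (show a < a' by omega), (io_comm_Ep C a' i _).eq, ← mul_assoc]
        exact Zs_top_gen (c * Polynomial.C (X C a' a)) (by rw [map_mul, ev_C])
  | of_succ b hb ih =>
    obtain ⟨ih1, ih2⟩ := ih
    have hE : (canon C (n + 1)).E b ∈ Sb C n i (b + 1) :=
      (canon C (n + 1)).E_mem _ (by omega) ih1
    have hb' : b + 1 < n + 1 := by omega
    -- reduce to the last generator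
    have red : ∀ y, y ∈ Sb C n i (b + 1) → (∃ y' ∈ Sb C n i (b + 1), ∃ y'' ∈ Sb C n i (b + 1),
        Ta C (n + 1) b * y = y' * Ta C (n + 1) b + y'') → y ∈ Sb C n i b := by
      rintro y hy ⟨y', hy', y'', hy'', h⟩
      refine Zs_ind _ fun c a h1 h2 => ?_
      by_cases hab : a = b
      · subst hab
        rw [tb_succ C n hb, ← mul_assoc, mul_assoc, h, mul_add, ← mul_assoc]
        have hg : ev C n c * Ep C (n + 1) n i * tb C n (a + 1) ∈ Zs C n i (a + 1) :=
          Zs_gen c le_rfl hb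
        exact Submodule.add_mem _ (Zs_o hb (hy' _ hg)) (Zs_mono (by omega) (hy'' _ hg))
      · exact Zs_mono (by omega) (hy _ (Zs_gen (b := b + 1) c (by omega) h2))
    constructor
    · intro a ha j
      refine red _ (ih1 a ha j) ⟨_, ih1 _ (swap_lt hb' ha) j, 0, Subalgebra.zero_mem _, ?_⟩
      rw [add_zero]
      exact ((canon C (n + 1)).sc b hb' a ha j).eq
    · intro a ha
      refine red _ (ih2 a ha) ?_
      by_cases h1 : a = b
      · subst h1
        refine ⟨_, ih2 (a + 1) hb', _, Subalgebra.neg_mem _ hE, ?_⟩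
        rw [← sub_eq_add_neg]
        exact (canon C (n + 1)).τx0' hb'
      · by_cases h2 : a = b + 1
        · subst h2
          exact ⟨_, ih2 b (by omega), _, hE, (canon C (n + 1)).τx1' hb'⟩
        · refine ⟨_, ih2 a ha, 0, Subalgebra.zero_mem _, ?_⟩
          rw [add_zero]
          exact (canon C (n + 1)).τx b hb' a ha h1 h2

lemma Sb_tau {b : ℕ} (hb : b ≤ n) : ∀ l, b ≤ l → l < n → Ta C (n + 1) l ∈ Sb C n i b := by
  induction hb using Nat.decreasingInduction with
  | self => intro l h1 h2; omega
  | of_succ b hb ih =>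
    intro l hl hln
    have hpol := Sb_pol (C := C) (i := i) (show b + 1 ≤ n from hb)
    refine Zs_ind _ fun c a h1 h2 => ?_
    have hg : ∀ c, ∀ a, b + 1 ≤ a → a ≤ n →
      ev C n c * Ep C (n + 1) n i * tb C n a ∈ Zs C n i (b + 1) := fun c a h h' => Zs_gen c h h'
    by_cases hab : a = b
    · subst hab
      rw [tb_succ C n hb, ← mul_assoc, mul_assoc _ (Ta C (n + 1) a)]
      by_cases h3 : l = a
      · subst h3
        exact Zs_mono (by omega) ((canon C (n + 1)).τsq_mem (l := l) (Sb C n i (l + 1)) (by omega)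
          hpol.1 hpol.2 _ (hg c _ le_rfl hb))
      · by_cases h4 : l = a + 1
        · subst h4
          have hB := (canon C (n + 1)).Br_mem (l := a) (Sb C n i (a + 1)) (by omega) hpol.1 hpol.2
          have hpol2 := Sb_pol (C := C) (i := i) (show a + 2 ≤ n from hln)
          have hB := (canon C (n + 1)).Br_mem (l := a) (Sb C n i (a + 2)) (by omega)
            hpol2.1 hpol2.2
          have e1 : Ta C (n + 1) (a + 1) * (Ta C (n + 1) a * Ta C (n + 1) (a + 1)) =
            Ta C (n + 1) a * (Ta C (n + 1) (a + 1) * Ta C (n + 1) a) + (canon C (n + 1)).Br a := by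
            unfold Rep.Br
            simp only [canon]
            noncomm_ring
          have e2 := (tb_comm_Ta C n (show a + 2 ≤ n from hln) (show a + 1 < a + 2 by omega)).eq
          have e3 : Ep C (n + 1) n i * Ta C (n + 1) a = Ta C (n + 1) a * Ep C (n + 1) n i := by
            rw [← io_Ta C n (show a + 1 < n by omega)]; exact (io_comm_Ep C n i _).eq
          have e4 : ev C n (c * Polynomial.C (Ta C n a)) = ev C n c * Ta C (n + 1) a := by
            rw [map_mul, ev_C, io_Ta C n (show a + 1 < n by omega)]
          have e5 : tb C n (a + 1) = tb C n (a + 2) * Ta C (n + 1) (a + 1) := tb_succ C n hln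
          have e6 : ev C n c * Ep C (n + 1) n i * tb C n (a + 1) *
              (Ta C (n + 1) a * Ta C (n + 1) (a + 1)) =
              ev C n (c * Polynomial.C (Ta C n a)) * Ep C (n + 1) n i * tb C n a +
              ev C n c * Ep C (n + 1) n i * tb C n (a + 2) * (canon C (n + 1)).Br a := by
            rw [e4, tb_succ C n hb, e5]
            simp only [mul_assoc]
            rw [e1, mul_add, mul_add, mul_add, ← mul_assoc (tb C n (a + 2)), e2]
            simp only [mul_assoc]
            rw [← mul_assoc (Ep C (n + 1) n i), e3]
            simp only [mul_assoc]
          rw [e6]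
          refine Submodule.add_mem _ ?_ (Zs_mono (show a ≤ a + 2 by omega) (hB _
            (Zs_gen c le_rfl hln)))
          exact Zs_gen _ le_rfl hb.le
        · have e1 : Ta C (n + 1) a * Ta C (n + 1) l = Ta C (n + 1) l * Ta C (n + 1) a :=
            (canon C (n + 1)).ττ a l (by omega) (by omega)
          rw [e1, ← mul_assoc]
          exact Zs_o hb (ih l (by omega) hln _ (hg c _ le_rfl hb))
    · by_cases h3 : l = b
      · subst h3
        exact Zs_o hb (hg c a (by omega) h2)
      · exact Zs_mono (by omega) (ih l (by omega) hln _ (hg c a (by omega) h2))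

lemma Zs_all (z) : Ep C (n + 1) n i * z ∈ Zs C n i 0 := by
  have hp := Sb_pol (C := C) (i := i) (Nat.zero_le n)
  have : z ∈ Sb C n i 0 := KA_top C _ hp.1 hp.2
    (fun l hl => Sb_tau (Nat.zero_le n) l (Nat.zero_le l) (by omega)) z
  refine this _ (Zs_mono (Nat.zero_le n) ?_)
  have := Zs_top_gen (C := C) (n := n) (i := i) 1 (map_one _).symm
  rwa [one_mul] at this

lemma Zs_coeff {z} (hz : z ∈ Zs C n i 0) : ∃ c : Fin (n + 1) → Polynomial (KA C n),
    z = ∑ a, ev C n (c a) * (Ep C (n + 1) n i * tb C n a) := by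
  induction hz using Submodule.span_induction with
  | mem x hx =>
    obtain ⟨c, a, -, h, rfl⟩ := hx
    refine ⟨Pi.single ⟨a, by omega⟩ c, ?_⟩
    rw [Finset.sum_eq_single (⟨a, by omega⟩ : Fin (n + 1))]
    · simp [mul_assoc]
    · intro b _ hb; rw [Pi.single_eq_of_ne hb, map_zero, zero_mul]
    · simp
  | zero => exact ⟨0, by simp⟩
  | add x y _ _ hx hy =>
    obtain ⟨c, rfl⟩ := hx
    obtain ⟨c', rfl⟩ := hy
    exact ⟨c + c', by simp [add_mul, Finset.sum_add_distrib]⟩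
  | smul s x _ hx =>
    obtain ⟨c, rfl⟩ := hx
    refine ⟨fun a => Polynomial.C (algebraMap k _ s) * c a, ?_⟩
    rw [Finset.smul_sum]
    refine Finset.sum_congr rfl fun a _ => ?_
    rw [map_mul, ev_C, AlgHom.commutes, mul_assoc, ← Algebra.smul_def]

variable (i) in
lemma span_ei (z : KA C (n + 1)) : ∃ c : Fin (n + 1) → Polynomial (KA C n),
    Ep C (n + 1) n i * z = ∑ a, ev C n (c a) * (Ep C (n + 1) n i * tb C n a) := Zs_coeff (Zs_all z)

end Span
end KLR


namespace KLR
open Finset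

variable {k : Type} [Field k] {I : Type} [Fintype I] [DecidableEq I]

section Lead
open Polynomial
variable (C : CartanDatum k I) {A : Type} [Ring A] [Algebra k A]

/-- degree of `Q_{ij}` in the first variable -/
def dg (i j : I) : ℕ := (-(C.a i j)).toNat

lemma dg_cast {i j : I} (h : i ≠ j) : (dg C i j : ℤ) = -(C.a i j) := by
  have := C.a_nonpos i j h
  unfold dg; omega

/-- lower terms -/
noncomputable def Qlow (i j : I) (u v : A) : A :=
    ∑ p ∈ Finset.range (dg C i j), ∑ q ∈ Finset.range ((-(C.a j i)).toNat + 1),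
      if C.d i * (p : ℤ) + C.d j * (q : ℤ) = -(C.d i * C.a i j) then
        C.t i j p q • (u ^ p * v ^ q) else 0

lemma Qel_eq {i j : I} (h : i ≠ j) (u v : A) :
    Qel C i j u v = C.t i j (dg C i j) 0 • u ^ (dg C i j) + Qlow C i j u v := by
  unfold Qel Qlow
  rw [if_neg h]
  change (∑ p ∈ Finset.range (dg C i j + 1), _) = _
  rw [Finset.sum_range_succ, add_comm]
  congr 1
  rw [Finset.sum_eq_single 0]
  · rw [if_pos, pow_zero, mul_one]
    rw [dg_cast C h]; push_cast; ring
  · intro q _ hq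
    rw [if_neg]
    rw [dg_cast C h]
    intro h'
    have h1 := C.d_pos j
    have : (C.d j : ℤ) * q = 0 := by linarith
    rcases mul_eq_zero.mp this with h2 | h2
    · omega
    · omega
  · simp

lemma Qlow_degree (i j : I) (v : A) (hn : dg C i j ≠ 0 ∨ True) :
    (Qlow C i j (Polynomial.X : A[X]) (Polynomial.C v)).degree < (dg C i j : WithBot ℕ) := by
  unfold Qlow
  refine (Polynomial.degree_sum_le _ _).trans_lt ?_
  rw [Finset.sup_lt_iff (WithBot.bot_lt_coe _)]
  intro p hp
  refine (Polynomial.degree_sum_le _ _).trans_lt ?_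
  rw [Finset.sup_lt_iff (WithBot.bot_lt_coe _)]
  intro q hq
  have hp' : (p : WithBot ℕ) < (dg C i j : WithBot ℕ) := by
    exact_mod_cast Finset.mem_range.mp hp
  split_ifs
  · refine lt_of_le_of_lt (Polynomial.degree_smul_le _ _) ?_
    rw [← map_pow, Polynomial.X_pow_mul_C]
    exact (Polynomial.degree_C_mul_X_pow_le _ _).trans_lt hp'
  · rw [Polynomial.degree_zero]; exact WithBot.bot_lt_coe _

/-- the normalising scalar -/
noncomputable def kap (i j : I) : k := (C.t i j (dg C i j) 0)⁻¹

lemma kap_mul {i j : I} (h : i ≠ j) : kap C i j * C.t i j (dg C i j) 0 = 1 :=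
  inv_mul_cancel₀ (C.t_lead i j h)

lemma Qel_monic {i j : I} (h : i ≠ j) (v : A) :
    kap C i j • Qel C i j (Polynomial.X : A[X]) (Polynomial.C v) =
      Polynomial.X ^ (dg C i j) + kap C i j • Qlow C i j Polynomial.X (Polynomial.C v) := by
  rw [Qel_eq C h, smul_add, smul_smul, kap_mul C h, one_smul]

lemma Qel_monic' {i j : I} (h : i ≠ j) (v : A) :
    (kap C i j • Qel C i j (Polynomial.X : A[X]) (Polynomial.C v)).Monic := by
  rw [Qel_monic C h]
  exact Polynomial.monic_X_pow_add ((Polynomial.degree_smul_le _ _).trans_lt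
    (Qlow_degree C i j v (Or.inr trivial)))

lemma Qel_natDegree [Nontrivial A] {i j : I} (h : i ≠ j) (v : A) :
    (kap C i j • Qel C i j (Polynomial.X : A[X]) (Polynomial.C v)).natDegree = dg C i j := by
  rw [Qel_monic C h]
  apply Polynomial.natDegree_eq_of_degree_eq_some
  rw [Polynomial.degree_add_eq_left_of_degree_lt, Polynomial.degree_X_pow]
  rw [Polynomial.degree_X_pow]
  exact (Polynomial.degree_smul_le _ _).trans_lt (Qlow_degree C i j v (Or.inr trivial))
end Lead

namespace Rep
variable {C : CartanDatum k I} {n : ℕ} {A : Type} [Ring A] [Algebra k A] (r : Rep C n A)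

/-- intertwiners -/
noncomputable def ph (l : ℕ) : A := r.τ l * r.x (l + 1) - r.x (l + 1) * r.τ l

lemma ph_eq {l : ℕ} (h : l + 1 < n) : r.ph l = (r.x l - r.x (l + 1)) * r.τ l + r.E l := by
  rw [ph, r.τx1' h]; noncomm_ring

lemma ph_x0 {l : ℕ} (h : l + 1 < n) : r.ph l * r.x l = r.x (l + 1) * r.ph l := by
  have h1 := r.xx l (by omega) (l + 1) h
  have h2 := r.τx0' h
  have h3 := (r.E_comm_x h (show l < n by omega)).eq
  have h4 := (r.E_comm_x h h).eq
  rw [r.ph_eq h, add_mul, mul_assoc, h2, mul_sub, sub_mul (r.x l) (r.x (l + 1)) (r.E l), h4, h3,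
    ← mul_assoc, mul_add, ← mul_assoc (r.x (l + 1)), h4]
  have : (r.x l - r.x (l + 1)) * r.x (l + 1) = r.x (l + 1) * (r.x l - r.x (l + 1)) := by
    rw [sub_mul, mul_sub, h1]
  rw [this]; noncomm_ring

lemma ph_x1 {l : ℕ} (h : l + 1 < n) : r.ph l * r.x (l + 1) = r.x l * r.ph l := by
  have h1 := r.xx l (by omega) (l + 1) h
  have h2 := r.τx1' h
  have h3 := (r.E_comm_x h (show l < n by omega)).eq
  have h4 := (r.E_comm_x h h).eq
  rw [r.ph_eq h, add_mul, mul_assoc, h2, mul_add, sub_mul (r.x l) (r.x (l + 1)) (r.E l), h4, h3,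
    ← mul_assoc, mul_add, ← mul_assoc (r.x l), h3]
  have : (r.x l - r.x (l + 1)) * r.x l = r.x l * (r.x l - r.x (l + 1)) := by
    rw [sub_mul, mul_sub, h1]
  rw [this]; noncomm_ring

lemma ph_xn {l a : ℕ} (h : l + 1 < n) (ha : a < n) (h1 : a ≠ l) (h2 : a ≠ l + 1) :
    Commute (r.ph l) (r.x a) := by
  have e1 : Commute (r.τ l) (r.x a) := r.τx l h a ha h1 h2
  have e2 : Commute (r.x (l + 1)) (r.x a) := r.xx _ h a ha
  exact (e1.mul_left e2).sub_left (e2.mul_left e1)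
end Rep
end KLR


namespace KLR
open Finset

variable {k : Type} [Field k] {I : Type} [Fintype I] [DecidableEq I]

section DD
variable (C : CartanDatum k I) (n : ℕ)

/-- the intertwiner -/
noncomputable abbrev Ph (l : ℕ) : KA C n := (canon C n).ph l

/-- auxiliary recursion -/
noncomputable def pd : ℕ → KA C (n + 1)
  | 0 => 1
  | m + 1 => pd m * Ph C (n + 1) (n - 1 - m)

/-- `φ_{n-1} ⋯ φ_b` -/
noncomputable def pb (b : ℕ) : KA C (n + 1) := pd C n (n - b)

lemma pb_n : pb C n n = 1 := by rw [pb, Nat.sub_self, pd]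
lemma pb_succ {b : ℕ} (h : b < n) : pb C n b = pb C n (b + 1) * Ph C (n + 1) b := by
  rw [pb, show n - b = (n - (b + 1)) + 1 by omega, pd, pb]
  congr 2; omega

lemma pb_X {b : ℕ} (hb : b ≤ n) : X C (n + 1) n * pb C n b = pb C n b * X C (n + 1) b := by
  induction hb using Nat.decreasingInduction with
  | self => rw [pb_n, mul_one, one_mul]
  | of_succ b hb ih =>
    rw [pb_succ C n hb, ← mul_assoc, ih, mul_assoc, mul_assoc]
    congr 1
    exact ((canon C (n + 1)).ph_x0 (show b + 1 < n + 1 by omega)).symm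

/-- `D_m` -/
noncomputable def Dm (m : ℕ) : KA C (n + 1) →ₗ[k] KA C (n + 1) :=
  LinearMap.mulRight k (X C (n + 1) m) - LinearMap.mulLeft k (X C (n + 1) n)

lemma Dm_apply (m : ℕ) (z) : Dm C n m z = z * X C (n + 1) m - X C (n + 1) n * z := rfl

/-- auxiliary -/
noncomputable def ddr : ℕ → (KA C (n + 1) →ₗ[k] KA C (n + 1))
  | 0 => LinearMap.id
  | m + 1 => Dm C n (n - m) ∘ₗ ddr m

/-- iterated `D` -/
noncomputable def dd (a : ℕ) : KA C (n + 1) →ₗ[k] KA C (n + 1) := ddr C n (n - a)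

lemma dd_n (z) : dd C n n z = z := by rw [dd, Nat.sub_self, ddr]; rfl
lemma dd_succ {a : ℕ} (h : a < n) (z) : dd C n a z = Dm C n (a + 1) (dd C n (a + 1) z) := by
  rw [dd, show n - a = (n - (a + 1)) + 1 by omega, ddr, dd, LinearMap.comp_apply]
  congr 2; omega

lemma dd_mul {a : ℕ} (ha : a ≤ n) {α : KA C (n + 1)} (h : Commute (X C (n + 1) n) α) (z) :
    dd C n a (α * z) = α * dd C n a z := by
  induction ha using Nat.decreasingInduction with
  | self => rw [dd_n, dd_n]
  | of_succ a ha ih =>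
    rw [dd_succ C n ha, ih, dd_succ C n ha, Dm_apply, Dm_apply, mul_sub, ← mul_assoc, ← mul_assoc,
      ← mul_assoc, h.eq]

lemma dd_tau {a l : ℕ} (ha : a ≤ n) (hl : l < a) (z) :
    dd C n a (z * Ta C (n + 1) l) = dd C n a z * Ta C (n + 1) l := by
  induction ha using Nat.decreasingInduction with
  | self => rw [dd_n, dd_n]
  | of_succ a ha ih =>
    have := (canon C (n + 1)).τx l (by omega) (a + 1) (by omega) (by omega) (by omega)
    change Ta C (n + 1) l * X C (n + 1) (a + 1) = X C (n + 1) (a + 1) * Ta C (n + 1) l at this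
    rw [dd_succ C n ha, ih (by omega), dd_succ C n ha, Dm_apply, Dm_apply, sub_mul, mul_assoc,
      mul_assoc, this, ← mul_assoc, ← mul_assoc]

lemma dd_tb {a : ℕ} (ha : a ≤ n) : dd C n a (tb C n a) = pb C n a := by
  induction ha using Nat.decreasingInduction with
  | self => rw [dd_n, tb_n, pb_n]
  | of_succ a ha ih =>
    rw [tb_succ C n ha, dd_succ C n ha, dd_tau C n (by omega) (by omega), ih, Dm_apply,
      pb_succ C n ha, ← mul_assoc, pb_X C n (by omega), mul_assoc, mul_assoc, ← mul_sub]
    rfl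

lemma dd_zero {b : ℕ} (hb : b ≤ n) : ∀ a, a < b → dd C n a (tb C n b) = 0 := by
  have : ∀ m, ∀ a, a + m + 1 = b → dd C n a (tb C n b) = 0 := by
    intro m
    induction m with
    | zero =>
      rintro a rfl
      rw [dd_succ C n (by omega), dd_tb C n (by omega), Dm_apply, pb_X C n (by omega)]
      exact sub_self _
    | succ m ih =>
      intro a h
      rw [dd_succ C n (by omega), ih (a + 1) (by omega), map_zero]
  intro a h
  exact this (b - a - 1) a (by omega)
end DD

section Rho
variable (C : CartanDatum k I) (L : Type) [Field L] [Algebra k L] (n : ℕ)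

/-- the representation -/
noncomputable def rho : KA C n →ₐ[k] Module.End k (Pt C L n → L) := (fRep C L n).lift

variable {C L n}

lemma rho_X {a : ℕ} (h : a < n) (F : Pt C L n → L) (ω) :
    rho C L n (X C n a) F ω = ω.z a * F ω := by rw [rho, Rep.lift_X _ h]; rfl
lemma rho_Ep {a : ℕ} (h : a < n) (j : I) (F : Pt C L n → L) (ω) :
    rho C L n (Ep C n a j) F ω = (if ω.ν a = j then 1 else 0) * F ω := by
  rw [rho, Rep.lift_Ep _ h]
  change ind C L n a j ω * F ω = _
  unfold ind; congr
lemma rho_Ta {l : ℕ} (h : l + 1 < n) (F : Pt C L n → L) (ω : Pt C L n) :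
    rho C L n (Ta C n l) F ω = if ω.ν l = ω.ν (l + 1) then (F (ω.sw l h) - F ω) / (ω.z l - ω.z (l + 1))
    else Pp C (ω.ν l) (ω.ν (l + 1)) (ω.z l) (ω.z (l + 1)) * F (ω.sw l h) := by
  rw [rho, Rep.lift_Ta _ h]; exact tauOp_apply h F ω

lemma Pt.sub_ne {a b : ℕ} (ω : Pt C L n) (ha : a < n) (hb : b < n) (h : a ≠ b) :
    ω.z a - ω.z b ≠ 0 := fun h' => h (ω.inj a ha b hb (sub_eq_zero.mp h'))

/-- the coefficient of the intertwiner -/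
noncomputable def pc (l : ℕ) (ω : Pt C L n) : L := if ω.ν l = ω.ν (l + 1) then 1 else
  (ω.z l - ω.z (l + 1)) * Pp C (ω.ν l) (ω.ν (l + 1)) (ω.z l) (ω.z (l + 1))

lemma rho_Ph {l : ℕ} (h : l + 1 < n) (F : Pt C L n → L) (ω : Pt C L n) :
    rho C L n (Ph C n l) F ω = pc l ω * F (ω.sw l h) := by
  change rho C L n (Ta C n l * X C n (l + 1) - X C n (l + 1) * Ta C n l) F ω = _
  have hz := ω.sub_ne (show l < n by omega) h (by omega)
  rw [map_sub, map_mul, map_mul]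
  simp only [LinearMap.sub_apply, Module.End.mul_apply, Pi.sub_apply, rho_Ta h, rho_X h, pc,
    Pt.sw_z1]
  split_ifs
  · field_simp; ring
  · ring

lemma pc_ne {l : ℕ} (h : l + 1 < n) (ω : Pt C L n) : pc l ω ≠ 0 := by
  unfold pc
  split_ifs with h1
  · exact one_ne_zero
  · refine mul_ne_zero (ω.sub_ne (by omega) h (by omega)) ?_
    have := ω.ne l (by omega) (l + 1) h h1
    rw [← Pp_mul C h1] at this
    exact left_ne_zero_of_mul this

lemma rho_Ph_surj {l : ℕ} (h : l + 1 < n) : Function.Surjective (rho C L n (Ph C n l)) := by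
  intro G
  refine ⟨fun ω => G (ω.sw l h) / pc l (ω.sw l h), ?_⟩
  funext ω
  rw [rho_Ph h, Pt.sw_sw]
  have := pc_ne h ω
  field_simp

lemma rho_pb_surj {b : ℕ} (hb : b ≤ n) : Function.Surjective (rho C L (n + 1) (pb C n b)) := by
  induction hb using Nat.decreasingInduction with
  | self => rw [pb_n, map_one]; exact fun z => ⟨z, rfl⟩
  | of_succ b hb ih =>
    rw [pb_succ C n hb, map_mul]
    exact ih.comp (rho_Ph_surj (show b + 1 < n + 1 by omega))

lemma rho_D {m : ℕ} (z) (h : rho C L (n + 1) z = 0) : rho C L (n + 1) (Dm C n m z) = 0 := by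
  rw [Dm_apply, map_sub, map_mul, map_mul, h, zero_mul, mul_zero, sub_zero]

lemma rho_dd {a : ℕ} (ha : a ≤ n) (z) (h : rho C L (n + 1) z = 0) :
    rho C L (n + 1) (dd C n a z) = 0 := by
  induction ha using Nat.decreasingInduction with
  | self => rwa [dd_n]
  | of_succ a ha ih => rw [dd_succ C n ha]; exact rho_D _ ih

/-- triangularity -/
lemma rho_coef (i : I) (c : Fin (n + 1) → Polynomial (KA C n))
    (hev : ∀ p : Polynomial (KA C n), rho C L (n + 1) (ev C n p * Ep C (n + 1) n i) = 0 → p = 0)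
    (h : rho C L (n + 1) (∑ a, ev C n (c a) * (Ep C (n + 1) n i * tb C n a)) = 0) : c = 0 := by
  have key : ∀ m : ℕ, ∀ a : Fin (n + 1), a.1 < m → c a = 0 := by
    intro m
    induction m with
    | zero => intro a h; omega
    | succ m ih =>
      intro a ham
      by_cases hlt : a.1 < m
      · exact ih a hlt
      have ham' : a.1 = m := by omega
      have han : a.1 ≤ n := by omega
      have h1 := rho_dd han _ h
      rw [map_sum, Finset.sum_eq_single a] at h1
      · rw [← mul_assoc, dd_mul C n han, dd_tb C n han, map_mul] at h1
        · apply hev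
          apply LinearMap.ext
          intro G
          obtain ⟨F, rfl⟩ := rho_pb_surj (C := C) (L := L) han G
          exact DFunLike.congr_fun h1 F
        · exact (ev_comm_X C n _).mul_right ((canon C (n + 1)).xε n (by omega) n (by omega) i)
      · intro b _ hb
        by_cases hb' : b.1 < m
        · rw [ih b hb', map_zero, zero_mul, map_zero]
        · have : a.1 ≠ b.1 := fun h => hb (Fin.ext h.symm)
          rw [← mul_assoc, dd_mul C n han, dd_zero C n (by omega) _ (by omega), mul_zero]
          exact (ev_comm_X C n _).mul_right ((canon C (n + 1)).xε n (by omega) n (by omega) i)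
      · simp
  funext a
  exact key (n + 1) a a.2
end Rho
end KLR


namespace KLR
open Finset

variable {k : Type} [Field k] {I : Type} [Fintype I] [DecidableEq I]

section Res
variable {C : CartanDatum k I} {L : Type} [Field L] [Algebra k L] {n : ℕ}

/-- forget the last strand -/
noncomputable def Pt.res (i₀ : I) (z₀ : L) (ω : Pt C L (n + 1)) : Pt C L n where
  ν a := if a = n then i₀ else ω.ν a
  z a := if a = n then z₀ else ω.z a
  inj a ha b hb h := by
    rw [if_neg (by omega), if_neg (by omega)] at h
    exact ω.inj a (by omega) b (by omega) h
  ne a ha b hb h := by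
    rw [if_neg (by omega), if_neg (by omega)] at h
    rw [if_neg (by omega), if_neg (by omega), if_neg (by omega), if_neg (by omega)]
    exact ω.ne a (by omega) b (by omega) h

lemma Pt.res_sw (i₀ : I) (z₀ : L) (ω : Pt C L (n + 1)) {l : ℕ} (h : l + 1 < n) :
    (ω.sw l (show l + 1 < n + 1 by omega)).res i₀ z₀ = (ω.res i₀ z₀).sw l h := by
  have key : ∀ a, Equiv.swap l (l + 1) a = n ↔ a = n := by
    intro a
    rw [Equiv.swap_apply_def]; split_ifs <;> omega
  apply Pt.ext' <;> intro a <;> simp [Pt.res, Pt.sw, key]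

lemma Pt.res_ν (i₀ : I) (z₀ : L) (ω : Pt C L (n + 1)) {a : ℕ} (h : a < n) :
    (ω.res i₀ z₀).ν a = ω.ν a := if_neg (by omega)
lemma Pt.res_z (i₀ : I) (z₀ : L) (ω : Pt C L (n + 1)) {a : ℕ} (h : a < n) :
    (ω.res i₀ z₀).z a = ω.z a := if_neg (by omega)

lemma rho_res (i₀ : I) (z₀ : L) (r : KA C n) : ∀ (F : Pt C L n → L),
    rho C L (n + 1) (io C n r) (fun ω => F (ω.res i₀ z₀)) =
      fun ω => rho C L n r F (ω.res i₀ z₀) := by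
  let S : Subalgebra k (KA C n) :=
    { carrier := {r | ∀ (F : Pt C L n → L), rho C L (n + 1) (io C n r) (fun ω => F (ω.res i₀ z₀)) =
        fun ω => rho C L n r F (ω.res i₀ z₀)}
      mul_mem' := by
        intro a b ha hb F
        rw [map_mul, map_mul, Module.End.mul_apply, hb F, ha, map_mul]
        rfl
      add_mem' := by
        intro a b ha hb F
        rw [map_add, map_add, LinearMap.add_apply, ha F, hb F, map_add]
        rfl
      algebraMap_mem' := by
        intro c F
        rw [AlgHom.commutes, AlgHom.commutes, AlgHom.commutes]
        rfl }
  refine KA_top C S ?_ ?_ ?_ r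
  · intro a ha j F
    funext ω
    rw [io_Ep C n ha, rho_Ep (by omega), rho_Ep ha, Pt.res_ν _ _ _ ha]
  · intro a ha F
    funext ω
    rw [io_X C n ha, rho_X (by omega), rho_X ha, Pt.res_z _ _ _ ha]
  · intro l hl F
    funext ω
    rw [io_Ta C n hl, rho_Ta (show l + 1 < n + 1 by omega), rho_Ta hl, Pt.res_ν _ _ _ hl,
      Pt.res_z _ _ _ hl, Pt.res_ν _ _ _ (show l < n by omega), Pt.res_z _ _ _ (show l < n by omega),
      Pt.res_sw _ _ _ hl]

/-- the condition for adding a strand -/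
def Pt.good (ω : Pt C L n) (i : I) (y : L) : Prop :=
  ∀ a < n, ω.z a ≠ y ∧ (i ≠ ω.ν a → Qel C i (ω.ν a) y (ω.z a) ≠ 0)

/-- add a strand -/
noncomputable def Pt.ex (ω : Pt C L n) (i : I) (y : L) (h : ω.good i y) : Pt C L (n + 1) where
  ν a := if a = n then i else ω.ν a
  z a := if a = n then y else ω.z a
  inj a ha b hb hab := by
    by_cases h1 : a = n
    · by_cases h2 : b = n
      · omega
      · rw [if_pos h1, if_neg h2] at hab
        exact absurd hab.symm (h b (by omega)).1
    · by_cases h2 : b = n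
      · rw [if_neg h1, if_pos h2] at hab
        exact absurd hab (h a (by omega)).1
      · rw [if_neg h1, if_neg h2] at hab
        exact ω.inj a (by omega) b (by omega) hab
  ne a ha b hb hab := by
    by_cases h1 : a = n
    · by_cases h2 : b = n
      · exact absurd (by rw [h1, h2]) hab
      · rw [if_pos h1, if_neg h2] at hab
        rw [if_pos h1, if_neg h2, if_pos h1, if_neg h2]
        exact (h b (by omega)).2 hab
    · by_cases h2 : b = n
      · rw [if_neg h1, if_pos h2] at hab
        rw [if_neg h1, if_pos h2, if_neg h1, if_pos h2, Qel_symm]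
        exact (h a (by omega)).2 (Ne.symm hab)
      · rw [if_neg h1, if_neg h2] at hab
        rw [if_neg h1, if_neg h2, if_neg h1, if_neg h2]
        exact ω.ne a (by omega) b (by omega) hab

lemma Pt.res_ex (ω : Pt C L n) (i : I) (y : L) (h : ω.good i y) :
    (ω.ex i y h).res (ω.ν n) (ω.z n) = ω := by
  apply Pt.ext' <;> intro a
  · change (if a = n then ω.ν n else if a = n then i else ω.ν a) = ω.ν a
    split_ifs with h
    · rw [h]
    · rfl
  · change (if a = n then ω.z n else if a = n then y else ω.z a) = ω.z a
    split_ifs with h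
    · rw [h]
    · rfl

lemma rho_Xpow (m : ℕ) (F : Pt C L (n + 1) → L) (ω) :
    rho C L (n + 1) (X C (n + 1) n ^ m) F ω = ω.z n ^ m * F ω := by
  induction m with
  | zero => simp
  | succ m ih => rw [pow_succ', map_mul, Module.End.mul_apply, rho_X (by omega), ih]; ring

lemma rho_ev_apply (c : Polynomial (KA C n)) (ω : Pt C L n) (i : I) (y : L) (h : ω.good i y)
    (F : Pt C L n → L) :
    rho C L (n + 1) (ev C n c * Ep C (n + 1) n i) (fun ω' => F (ω'.res (ω.ν n) (ω.z n))) (ω.ex i y h)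
      = (c.sum fun m a => Polynomial.monomial m (rho C L n a F ω)).eval y := by
  have hn : (ω.ex i y h).ν n = i := if_pos rfl
  have hz : (ω.ex i y h).z n = y := if_pos rfl
  rw [← (ev_comm_Ep C n i c).eq, map_mul, Module.End.mul_apply, rho_Ep (by omega), hn, if_pos rfl,
    one_mul]
  have : ev C n c = ∑ m ∈ c.support, X C (n + 1) n ^ m * io C n (c.coeff m) := by
    change Polynomial.eval₂ _ _ c = _
    rw [Polynomial.eval₂_eq_sum, Polynomial.sum]
    refine Finset.sum_congr rfl fun m _ => ?_
    exact ((io_comm_X C n _).pow_left m).symm.eq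
  rw [this, map_sum, LinearMap.sum_apply, Finset.sum_apply, Polynomial.sum, Polynomial.eval_finset_sum]
  refine Finset.sum_congr rfl fun m _ => ?_
  rw [map_mul, Module.End.mul_apply, rho_Xpow, rho_res, Polynomial.eval_monomial, hz, mul_comm]
  simp only [Pt.res_ex]

open Polynomial in
/-- most values are good -/
lemma exists_good_poly (ω : Pt C L n) (i : I) : ∃ H : L[X], H ≠ 0 ∧ ∀ y, H.eval y ≠ 0 → ω.good i y := by
  refine ⟨∏ a ∈ Finset.range n, ((Polynomial.X - Polynomial.C (ω.z a)) *
    (if i = ω.ν a then 1 else Qel C i (ω.ν a) Polynomial.X (Polynomial.C (ω.z a)))), ?_, ?_⟩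
  · rw [Finset.prod_ne_zero_iff]
    intro a _
    refine mul_ne_zero (X_sub_C_ne_zero _) ?_
    split_ifs with h
    · exact one_ne_zero
    · intro h0
      have := (Qel_monic' C h (ω.z a)).ne_zero
      rw [h0, smul_zero] at this
      exact this rfl
  · intro y hy a ha
    rw [eval_prod, Finset.prod_ne_zero_iff] at hy
    have h1 := hy a (Finset.mem_range.mpr ha)
    rw [eval_mul, eval_sub, eval_X, eval_C] at h1
    have h2 := left_ne_zero_of_mul h1
    have h3 := right_ne_zero_of_mul h1
    refine ⟨fun h => h2 (by rw [h, sub_self]), fun h => ?_⟩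
    rw [if_neg h] at h3
    have e := Qel_map C ((Polynomial.aeval y).restrictScalars k : L[X] →ₐ[k] L) i (ω.ν a) Polynomial.X
      (Polynomial.C (ω.z a))
    simp only [AlgHom.restrictScalars_apply, aeval_X, aeval_C, Algebra.algebraMap_self, RingHom.id_apply] at e
    rw [← e]
    simpa [Polynomial.coe_aeval_eq_eval] using h3

lemma ev_inj [Infinite L] (hinj : Function.Injective (rho C L n)) (i : I) (c : Polynomial (KA C n))
    (h : rho C L (n + 1) (ev C n c * Ep C (n + 1) n i) = 0) : c = 0 := by
  ext m
  apply hinj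
  rw [Polynomial.coeff_zero, map_zero]
  apply LinearMap.ext; intro F; funext ω
  obtain ⟨H, hH, hg⟩ := exists_good_poly ω i
  have h1 : H * (c.sum fun m a => Polynomial.monomial m (rho C L n a F ω)) = 0 := by
    apply Polynomial.funext
    intro y
    rw [Polynomial.eval_mul, Polynomial.eval_zero]
    by_cases hy : H.eval y = 0
    · rw [hy, zero_mul]
    · rw [← rho_ev_apply c ω i y (hg y hy) F, h]
      simp
  have h2 := (mul_eq_zero.mp h1).resolve_left hH
  have h3 := congrArg (fun p => Polynomial.coeff p m) h2
  simp only [Polynomial.sum, Polynomial.finset_sum_coeff, Polynomial.coeff_monomial,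
    Finset.sum_ite_eq', Polynomial.mem_support_iff, Polynomial.coeff_zero] at h3
  by_cases hm : c.coeff m = 0
  · rw [hm, map_zero]
  · rw [if_pos (Polynomial.mem_support_iff.mpr hm)] at h3
    exact h3

variable (C L n) in
theorem rho_injective [Nonempty I] [Infinite L] : Function.Injective (rho C L n) := by
  induction n with
  | zero =>
    rw [injective_iff_map_eq_zero]
    intro z hz
    have hb : z ∈ (⊥ : Subalgebra k (KA C 0)) := KA_top C _ (by intro a h; omega)
      (by intro a h; omega) (by intro a h; omega) z
    obtain ⟨c, rfl⟩ := Algebra.mem_bot.mp hb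
    rw [AlgHom.commutes] at hz
    let ω : Pt C L 0 := ⟨fun _ => Classical.arbitrary I, fun _ => 0, by intro a h; omega,
      by intro a h; omega⟩
    have h1 := congrFun (DFunLike.congr_fun hz (fun _ => (1 : L))) ω
    rw [Module.algebraMap_end_apply] at h1
    simp only [Pi.smul_apply, LinearMap.zero_apply, Pi.zero_apply, Algebra.smul_def, mul_one] at h1
    have : c = 0 := (map_eq_zero (algebraMap k L)).mp h1
    rw [this, map_zero]
  | succ n ih =>
    rw [injective_iff_map_eq_zero]
    intro z hz
    have hi : ∀ i, Ep C (n + 1) n i * z = 0 := by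
      intro i
      obtain ⟨c, hc⟩ := span_ei i z
      have h0 : rho C L (n + 1) (Ep C (n + 1) n i * z) = 0 := by rw [map_mul, hz, mul_zero]
      rw [hc] at h0 ⊢
      rw [rho_coef i c (ev_inj ih i) h0]
      simp
    have hs := (canon C (n + 1)).εsum n (by omega)
    change ∑ j, Ep C (n + 1) n j = 1 at hs
    rw [← one_mul z, ← hs, Finset.sum_mul]
    exact Finset.sum_eq_zero fun i _ => hi i

/-- uniqueness of coefficients -/
theorem coef_unique (i : I) (c : Fin (n + 1) → Polynomial (KA C n))
    (h : (∑ a, ev C n (c a) * (Ep C (n + 1) n i * tb C n a)) = 0) : c = 0 := by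
  haveI : Nonempty I := ⟨i⟩
  exact rho_coef (L := AlgebraicClosure k) i c (ev_inj (rho_injective C _ n) i) (by rw [h, map_zero])
end Res
end KLR


namespace KLR
open Finset

variable {k : Type} [Field k] {I : Type} [Fintype I] [DecidableEq I]

section Frame
variable {C : CartanDatum k I} {n : ℕ} (i : I)

/-- coefficients -/
noncomputable def th (z : KA C (n + 1)) : Fin (n + 1) → Polynomial (KA C n) :=
  Classical.choose (span_ei i z)

lemma th_spec (z : KA C (n + 1)) :
    Ep C (n + 1) n i * z = ∑ a, ev C n (th i z a) * (Ep C (n + 1) n i * tb C n a) :=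
  Classical.choose_spec (span_ei i z)

lemma Ep_idem {a : ℕ} (h : a < n) : Ep C n a i * Ep C n a i = Ep C n a i := by
  have := (canon C n).εmul a h i i
  rw [if_pos rfl] at this
  exact this

lemma th_unique {z : KA C (n + 1)} {c : Fin (n + 1) → Polynomial (KA C n)}
    (h : Ep C (n + 1) n i * z = ∑ a, ev C n (c a) * (Ep C (n + 1) n i * tb C n a)) : th i z = c := by
  rw [← sub_eq_zero]
  apply coef_unique i
  simp only [Pi.sub_apply, map_sub, sub_mul, Finset.sum_sub_distrib]
  rw [← th_spec, ← h, sub_self]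

lemma th_add (z w : KA C (n + 1)) : th i (z + w) = th i z + th i w := by
  apply th_unique
  rw [mul_add, th_spec, th_spec, ← Finset.sum_add_distrib]
  simp [add_mul]

lemma th_ev (c : Polynomial (KA C n)) (z : KA C (n + 1)) :
    th i (ev C n c * z) = fun a => c * th i z a := by
  apply th_unique
  rw [← mul_assoc, (ev_comm_Ep C n i c).eq, mul_assoc, th_spec, Finset.mul_sum]
  simp [mul_assoc]

lemma th_Ep (z : KA C (n + 1)) : th i (Ep C (n + 1) n i * z) = th i z := by
  apply th_unique
  rw [← mul_assoc, Ep_idem i (by omega), th_spec]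

lemma th_surj (c : Fin (n + 1) → Polynomial (KA C n)) : ∃ z : KA C (n + 1), th i z = c := by
  refine ⟨∑ a, ev C n (c a) * (Ep C (n + 1) n i * tb C n a), th_unique i ?_⟩
  rw [Finset.mul_sum]
  refine Finset.sum_congr rfl fun a _ => ?_
  rw [← mul_assoc, (ev_comm_Ep C n i _).eq, mul_assoc, ← mul_assoc (Ep C _ _ _), Ep_idem i (by omega)]

lemma th_Ep_ne {j : I} (h : j ≠ i) (z : KA C (n + 1)) : th i (Ep C (n + 1) n j * z) = 0 := by
  apply th_unique
  have := (canon C (n + 1)).εmul n (by omega) i j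
  rw [if_neg h.symm] at this
  change Ep C (n + 1) n i * Ep C (n + 1) n j = 0 at this
  rw [← mul_assoc, this]
  simp

variable {S : Type} [Ring S] (π : KA C n →+* S)

/-- the frame map -/
noncomputable def psi : KA C (n + 1) →+ (Fin (n + 1) → Polynomial S) where
  toFun z a := (th i z a).map π
  map_zero' := by
    have : th i (0 : KA C (n + 1)) = 0 := th_unique i (by simp)
    funext a
    rw [this]; simp
  map_add' z w := by funext a; rw [th_add]; simp

lemma psi_apply (z : KA C (n + 1)) (a) : psi i π z a = (th i z a).map π := rfl

lemma psi_ev (c : Polynomial (KA C n)) (z : KA C (n + 1)) (a) :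
    psi i π (ev C n c * z) a = c.map π * psi i π z a := by
  rw [psi_apply, th_ev, Polynomial.map_mul, psi_apply]

lemma psi_io (r : KA C n) (z : KA C (n + 1)) (a) :
    psi i π (io C n r * z) a = Polynomial.C (π r) * psi i π z a := by
  rw [← ev_C, psi_ev, Polynomial.map_C]

lemma psi_Ep (z : KA C (n + 1)) : psi i π (Ep C (n + 1) n i * z) = psi i π z := by
  funext a; rw [psi_apply, th_Ep, psi_apply]

lemma psi_Ep_ne {j : I} (h : j ≠ i) (z : KA C (n + 1)) : psi i π (Ep C (n + 1) n j * z) = 0 := by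
  funext a; rw [psi_apply, th_Ep_ne i h]; simp

lemma psi_surj (hπ : Function.Surjective π) : Function.Surjective (psi (C := C) (n := n) i π) := by
  intro κ
  choose c hc using fun a => Polynomial.map_surjective π hπ (κ a)
  obtain ⟨z, hz⟩ := th_surj i c
  exact ⟨z, by funext a; rw [psi_apply, hz, hc]⟩

lemma psi_ev_zero {z : KA C (n + 1)} (h : psi i π z = 0) (c) : psi i π (ev C n c * z) = 0 := by
  funext a; rw [psi_ev, h]; simp

lemma psi_io_zero {r : KA C n} (h : π r = 0) (z : KA C (n + 1)) : psi i π (io C n r * z) = 0 := by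
  funext a; rw [psi_io, h]; simp

lemma psi_right {z : KA C (n + 1)} (h : psi i π z = 0) (w) : psi i π (z * w) = 0 := by
  rw [← psi_Ep, ← mul_assoc, th_spec, Finset.sum_mul, map_sum]
  refine Finset.sum_eq_zero fun a _ => ?_
  funext b
  rw [mul_assoc, psi_ev]
  have := congrFun h a
  rw [psi_apply] at this
  rw [this]; simp

lemma psi_right' {z z' : KA C (n + 1)} (h : psi i π z = psi i π z') (w) :
    psi i π (z * w) = psi i π (z' * w) := by
  rw [← sub_eq_zero, ← map_sub, ← sub_mul]
  exact psi_right i π (by rw [map_sub, h, sub_self]) w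

/-- expansion -/
lemma psi_kernel {z : KA C (n + 1)} (h : psi i π z = 0) :
    ∃ c : Fin (n + 1) → Polynomial (KA C n), (∀ a m, π ((c a).coeff m) = 0) ∧
      Ep C (n + 1) n i * z = ∑ a, ev C n (c a) * (Ep C (n + 1) n i * tb C n a) := by
  refine ⟨th i z, fun a m => ?_, th_spec i z⟩
  have := congrFun h a
  rw [psi_apply] at this
  rw [← Polynomial.coeff_map, this]; simp

lemma ev_sum (c : Polynomial (KA C n)) :
    ev C n c = ∑ m ∈ c.support, io C n (c.coeff m) * X C (n + 1) n ^ m := by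
  change Polynomial.eval₂ _ _ c = _
  rw [Polynomial.eval₂_eq_sum, Polynomial.sum]
  rfl

/-- membership criterion for additive maps killing the kernel -/
lemma psi_kill {G : Type} [AddCommGroup G] (f : KA C (n + 1) →+ G)
    (h1 : ∀ r z, π r = 0 → f (io C n r * z) = 0) (h2 : ∀ z, f (Ep C (n + 1) n i * z) = f z)
    {z} (h : psi i π z = 0) : f z = 0 := by
  obtain ⟨c, hc, e⟩ := psi_kernel i π h
  rw [← h2, e, map_sum]
  refine Finset.sum_eq_zero fun a _ => ?_
  rw [ev_sum, Finset.sum_mul, map_sum]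
  refine Finset.sum_eq_zero fun m _ => ?_
  rw [mul_assoc]
  exact h1 _ _ (hc a m)

/-- the shifted frame -/
noncomputable def psi' : KA C (n + 1) →+ (Fin (n + 1) → Polynomial S) :=
  (psi i (π.comp (om C n).toRingHom)).comp (om C (n + 1)).toRingHom.toAddMonoidHom

lemma psi'_apply (z : KA C (n + 1)) :
    psi' i π z = psi i (π.comp (om C n).toRingHom) (om C (n + 1) z) := rfl

lemma psi'_is (r : KA C n) (z : KA C (n + 1)) (a) :
    psi' i π (is C n r * z) a = Polynomial.C (π r) * psi' i π z a := by
  rw [psi'_apply, map_mul, om_is, psi_io, ← psi'_apply]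
  congr 2
  change π (om C n (om C n r)) = _
  rw [om_om]

lemma om_X0 : om C (n + 1) (X C (n + 1) 0) = X C (n + 1) n := by
  rw [om_X C _ (by omega)]; congr 1
lemma om_Ep0 (j : I) : om C (n + 1) (Ep C (n + 1) 0 j) = Ep C (n + 1) n j := by
  rw [om_Ep C _ (by omega)]; congr 1

lemma psi'_X (z : KA C (n + 1)) (a) :
    psi' i π (X C (n + 1) 0 * z) a = Polynomial.X * psi' i π z a := by
  rw [psi'_apply, map_mul, om_X0, ← ev_X, psi_ev, ← psi'_apply, Polynomial.map_X]

lemma psi'_Ep (z : KA C (n + 1)) : psi' i π (Ep C (n + 1) 0 i * z) = psi' i π z := by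
  rw [psi'_apply, map_mul, om_Ep0, psi_Ep]; rfl

lemma psi'_surj (hπ : Function.Surjective π) : Function.Surjective (psi' (C := C) (n := n) i π) := by
  intro κ
  obtain ⟨z, hz⟩ := psi_surj (C := C) (n := n) i (π.comp (om C n).toRingHom)
    (hπ.comp fun z => ⟨om C n z, om_om C n z⟩) κ
  exact ⟨om C (n + 1) z, by rw [psi'_apply, om_om, hz]⟩

lemma psi'_right {z : KA C (n + 1)} (h : psi' i π z = 0) (w) : psi' i π (z * w) = 0 := by
  rw [psi'_apply, map_mul]; exact psi_right i _ h _

lemma psi'_kill {G : Type} [AddCommGroup G] (f : KA C (n + 1) →+ G)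
    (h1 : ∀ r z, π r = 0 → f (is C n r * z) = 0) (h2 : ∀ z, f (Ep C (n + 1) 0 i * z) = f z)
    {z} (h : psi' i π z = 0) : f z = 0 := by
  have := psi_kill i (π.comp (om C n).toRingHom)
    (f.comp (om C (n + 1)).toRingHom.toAddMonoidHom) ?_ ?_ h
  · change f (om C (n + 1) (om C (n + 1) z)) = 0 at this
    rwa [om_om] at this
  · intro r z hr
    change f (om C (n + 1) (io C n r * z)) = 0
    rw [map_mul, om_io]
    exact h1 _ _ hr
  · intro z
    change f (om C (n + 1) (Ep C (n + 1) n i * z)) = f (om C (n + 1) z)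
    rw [map_mul, ← om_Ep0, om_om, h2]

lemma is_comm_X (r : KA C n) : Commute (X C (n + 1) 0) (is C n r) := by
  have := (io_comm_X C n (om C n r)).map (om C (n + 1))
  rw [← om_X0, om_om, ← is_apply] at this
  exact this

variable (C n) in
/-- shifted evaluation -/
noncomputable def evs : Polynomial (KA C n) →+* KA C (n + 1) :=
  Polynomial.eval₂RingHom' (is C n).toRingHom (X C (n + 1) 0) fun z => (is_comm_X z).symm

lemma evs_C (z) : evs C n (Polynomial.C z) = is C n z := Polynomial.eval₂_C _ _
lemma evs_X : evs C n Polynomial.X = X C (n + 1) 0 := Polynomial.eval₂_X _ _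

lemma psi'_evs (c : Polynomial (KA C n)) (z : KA C (n + 1)) (a) :
    psi' i π (evs C n c * z) a = c.map π * psi' i π z a := by
  induction c using Polynomial.induction_on' generalizing z with
  | add p q hp hq => rw [map_add, add_mul, map_add, Pi.add_apply, hp, hq, Polynomial.map_add, add_mul]
  | monomial m r =>
    have hX : ∀ m z, psi' i π (X C (n + 1) 0 ^ m * z) a = Polynomial.X ^ m * psi' i π z a := by
      intro m
      induction m with
      | zero => intro z; simp
      | succ m ih => intro z; rw [pow_succ, mul_assoc, ih, psi'_X, pow_succ, mul_assoc]
    rw [← Polynomial.C_mul_X_pow_eq_monomial, map_mul (evs C n), map_pow, evs_C, evs_X, mul_assoc, psi'_is, hX]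
    simp [mul_assoc]

lemma evs_eq (c : Polynomial (KA C n)) : 
    evs C n c = om C (n + 1) (ev C n (c.map (om C n).toRingHom)) := by
  induction c using Polynomial.induction_on' with
  | add p q hp hq => rw [map_add, hp, hq, Polynomial.map_add, map_add, map_add]
  | monomial m r =>
    rw [← Polynomial.C_mul_X_pow_eq_monomial, map_mul, map_pow, evs_C, evs_X, Polynomial.map_mul,
      Polynomial.map_pow, Polynomial.map_X, Polynomial.map_C, map_mul, map_pow, ev_C, ev_X, map_mul,
      map_pow, ← om_X0, om_om]
    rfl

lemma evs_inj (i : I) : Function.Injective (evs C n) := by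
  rw [injective_iff_map_eq_zero]
  intro c hc
  rw [evs_eq] at hc
  have h1 := congrArg (om C (n + 1)) hc
  rw [om_om, map_zero] at h1
  have h2 : th i (ev C n (c.map (om C n).toRingHom) * 1) = 0 := by
    rw [h1, zero_mul]; exact th_unique i (by simp)
  rw [th_ev] at h2
  have h3 : th (C := C) i (1 : KA C (n + 1)) (Fin.last n) = 1 := by
    rw [th_unique i (z := 1) (c := Pi.single (Fin.last n) 1)]
    · simp
    · rw [Finset.sum_eq_single (Fin.last n)]
      · simp [tb_n]
      · intro b _ hb; rw [Pi.single_eq_of_ne hb, map_zero, zero_mul]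
      · simp
  have h4 := congrFun h2 (Fin.last n)
  simp only [h3, mul_one, Pi.zero_apply] at h4
  rw [← Polynomial.map_zero (om C n).toRingHom] at h4
  refine Polynomial.map_injective _ ?_ h4
  intro a b hab
  have := congrArg (om C n) hab
  change om C n (om C n a) = om C n (om C n b) at this
  rwa [om_om, om_om] at this
end Frame
end KLR


namespace KLR
open Finset

variable {k : Type} [Field k] {I : Type} [Fintype I] [DecidableEq I]

section Vv
variable (C : CartanDatum k I) (n : ℕ) (i : I) (N : ℕ)

/-- `τ_{b-1} ⋯ τ_0 x_0^N ε_0(i)` -/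
noncomputable def Vv : ℕ → KA C n
  | 0 => X C n 0 ^ N * Ep C n 0 i
  | b + 1 => Ta C n b * Vv b

variable {C n i N}

lemma tb_Vv {b : ℕ} (h : b ≤ n) : tb C n b * Vv C (n + 1) i N b = Vv C (n + 1) i N n := by
  induction h using Nat.decreasingInduction with
  | self => rw [tb_n, one_mul]
  | of_succ b h ih => rw [tb_succ C n h, mul_assoc]; exact ih

lemma io_Vv {b : ℕ} (h : b < n) : io C n (Vv C n i N b) = Vv C (n + 1) i N b := by
  induction b with
  | zero => rw [Vv, Vv, map_mul, map_pow, io_X C n h, io_Ep C n h]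
  | succ b ih => rw [Vv, Vv, map_mul, io_Ta C n h, ih (by omega)]

lemma Vv_comm_X {a b : ℕ} (h : a < b) (hb : b < n) : Commute (Vv C n i N a) (X C n b) := by
  induction a with
  | zero =>
    refine Commute.mul_left (Commute.pow_left ?_ _) ?_
    · exact (canon C n).xx 0 (by omega) b hb
    · exact ((canon C n).xε b hb 0 (by omega) i).symm
  | succ a ih =>
    exact Commute.mul_left ((canon C n).τx a (by omega) b hb (by omega) (by omega)) (ih (by omega))

lemma Vv_comm_Ep {a b : ℕ} (h : a < b) (hb : b < n) (j : I) :
    Commute (Vv C n i N a) (Ep C n b j) := by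
  induction a with
  | zero =>
    refine Commute.mul_left (Commute.pow_left ?_ _) ?_
    · exact (canon C n).xε 0 (by omega) b hb j
    · exact (canon C n).εε 0 (by omega) b hb i j
  | succ a ih =>
    exact Commute.mul_left ((canon C n).τε a (by omega) b hb (by omega) (by omega) j) (ih (by omega))

lemma Vv_comm_Ta {a l : ℕ} (h : a < l) (hl : l + 1 < n) :
    Commute (Vv C n i N a) (Ta C n l) := by
  induction a with
  | zero =>
    refine Commute.mul_left (Commute.pow_left ?_ _) ?_
    · exact ((canon C n).τx l hl 0 (by omega) (by omega) (by omega)).symm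
    · exact ((canon C n).τε l hl 0 (by omega) (by omega) (by omega) i).symm
  | succ a ih =>
    exact Commute.mul_left ((canon C n).ττ a l (by omega) hl) (ih (by omega))

lemma tb_comm_X {a b : ℕ} (hb : b ≤ n) (h : a < b) : Commute (tb C n b) (X C (n + 1) a) := by
  induction hb using Nat.decreasingInduction with
  | self => rw [tb_n]; exact Commute.one_left _
  | of_succ b hb ih =>
    rw [tb_succ C n hb]
    exact (ih (by omega)).mul_left
      ((canon C (n + 1)).τx b (by omega) a (by omega) (by omega) (by omega))

lemma tb_comm_Ep {a b : ℕ} (hb : b ≤ n) (h : a < b) (j : I) :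
    Commute (tb C n b) (Ep C (n + 1) a j) := by
  induction hb using Nat.decreasingInduction with
  | self => rw [tb_n]; exact Commute.one_left _
  | of_succ b hb ih =>
    rw [tb_succ C n hb]
    exact (ih (by omega)).mul_left
      ((canon C (n + 1)).τε b (by omega) a (by omega) (by omega) (by omega) j)

lemma tb_comm_Vv {a b : ℕ} (hb : b ≤ n) (h : a < b) : Commute (tb C n b) (Vv C (n + 1) i N a) := by
  induction a with
  | zero => exact Commute.mul_right ((tb_comm_X hb h).pow_right _) (tb_comm_Ep hb h i)
  | succ a ih => exact Commute.mul_right (tb_comm_Ta C n hb h) (ih (by omega))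

lemma Vv_Ep {b : ℕ} (h : b < n) : Ep C n b i * Vv C n i N b = Vv C n i N b := by
  induction b with
  | zero =>
    have h0 : X C n 0 ^ N * Ep C n 0 i = Ep C n 0 i * X C n 0 ^ N :=
      (Commute.pow_left ((canon C n).xε 0 h 0 h i) N).eq
    rw [Vv, ← mul_assoc, ← h0, mul_assoc, Ep_idem i h]
  | succ b ih =>
    have h2 : Ta C n b * Ep C n b i = Ep C n (b + 1) i * Ta C n b := by
      have := ((canon C n).sc b h b (by omega) i).eq
      rwa [Equiv.swap_apply_left] at this
    rw [Vv, ← mul_assoc, ← h2, mul_assoc, ih (by omega)]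

lemma Vv_right (b : ℕ) (h : 0 < n) : Vv C n i N b * Ep C n 0 i = Vv C n i N b := by
  induction b with
  | zero => rw [Vv, mul_assoc, Ep_idem i h]
  | succ b ih => rw [Vv, mul_assoc, ih]

variable {S : Type} [Ring S] (π : KA C n →+* S) 

lemma pi_Vv (hL : 0 < n → π (X C n 0 ^ N * Ep C n 0 i) = 0) (h : 0 < n) (b : ℕ) :
    π (Vv C n i N b) = 0 := by
  induction b with
  | zero => exact hL h
  | succ b ih => rw [Vv, map_mul, ih, mul_zero]


lemma Z_kill (i' : I) {a : ℕ} (ha : a < n) (hv : π (Vv C n i N a) = 0) {z} (hz : z ∈ Zs C n i' (a + 1)) (w) :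
    psi i' π (z * Vv C (n + 1) i N a * w) = 0 := by
  induction hz using Submodule.span_induction with
  | mem z hz =>
    obtain ⟨c, b, h1, h2, rfl⟩ := hz
    have : ev C n c * Ep C (n + 1) n i' * tb C n b * Vv C (n + 1) i N a * w =
        ev C n c * (io C n (Vv C n i N a) * (Ep C (n + 1) n i' * (tb C n b * w))) := by
      rw [mul_assoc _ (tb C n b), (tb_comm_Vv h2 (by omega)).eq, ← io_Vv ha]
      have := (io_comm_Ep C n i' (Vv C n i N a)).eq
      simp only [mul_assoc]
      rw [← mul_assoc (Ep C (n + 1) n i') (io C n _), this]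
      simp only [mul_assoc]
    rw [this]
    exact psi_ev_zero i' π (psi_io_zero i' π hv _) _
  | zero => simp
  | add x y _ _ hx hy => rw [add_mul, add_mul, map_add, hx, hy, add_zero]
  | smul s x _ hx =>
    rw [Algebra.smul_def, mul_assoc, mul_assoc, ← AlgHom.commutes (io C n), ← ev_C]
    rw [mul_assoc] at hx
    exact psi_ev_zero i' π hx _

lemma err_kill (hL : 0 < n → π (X C n 0 ^ N * Ep C n 0 i) = 0) {a : ℕ} (ha : a < n) {y} (hy : y ∈ Sb C n i (a + 1)) (w) :
    psi i π (tb C n (a + 1) * y * Vv C (n + 1) i N a * w) = 0 := by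
  rw [← psi_Ep]
  have : Ep C (n + 1) n i * (tb C n (a + 1) * y * Vv C (n + 1) i N a * w) =
    (Ep C (n + 1) n i * tb C n (a + 1) * y) * Vv C (n + 1) i N a * w := by
    simp only [mul_assoc]
  rw [this]
  refine Z_kill π i ha (pi_Vv π hL (by omega) a) ?_ w
  refine hy _ ?_
  have := Zs_gen (C := C) (n := n) (i := i) (b := a + 1) 1 le_rfl ha
  rwa [map_one, one_mul] at this

variable (C n i N) in
/-- the element `p` -/
noncomputable def pel : KA C (n + 1) := Vv C (n + 1) i N n

lemma pel_is (hL : 0 < n → π (X C n 0 ^ N * Ep C n 0 i) = 0) (r : KA C n) : ∀ w, psi i π (pel C n i N * is C n r * w) = psi i π (io C n r * pel C n i N * w) := by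
  let S' : Subalgebra k (KA C n) :=
    { carrier := {r | ∀ w, psi i π (pel C n i N * is C n r * w) = psi i π (io C n r * pel C n i N * w)}
      mul_mem' := by
        intro a b ha hb w
        rw [map_mul (is C n), ← mul_assoc, mul_assoc _ (is C n b), ha, map_mul (io C n), mul_assoc, mul_assoc, mul_assoc]
        funext x
        rw [psi_io, psi_io, ← mul_assoc (pel C n i N), hb, mul_assoc]
      add_mem' := by
        intro a b ha hb w
        rw [map_add, mul_add, add_mul, map_add, ha, hb, map_add, add_mul, add_mul, map_add]
      algebraMap_mem' := by
        intro c w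
        rw [AlgHom.commutes, AlgHom.commutes, Algebra.commutes] }
  refine KA_top C S' ?_ ?_ ?_ r
  · intro a ha j w
    congr 2
    rw [is_Ep C n ha, io_Ep C n ha, pel, ← tb_Vv (show a + 1 ≤ n from ha), mul_assoc, Vv, mul_assoc,
      (Vv_comm_Ep (show a < a + 1 by omega) (by omega) j).eq]
    have h2 : Ta C (n + 1) a * Ep C (n + 1) (a + 1) j = Ep C (n + 1) a j * Ta C (n + 1) a := by
      have := ((canon C (n + 1)).sc a (by omega) (a + 1) (by omega) j).eq
      rwa [Equiv.swap_apply_right] at this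
    rw [← mul_assoc (Ta _ _ _), h2, mul_assoc, ← mul_assoc,
      (tb_comm_Ep (show a + 1 ≤ n from ha) (show a < a + 1 by omega) j).eq, mul_assoc]
  · intro a ha w
    rw [is_X C n ha, io_X C n ha, pel, ← tb_Vv (show a + 1 ≤ n from ha)]
    have h2 : Ta C (n + 1) a * X C (n + 1) (a + 1) =
      X C (n + 1) a * Ta C (n + 1) a + (canon C (n + 1)).E a := (canon C (n + 1)).τx1' (by omega)
    have h1 : tb C n (a + 1) * Vv C (n + 1) i N (a + 1) * X C (n + 1) (a + 1) * w =
      X C (n + 1) a * (tb C n (a + 1) * Vv C (n + 1) i N (a + 1)) * w +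
      tb C n (a + 1) * (canon C (n + 1)).E a * Vv C (n + 1) i N a * w := by
      rw [← add_mul]
      congr 1
      rw [Vv, mul_assoc, mul_assoc (Ta _ _ _), (Vv_comm_X (show a < a + 1 by omega) (by omega)).eq,
        ← mul_assoc (Ta _ _ _), h2, add_mul, mul_add, mul_assoc (X _ _ _), ← mul_assoc,
        (tb_comm_X (show a + 1 ≤ n from ha) (show a < a + 1 by omega)).eq, mul_assoc, mul_assoc]
    have hpol := Sb_pol (C := C) (i := i) (show a + 1 ≤ n from ha)
    rw [h1, map_add, err_kill π hL ha ((canon C (n + 1)).E_mem _ (by omega) hpol.1), add_zero]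
  · intro l hl w
    rw [is_Ta C n hl, io_Ta C n hl, pel, ← tb_Vv (show l + 2 ≤ n from hl)]
    have h2 : Ta C (n + 1) (l + 1) * (Ta C (n + 1) l * Ta C (n + 1) (l + 1)) =
        Ta C (n + 1) l * (Ta C (n + 1) (l + 1) * Ta C (n + 1) l) + (canon C (n + 1)).Br l := by
      unfold Rep.Br
      simp only [canon]
      noncomm_ring
    have h1 : tb C n (l + 2) * Vv C (n + 1) i N (l + 2) * Ta C (n + 1) (l + 1) * w =
      Ta C (n + 1) l * (tb C n (l + 2) * Vv C (n + 1) i N (l + 2)) * w +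
      tb C n (l + 2) * (canon C (n + 1)).Br l * Vv C (n + 1) i N l * w := by
      rw [← add_mul]
      congr 1
      rw [Vv, Vv, mul_assoc, mul_assoc (Ta _ _ _), mul_assoc (Ta _ _ _),
        (Vv_comm_Ta (show l < l + 1 by omega) (by omega)).eq,
        ← mul_assoc (Ta _ _ l), ← mul_assoc (Ta _ _ (l + 1)), h2, add_mul, mul_add, mul_assoc (Ta _ _ _),
        ← mul_assoc, (tb_comm_Ta C n (show l + 2 ≤ n from hl) (show l + 1 < l + 2 by omega)).eq]
      simp only [mul_assoc]
    have hpol := Sb_pol (C := C) (i := i) (show l + 2 ≤ n from hl)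
    have h3 : psi i π (tb C n (l + 2) * (canon C (n + 1)).Br l * Vv C (n + 1) i N l * w) = 0 := by
      rw [← psi_Ep]
      have : Ep C (n + 1) n i * (tb C n (l + 2) * (canon C (n + 1)).Br l * Vv C (n + 1) i N l * w) =
        (Ep C (n + 1) n i * tb C n (l + 2) * (canon C (n + 1)).Br l) * Vv C (n + 1) i N l * w := by
        simp only [mul_assoc]
      rw [this]
      refine Z_kill π i (by omega) (pi_Vv π hL (by omega) l) (Zs_mono (show l + 1 ≤ l + 2 by omega) ?_) w
      refine (canon C (n + 1)).Br_mem (l := l) (Sb C n i (l + 2)) (by omega) hpol.1 hpol.2 _ ?_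
      have := Zs_gen (C := C) (n := n) (i := i) (b := l + 2) 1 le_rfl hl
      rwa [map_one, one_mul] at this
    rw [h1, map_add, h3, add_zero]

end Vv
end KLR


namespace KLR
open Finset

variable {k : Type} [Field k] {I : Type} [Fintype I] [DecidableEq I]

section Phi
variable {C : CartanDatum k I} {n : ℕ}

lemma Ph_x (l : ℕ) (h : l + 1 < n) (a : ℕ) (ha : a < n) :
    SemiconjBy (Ph C n l) (X C n a) (X C n (Equiv.swap l (l + 1) a)) := by
  by_cases h1 : a = l
  · subst h1; rw [Equiv.swap_apply_left]; exact (canon C n).ph_x0 h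
  · by_cases h2 : a = l + 1
    · subst h2; rw [Equiv.swap_apply_right]; exact (canon C n).ph_x1 h
    · rw [Equiv.swap_apply_of_ne_of_ne h1 h2]; exact (canon C n).ph_xn h ha h1 h2

lemma Ph_ε (l : ℕ) (h : l + 1 < n) (a : ℕ) (ha : a < n) (j : I) :
    SemiconjBy (Ph C n l) (Ep C n a j) (Ep C n (Equiv.swap l (l + 1) a) j) := by
  have h1 := (canon C n).sc l h a ha j
  have h2 : SemiconjBy ((canon C n).x (l + 1)) ((canon C n).ε a j) ((canon C n).ε a j) :=
    (canon C n).xε (l + 1) h a ha j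
  have h3 : SemiconjBy ((canon C n).x (l + 1)) ((canon C n).ε (Equiv.swap l (l + 1) a) j)
      ((canon C n).ε (Equiv.swap l (l + 1) a) j) :=
    (canon C n).xε (l + 1) h _ (swap_lt h ha) j
  exact (h1.mul_left h2).sub_left (h3.mul_left h1)

lemma Ph_far {l m : ℕ} (h : m + 1 < n) (hlm : l + 1 < m) : Commute (Ph C n m) (Ta C n l) := by
  have h1 : Commute (Ta C n m) (Ta C n l) := ((canon C n).ττ l m hlm h).symm
  have h2 : Commute (X C n (m + 1)) (Ta C n l) :=
    ((canon C n).τx l (by omega) (m + 1) h (by omega) (by omega)).symm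
  exact (h1.mul_left h2).sub_left (h2.mul_left h1)

lemma Ph_far' {l m : ℕ} (h : m + 1 < n) (hlm : l + 1 < m) : Commute (Ph C n l) (Ta C n m) := by
  have h1 : Commute (Ta C n l) (Ta C n m) := (canon C n).ττ l m hlm h
  have h2 : Commute (X C n (l + 1)) (Ta C n m) :=
    ((canon C n).τx m h (l + 1) (by omega) (by omega) (by omega)).symm
  exact (h1.mul_left h2).sub_left (h2.mul_left h1)

lemma eq_of_rho [Nonempty I] {z w : KA C n}
    (h : ∀ (F : Pt C (AlgebraicClosure k) n → AlgebraicClosure k) ω, rho C _ n z F ω = rho C _ n w F ω) :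
    z = w := by
  apply rho_injective C (AlgebraicClosure k) n
  apply LinearMap.ext; intro F; funext ω; exact h F ω

lemma Ph_braid [Nonempty I] {l : ℕ} (h : l + 2 < n) :
    Ph C n l * Ph C n (l + 1) * Ta C n l = Ta C n (l + 1) * (Ph C n l * Ph C n (l + 1)) := by
  have h1 : l + 1 < n := by omega
  have h2 : l + 1 + 1 < n := h
  apply eq_of_rho
  intro F ω
  have z01 := ω.sub_ne (show l < n by omega) h1 (by omega)
  have z02 := ω.sub_ne (show l < n by omega) h (by omega)
  have z12 := ω.sub_ne h1 h (by omega)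
  have e2 : ∀ (f : ℕ → AlgebraicClosure k), f (l + 1 + 1) = f (l + 2) := fun _ => rfl
  have e3 : ∀ (f : ℕ → I), f (l + 1 + 1) = f (l + 2) := fun _ => rfl
  simp only [map_mul, Module.End.mul_apply, rho_Ph h1, rho_Ph h2, rho_Ta h1, rho_Ta h2, pc,
    e2 (Pt.z _), e3 (Pt.ν _), Pt.sw_ν0, Pt.sw_ν1, Pt.sw_z0, Pt.sw_z1,
    Pt.sw_ν2, Pt.sw_z2, Pt.sw'_ν2, Pt.sw'_z2, Pt.sw'_ν, Pt.sw'_z, Pt.sw_sw, Pt.sw_braid _ _ _ h2]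
  generalize F ((ω.sw l h1).sw (l + 1) h2) = F3
  generalize F (((ω.sw (l + 1) h2).sw l h1).sw (l + 1) h2) = F5
  generalize ω.z l = u at *
  generalize ω.z (l + 1) = v at *
  generalize ω.z (l + 2) = w at *
  generalize ω.ν l = a at *
  generalize ω.ν (l + 1) = b at *
  generalize ω.ν (l + 2) = c at *
  by_cases hab : a = b
  · subst hab
    by_cases hac : a = c
    · subst hac
      simp only [if_true]
      field_simp
    · simp only [if_true, hac, if_false]
      ring
  · by_cases hbc : b = c
    · subst hbc
      simp only [if_true, hab, if_false]
      field_simp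
    · by_cases hac : a = c
      · subst hac
        simp only [if_true, hab, Ne.symm hab, if_false]
        ring
      · simp only [hab, hbc, hac, if_false]
        ring

variable (C n) in
/-- `φ_0 ⋯ φ_{m-1}` -/
noncomputable def Phi : ℕ → KA C n
  | 0 => 1
  | m + 1 => Phi m * Ph C n m

lemma Phi_gen (f : ℕ → KA C n) (hf : ∀ l, l + 1 < n → ∀ a < n,
      SemiconjBy (Ph C n l) (f a) (f (Equiv.swap l (l + 1) a))) (m : ℕ) (hm : m < n) :
    (∀ a, a < m → SemiconjBy (Phi C n m) (f a) (f (a + 1))) ∧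
    SemiconjBy (Phi C n m) (f m) (f 0) ∧ (∀ b, m < b → b < n → Commute (Phi C n m) (f b)) := by
  induction m with
  | zero =>
    refine ⟨fun a h => by omega, ?_, fun b _ _ => Commute.one_left _⟩
    exact SemiconjBy.one_left _
  | succ m ih =>
    obtain ⟨h1, h2, h3⟩ := ih (by omega)
    refine ⟨fun a ha => ?_, ?_, fun b hb hbn => ?_⟩
    · have := hf m hm a (by omega)
      by_cases ham : a = m
      · subst ham
        rw [Equiv.swap_apply_left] at this
        exact SemiconjBy.mul_left (h3 (a + 1) (by omega) hm) this
      · rw [Equiv.swap_apply_of_ne_of_ne (by omega) (by omega)] at this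
        exact SemiconjBy.mul_left (h1 a (by omega)) this
    · have := hf m hm (m + 1) hm
      rw [Equiv.swap_apply_right] at this
      exact SemiconjBy.mul_left h2 this
    · have := hf m hm b hbn
      rw [Equiv.swap_apply_of_ne_of_ne (by omega) (by omega)] at this
      exact Commute.mul_left (h3 b (by omega) hbn) this

lemma Phi_x {m : ℕ} (hm : m < n) :
    (∀ a, a < m → SemiconjBy (Phi C n m) (X C n a) (X C n (a + 1))) ∧
    SemiconjBy (Phi C n m) (X C n m) (X C n 0) ∧
    (∀ b, m < b → b < n → Commute (Phi C n m) (X C n b)) :=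
  Phi_gen (C := C) (n := n) (fun a => X C n a) Ph_x m hm

lemma Phi_ε {m : ℕ} (hm : m < n) (j : I) :
    (∀ a, a < m → SemiconjBy (Phi C n m) (Ep C n a j) (Ep C n (a + 1) j)) ∧
    SemiconjBy (Phi C n m) (Ep C n m j) (Ep C n 0 j) ∧
    (∀ b, m < b → b < n → Commute (Phi C n m) (Ep C n b j)) :=
  Phi_gen (C := C) (n := n) (fun a => Ep C n a j) (fun l h a ha => Ph_ε l h a ha j) m hm

lemma Phi_far {m l : ℕ} (hm : m < l) (hl : l + 1 < n) : Commute (Phi C n m) (Ta C n l) := by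
  induction m with
  | zero => exact Commute.one_left _
  | succ m ih => exact (ih (by omega)).mul_left (Ph_far' hl hm)

lemma Phi_T [Nonempty I] {m l : ℕ} (hm : m < n) (hl : l + 1 < m) :
    SemiconjBy (Phi C n m) (Ta C n l) (Ta C n (l + 1)) := by
  induction m with
  | zero => omega
  | succ m ih =>
    by_cases h : l + 1 = m
    · subst h
      rw [Phi, Phi, mul_assoc]
      refine SemiconjBy.mul_left (Phi_far (by omega) (by omega)) ?_
      exact Ph_braid hm
    · exact SemiconjBy.mul_left (ih (by omega) (by omega)) (Ph_far hm (by omega))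

/-- `V` shifted -/
lemma Phi_Vv [Nonempty I] {i : I} {N : ℕ} {m : ℕ} (hm : m < n) : ∀ b, b ≤ m →
    Phi C (n + 1) (m + 1) * Vv C (n + 1) i N b =
      is C n (Vv C n i N b) * Phi C (n + 1) (m + 1) := by
  intro b hb
  induction b with
  | zero =>
    rw [Vv, Vv, map_mul, map_pow, is_X C n (by omega), is_Ep C n (by omega)]
    exact SemiconjBy.mul_right (((Phi_x (show m + 1 < n + 1 by omega)).1 0 (by omega)).pow_right N)
      ((Phi_ε (show m + 1 < n + 1 by omega) i).1 0 (by omega))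
  | succ b ih =>
    rw [Vv, Vv, map_mul, is_Ta C n (by omega)]
    exact SemiconjBy.mul_right (Phi_T (show m + 1 < n + 1 by omega) (by omega)) (ih (by omega))

end Phi
end KLR


namespace KLR
open Finset

variable {k : Type} [Field k] {I : Type} [Fintype I] [DecidableEq I]

section Hf
variable (C : CartanDatum k I) (i : I) {A : Type} [Ring A] [Algebra k A]
  {B' : Type} [Ring B'] [Algebra k B']

/-- data of a family of two variable polynomials -/
structure HD (k I : Type) where
  /-- scalar -/
  c : I → k
  /-- exponent of the difference -/
  N : I → ℕ
  /-- exponent of `Q` -/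
  e : I → ℕ

/-- `c (u-v)^N Q_{ij}(u,v)^e` -/
noncomputable def hf (D : HD k I) (j : I) (u v : A) : A :=
  D.c j • ((u - v) ^ D.N j * Qel C i j u v ^ D.e j)

/-- sum over labels -/
noncomputable def Hf (D : HD k I) (ε : I → A) (u v : A) : A := ∑ j, ε j * hf C i D j u v

variable {C i}

lemma hf_map (f : A →ₐ[k] B') (D : HD k I) (j : I) (u v : A) :
    f (hf C i D j u v) = hf C i D j (f u) (f v) := by
  simp only [hf, map_smul, map_mul, map_pow, map_sub, Qel_map]

lemma Hf_map (f : A →ₐ[k] B') (D : HD k I) (ε : I → A) (u v : A) :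
    f (Hf C i D ε u v) = Hf C i D (fun j => f (ε j)) (f u) (f v) := by
  simp only [Hf, map_sum, map_mul, hf_map]

lemma Qel_sc (i j : I) {u v u' v' z : A} (hu : SemiconjBy z u u') (hv : SemiconjBy z v v') :
    SemiconjBy z (Qel C i j u v) (Qel C i j u' v') := by
  unfold Qel
  split_ifs
  · exact SemiconjBy.zero_right _
  simp only [SemiconjBy, Finset.mul_sum, Finset.sum_mul]
  refine Finset.sum_congr rfl fun p _ => Finset.sum_congr rfl fun q _ => ?_
  split_ifs
  · rw [mul_smul_comm, smul_mul_assoc, ((hu.pow_right p).mul_right (hv.pow_right q)).eq]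
  · simp

lemma hf_sc (D : HD k I) (j : I) {u v u' v' z : A} (hu : SemiconjBy z u u') (hv : SemiconjBy z v v') :
    SemiconjBy z (hf C i D j u v) (hf C i D j u' v') := by
  have := ((hu.sub_right hv).pow_right (D.N j)).mul_right ((Qel_sc (C := C) i j hu hv).pow_right (D.e j))
  unfold hf
  rw [SemiconjBy, mul_smul_comm, smul_mul_assoc, this.eq]

lemma Hf_sc (D : HD k I) {ε ε' : I → A} {u v u' v' z : A} (hε : ∀ j, SemiconjBy z (ε j) (ε' j))
    (hu : SemiconjBy z u u') (hv : SemiconjBy z v v') :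
    SemiconjBy z (Hf C i D ε u v) (Hf C i D ε' u' v') := by
  unfold Hf
  simp only [SemiconjBy, Finset.mul_sum, Finset.sum_mul]
  exact Finset.sum_congr rfl fun j _ => ((hε j).mul_right (hf_sc D j hu hv)).eq

lemma Hf_comm (D : HD k I) {ε : I → A} {u v z : A} (hε : ∀ j, Commute z (ε j))
    (hu : Commute z u) (hv : Commute z v) : Commute z (Hf C i D ε u v) := Hf_sc D hε hu hv
end Hf

section Hn
variable {C : CartanDatum k I} {n : ℕ} {i : I}

variable (C n i) in
/-- polynomial version -/
noncomputable def HP (D : HD k I) (a : ℕ) : Polynomial (KA C n) :=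
  Hf C i D (fun j => Polynomial.C (Ep C n a j)) Polynomial.X (Polynomial.C (X C n a))

variable (C n) in
/-- `evs` as an algebra hom -/
noncomputable def evsA : Polynomial (KA C n) →ₐ[k] KA C (n + 1) :=
  { evs C n with
    commutes' := fun s => by
      change evs C n (Polynomial.C (algebraMap k (KA C n) s)) = _
      rw [evs_C, AlgHom.commutes] }

variable (C n i) in
/-- element version -/
noncomputable def HE (D : HD k I) (a : ℕ) : KA C (n + 1) :=
  Hf C i D (fun j => Ep C (n + 1) a j) (X C (n + 1) 0) (X C (n + 1) a)

lemma evs_HP (D : HD k I) {a : ℕ} (h : a < n) : evs C n (HP C n i D a) = HE C n i D (a + 1) := by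
  change evsA C n (HP C n i D a) = _
  rw [HP, Hf_map]
  change Hf C i D (fun j => evs C n (Polynomial.C _)) (evs C n _) (evs C n _) = _
  simp only [evs_C, evs_X, is_X C n h, is_Ep C n h]
  rfl

lemma HE_comm_X (D : HD k I) {a b : ℕ} (ha : a < n + 1) (hb : b < n + 1) :
    Commute (X C (n + 1) b) (HE C n i D a) :=
  Hf_comm D (fun j => (canon C (n + 1)).xε b hb a ha j)
    ((canon C (n + 1)).xx b hb 0 (by omega)) ((canon C (n + 1)).xx b hb a ha)

lemma HE_comm_Ep (D : HD k I) {a b : ℕ} (ha : a < n + 1) (hb : b < n + 1) (j : I) :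
    Commute (Ep C (n + 1) b j) (HE C n i D a) :=
  Hf_comm D (fun j' => (canon C (n + 1)).εε b hb a ha j j')
    (((canon C (n + 1)).xε 0 (by omega) b hb j).symm) (((canon C (n + 1)).xε a ha b hb j).symm)

lemma HE_comm_HE (D D' : HD k I) {a b : ℕ} (ha : a < n + 1) (hb : b < n + 1) :
    Commute (HE C n i D' b) (HE C n i D a) :=
  Hf_comm D (fun j => (HE_comm_Ep D' hb ha j).symm) (HE_comm_X D' hb (by omega)).symm
    (HE_comm_X D' hb ha).symm

lemma HE_comm_Ta (D : HD k I) {a l : ℕ} (ha : a < n + 1) (hl : l + 1 < n + 1) (h0 : 0 < l)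
    (h1 : a ≠ l) (h2 : a ≠ l + 1) :
    Commute (Ta C (n + 1) l) (HE C n i D a) :=
  Hf_comm D (fun j => (canon C (n + 1)).τε l hl a ha h1 h2 j)
    ((canon C (n + 1)).τx l hl 0 (by omega) (by omega) (by omega))
    ((canon C (n + 1)).τx l hl a ha h1 h2)

section
variable {L : Type} [Field L] [Algebra k L]

lemma rho_HE (D : HD k I) {a : ℕ} (h : a < n + 1) (F : Pt C L (n + 1) → L) (ω) :
    rho C L (n + 1) (HE C n i D a) F ω = hf C i D (ω.ν a) (ω.z 0) (ω.z a) * F ω := by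
  have h1 : ∀ b, b < n + 1 → rho C L (n + 1) (X C (n + 1) b) =
      mulOp C L (n + 1) (fun ω => ω.z b) := fun b hb => by
    apply LinearMap.ext; intro F; funext ω; rw [rho_X hb]; rfl
  unfold HE Hf
  rw [map_sum, LinearMap.sum_apply, Finset.sum_apply]
  simp only [map_mul, Module.End.mul_apply, rho_Ep h, hf_map, h1 a h, h1 0 (by omega)]
  simp only [← hf_map, mulOp_apply']
  rw [Finset.sum_eq_single (ω.ν a)]
  · rw [if_pos rfl, one_mul]
    congr 1
    exact hf_map (Pi.evalAlgHom k (fun _ : Pt C L (n + 1) => L) ω) D _ _ _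
  · intro j _ hj; rw [if_neg hj.symm, zero_mul]
  · simp
end

lemma HE_pair [Nonempty I] (D : HD k I) {l : ℕ} (hl : l + 1 < n + 1) (h0 : 0 < l) :
    Commute (Ta C (n + 1) l) (HE C n i D l * HE C n i D (l + 1)) := by
  apply eq_of_rho
  intro F ω
  have e0 : ∀ ω : Pt C (AlgebraicClosure k) (n + 1), (ω.sw l hl).z 0 = ω.z 0 :=
    fun ω => Pt.sw_zn _ _ _ (by omega) (by omega)
  simp only [map_mul, Module.End.mul_apply, rho_Ta hl, rho_HE D hl, rho_HE D (show l < n + 1 by omega),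
    Pt.sw_ν0, Pt.sw_ν1, Pt.sw_z0, Pt.sw_z1, e0]
  split_ifs with h
  · rw [h]; ring
  · ring

variable (C n i) in
/-- products -/
noncomputable def HProd (D : HD k I) : ℕ → Polynomial (KA C n)
  | 0 => 1
  | m + 1 => HP C n i D m * HProd D m

lemma evs_HProd_succ (D : HD k I) {m : ℕ} (h : m < n) :
    evs C n (HProd C n i D (m + 1)) = HE C n i D (m + 1) * evs C n (HProd C n i D m) := by
  rw [HProd, map_mul, evs_HP D h]

lemma HProd_comm_gen (D : HD k I) (z : KA C (n + 1)) (m : ℕ) (hm : m ≤ n)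
    (h : ∀ a, 1 ≤ a → a ≤ m → Commute z (HE C n i D a)) : Commute z (evs C n (HProd C n i D m)) := by
  induction m with
  | zero => rw [HProd, map_one]; exact Commute.one_right _
  | succ m ih =>
    rw [evs_HProd_succ D hm]
    exact (h _ (by omega) le_rfl).mul_right (ih (by omega) fun a h1 h2 => h a h1 (by omega))

lemma HProd_comm_Ta [Nonempty I] (D : HD k I) {l : ℕ} (hl : l + 1 < n + 1) (h0 : 0 < l) (m : ℕ)
    (hm : m ≤ n) (hm' : l + 1 ≤ m) : Commute (Ta C (n + 1) l) (evs C n (HProd C n i D m)) := by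
  induction m with
  | zero => omega
  | succ m ih =>
    rw [evs_HProd_succ D hm]
    by_cases h : l = m
    · obtain ⟨m, rfl⟩ : ∃ m', m = m' + 1 := ⟨m - 1, by omega⟩
      subst h
      rw [evs_HProd_succ D (by omega), ← mul_assoc, (HE_comm_HE D D (by omega) (by omega)).eq]
      exact (HE_pair D hl h0).mul_right (HProd_comm_gen D _ _ (by omega) fun a h1 h2 =>
        HE_comm_Ta D (by omega) hl h0 (by omega) (by omega))
    · exact (HE_comm_Ta D (by omega) hl h0 (by omega) (by omega)).mul_right (ih (by omega) (by omega))

/-- the full product commutes with `is r` -/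
lemma HProd_comm_is [Nonempty I] (D : HD k I) (r : KA C n) :
    Commute (is C n r) (evs C n (HProd C n i D n)) := by
  let S' : Subalgebra k (KA C n) :=
    (Subalgebra.centralizer k {evs C n (HProd C n i D n)}).comap (is C n)
  have hS : ∀ r, r ∈ S' ↔ Commute (is C n r) (evs C n (HProd C n i D n)) := by
    intro r
    change is C n r ∈ Subalgebra.centralizer k {evs C n (HProd C n i D n)} ↔ _
    rw [Subalgebra.mem_centralizer_iff]
    constructor
    · intro h; exact (h _ rfl).symm
    · rintro h _ rfl; exact h.eq.symm
  have hε : ∀ a < n, ∀ j, Ep C n a j ∈ S' := by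
    intro a ha j
    rw [hS, is_Ep C n ha]
    exact HProd_comm_gen D _ _ le_rfl fun b h1 h2 => HE_comm_Ep D (by omega) (by omega) j
  refine (hS r).1 (KA_top C S' hε ?_ ?_ r)
  · intro a ha
    rw [hS, is_X C n ha]
    exact HProd_comm_gen D _ _ le_rfl fun b h1 h2 => HE_comm_X D (by omega) (by omega)
  · intro l hl
    rw [hS, is_Ta C n hl]
    exact HProd_comm_Ta D (by omega) (by omega) n le_rfl (by omega)

lemma HProd_comm_C [Nonempty I] (D : HD k I) (r : KA C n) :
    Commute (Polynomial.C r) (HProd C n i D n) := by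
  apply evs_inj (C := C) (n := n) i
  rw [map_mul, map_mul, evs_C]
  exact HProd_comm_is D r
end Hn
end KLR


namespace KLR
open Finset

variable {k : Type} [Field k] {I : Type} [Fintype I] [DecidableEq I]

section Qq
variable (C : CartanDatum k I) (i : I)

/-- total degree -/
noncomputable def Mt : ℕ := 1 + ∑ j, dg C i j

lemma dg_lt (j : I) : dg C i j < Mt C i := by
  have : dg C i j ≤ ∑ j, dg C i j := Finset.single_le_sum (fun _ _ => Nat.zero_le _) (Finset.mem_univ j)
  unfold Mt; omega

/-- the denominators -/
noncomputable def Dd : HD k I where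
  c j := if j = i then -1 else kap C i j
  N j := if j = i then Mt C i + 1 else Mt C i - 1 - dg C i j
  e _ := 0

/-- the norms -/
noncomputable def Dg : HD k I where
  c j := if j = i then 1 else kap C i j
  N j := if j = i then Mt C i else Mt C i - dg C i j
  e j := if j = i then 0 else 1

variable {C i}

lemma Dg_monic {A : Type} [Ring A] [Algebra k A] [Nontrivial A] (j : I) (v : A) :
    (hf C i (Dg C i) j (Polynomial.X : Polynomial A) (Polynomial.C v)).Monic ∧
    (hf C i (Dg C i) j (Polynomial.X : Polynomial A) (Polynomial.C v)).natDegree = Mt C i := by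
  by_cases h : j = i
  · simp only [hf, Dg, h, if_true, one_smul, pow_zero, mul_one]
    refine ⟨(Polynomial.monic_X_sub_C v).pow _, ?_⟩
    rw [(Polynomial.monic_X_sub_C v).natDegree_pow, Polynomial.natDegree_X_sub_C, mul_one]
  · simp only [hf, Dg, h, if_false, pow_one]
    rw [← mul_smul_comm]
    have h1 := (Polynomial.monic_X_sub_C v).pow (Mt C i - dg C i j)
    have h2 := Qel_monic' C (i := i) (j := j) (Ne.symm h) v
    refine ⟨h1.mul h2, ?_⟩
    rw [h1.natDegree_mul h2, (Polynomial.monic_X_sub_C v).natDegree_pow, Polynomial.natDegree_X_sub_C,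
      Qel_natDegree C (Ne.symm h)]
    have := dg_lt C i j
    omega

variable {n : ℕ}

lemma HP_monic {a : ℕ} (ha : a < n) : (HP C n i (Dg C i) a).Monic := by
  nontriviality (KA C n)
  have h1 : HP C n i (Dg C i) a = Polynomial.X ^ Mt C i + ∑ j, Polynomial.C (Ep C n a j) *
      (hf C i (Dg C i) j Polynomial.X (Polynomial.C (X C n a)) - Polynomial.X ^ Mt C i) := by
    simp only [mul_sub, Finset.sum_sub_distrib, ← Finset.sum_mul, ← map_sum]
    rw [show ∑ j, Ep C n a j = 1 from (canon C n).εsum a ha]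
    simp only [map_one, one_mul]
    rw [add_sub_cancel]
    rfl
  rw [h1]
  apply Polynomial.monic_X_pow_add
  rw [← Polynomial.mem_degreeLT]
  refine Submodule.sum_mem _ fun j _ => ?_
  rw [← Polynomial.smul_eq_C_mul]
  refine Submodule.smul_mem _ _ ?_
  rw [Polynomial.mem_degreeLT]
  obtain ⟨h2, h3⟩ := Dg_monic (C := C) (i := i) j (X C n a)
  have h4 : (hf C i (Dg C i) j (Polynomial.X : Polynomial (KA C n)) (Polynomial.C (X C n a))).degree = Mt C i := by
    rw [Polynomial.degree_eq_natDegree h2.ne_zero, h3]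
  rw [← h4]
  exact Polynomial.degree_sub_lt (by rw [h4, Polynomial.degree_X_pow]) h2.ne_zero
    (by rw [h2.leadingCoeff, (Polynomial.monic_X_pow _).leadingCoeff])

lemma HProd_monic {m : ℕ} (hm : m ≤ n) : (HProd C n i (Dg C i) m).Monic := by
  induction m with
  | zero => exact Polynomial.monic_one
  | succ m ih => exact (HP_monic hm).mul (ih (by omega))

lemma hf_comm_left {A : Type} [Ring A] [Algebra k A] (D : HD k I) (j : I) {u v z : A} (hu : Commute z u) (hv : Commute z v) :
    Commute z (hf C i D j u v) := hf_sc D j hu hv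

/-- key identity -/
lemma key {m : ℕ} (h : m + 1 < n) :
    Hf C i (Dd C i) (fun j => Ep C n (m + 1) j) (X C n m) (X C n (m + 1)) *
      (Ph C n m * Ta C n m) * Ep C n m i =
    (Hf C i (Dg C i) (fun j => Ep C n (m + 1) j) (X C n m) (X C n (m + 1))
      - (X C n m - X C n (m + 1)) ^ Mt C i * Ph C n m * Ep C n (m + 1) i) * Ep C n m i := by
  set r := canon C n with hr
  have hm : m < n := by omega
  set u := X C n m with hu
  set v := X C n (m + 1) with hv
  have hsum : ∑ j, Ep C n (m + 1) j = 1 := r.εsum (m + 1) h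
  suffices H : ∀ j, Hf C i (Dd C i) (fun j => Ep C n (m + 1) j) u v *
      (Ph C n m * Ta C n m) * Ep C n m i * Ep C n (m + 1) j =
    (Hf C i (Dg C i) (fun j => Ep C n (m + 1) j) u v
      - (u - v) ^ Mt C i * Ph C n m * Ep C n (m + 1) i) * Ep C n m i * Ep C n (m + 1) j by
    rw [← mul_one (_ * Ep C n m i), ← mul_one (( _ - _) * Ep C n m i), ← hsum, Finset.mul_sum, Finset.mul_sum]
    exact Finset.sum_congr rfl fun j _ => H j
  intro j
  have hcu : ∀ a j', a < n → Commute (Ep C n a j') u := fun a j' ha => ((r.xε m hm a ha j').symm)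
  have hcv : ∀ a j', a < n → Commute (Ep C n a j') v := fun a j' ha => ((r.xε (m + 1) h a ha j').symm)
  have hH : ∀ D : HD k I, Hf C i D (fun j => Ep C n (m + 1) j) u v * Ep C n (m + 1) j =
      hf C i D j u v * Ep C n (m + 1) j := by
    intro D
    unfold Hf
    rw [Finset.sum_mul, Finset.sum_eq_single j]
    · rw [(hf_comm_left D j (hcu (m + 1) j h) (hcv (m + 1) j h)).eq, mul_assoc, Ep_idem j h]
    · intro j' _ hj
      rw [(hf_comm_left D j' (hcu (m + 1) j' h) (hcv (m + 1) j' h)).eq, mul_assoc]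
      have := r.εmul (m + 1) h j' j
      rw [if_neg hj] at this
      change Ep C n (m + 1) j' * Ep C n (m + 1) j = 0 at this
      rw [this, mul_zero]
    · simp
  have hφ : Ph C n m = (u - v) * Ta C n m + r.E m := r.ph_eq h
  have hEτ : Commute (Ta C n m) (r.E m) := r.E_comm_τ h
  have hE : r.E m * (Ep C n m i * Ep C n (m + 1) j) = if i = j then Ep C n m i * Ep C n (m + 1) j else 0 :=
    r.E_mul h i j
  have hsq : Ta C n m * Ta C n m * (Ep C n m i * Ep C n (m + 1) j) = Qel C i j u v * (Ep C n m i * Ep C n (m + 1) j) :=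
    r.τsq m h i j
  have hεε : Commute (Ep C n m i) (Ep C n (m + 1) j) := r.εε m hm (m + 1) h i j
  -- the element φ τ commutes with labels
  have hTs : SemiconjBy (Ta C n m) (Ep C n (m + 1) j) (Ep C n m j) := by
    have := r.sc m h (m + 1) h j
    rwa [Equiv.swap_apply_right] at this
  have hPs : SemiconjBy (Ph C n m) (Ep C n m j) (Ep C n (m + 1) j) := by
    have := Ph_ε (C := C) m h m hm j
    rwa [Equiv.swap_apply_left] at this
  have hPT : Commute (Ph C n m * Ta C n m) (Ep C n (m + 1) j) := hPs.mul_left hTs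
  have hL : Hf C i (Dd C i) (fun j => Ep C n (m + 1) j) u v *
      (Ph C n m * Ta C n m) * Ep C n m i * Ep C n (m + 1) j =
      hf C i (Dd C i) j u v * ((Ph C n m * Ta C n m) * (Ep C n m i * Ep C n (m + 1) j)) := by
    rw [mul_assoc, hεε.eq, ← mul_assoc, mul_assoc _ (_ * _) (Ep C n (m + 1) j), hPT.eq,
      ← mul_assoc, hH]
    rw [mul_assoc (hf C i (Dd C i) j u v), ← hPT.eq]
    simp only [mul_assoc]
  have hR : Hf C i (Dg C i) (fun j => Ep C n (m + 1) j) u v * (Ep C n m i * Ep C n (m + 1) j) =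
      hf C i (Dg C i) j u v * (Ep C n m i * Ep C n (m + 1) j) := by
    rw [hεε.eq, ← mul_assoc, hH, mul_assoc]
  rw [hL, sub_mul, sub_mul, mul_assoc (Hf _ _ _ _ _ _), hR]
  rw [hφ, add_mul, add_mul, mul_assoc (u - v), mul_assoc (u - v), hsq, ← hEτ.eq, mul_assoc (Ta C n m), hE]
  by_cases hij : i = j
  · subst hij
    have hQ : Qel C i i u v = 0 := by unfold Qel; rw [if_pos rfl]
    rw [if_pos rfl, hQ, zero_mul, mul_zero, zero_add]
    simp only [hf, Dd, Dg, if_true, one_smul, neg_smul, pow_zero, mul_one]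
    have h3 : (u - v) ^ Mt C i * ((u - v) * Ta C n m + r.E m) * Ep C n (m + 1) i * Ep C n m i * Ep C n (m + 1) i
      = (u - v) ^ (Mt C i + 1) * (Ta C n m * (Ep C n m i * Ep C n (m + 1) i)) + (u - v) ^ Mt C i * (Ep C n m i * Ep C n (m + 1) i) := by
      rw [mul_assoc _ (Ep C n (m + 1) i), ← hεε.eq, mul_assoc, mul_assoc (Ep C n m i), Ep_idem i h, mul_assoc,
        add_mul, hE, if_pos rfl, mul_add, pow_succ]
      simp only [mul_assoc]
    rw [h3]
    rw [neg_mul]; abel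
  · have hji : j ≠ i := Ne.symm hij
    have h0 : Ep C n (m + 1) i * Ep C n m i * Ep C n (m + 1) j = 0 := by
      have h5 : Ep C n (m + 1) i * Ep C n (m + 1) j = 0 := by
        have := r.εmul (m + 1) h i j
        rwa [if_neg hij] at this
      rw [mul_assoc, hεε.eq, ← mul_assoc, h5, zero_mul]
    rw [if_neg hij, mul_zero, add_zero, mul_assoc, mul_assoc ((u - v) ^ _ * _), ← mul_assoc (Ep C n (m + 1) i), h0, mul_zero, sub_zero]
    simp only [hf, Dd, Dg, hji, if_false, pow_zero, mul_one, pow_one]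
    have e : Mt C i - dg C i j = Mt C i - 1 - dg C i j + 1 := by
      have := dg_lt C i j
      omega
    rw [e, pow_succ]
    simp only [smul_mul_assoc, mul_assoc]
end Qq
end KLR


namespace KLR
open Finset

variable {k : Type} [Field k] {I : Type} [Fintype I] [DecidableEq I]

section Qel
variable {C : CartanDatum k I} {n : ℕ} {i : I} {N : ℕ}

variable (C n i) in
/-- the element `q` -/
noncomputable def qel : KA C (n + 1) := evs C n (HProd C n i (Dd C i) n) * Phi C (n + 1) n

lemma Phi_io [Nonempty I] (r : KA C n) : Phi C (n + 1) n * io C n r = is C n r * Phi C (n + 1) n := by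
  let S' : Subalgebra k (KA C n) :=
    { carrier := {r | Phi C (n + 1) n * io C n r = is C n r * Phi C (n + 1) n}
      mul_mem' := by
        intro a b ha hb
        change _ = _ at ha hb ⊢
        rw [map_mul, map_mul, ← mul_assoc, ha, mul_assoc, hb, mul_assoc]
      add_mem' := by
        intro a b ha hb
        change _ = _ at ha hb ⊢
        rw [map_add, map_add, mul_add, add_mul, ha, hb]
      algebraMap_mem' := by
        intro c
        change _ = _
        rw [AlgHom.commutes, AlgHom.commutes, Algebra.commutes] }
  refine KA_top C S' ?_ ?_ ?_ r
  · intro a ha j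
    change _ = _
    rw [is_Ep C n ha, io_Ep C n ha]
    exact (Phi_ε (by omega) j).1 a ha
  · intro a ha
    change _ = _
    rw [is_X C n ha, io_X C n ha]
    exact (Phi_x (by omega)).1 a ha
  · intro l hl
    change _ = _
    rw [is_Ta C n hl, io_Ta C n hl]
    exact Phi_T (by omega) hl

lemma qel_io [Nonempty I] (r : KA C n) : qel C n i * io C n r = is C n r * qel C n i := by
  rw [qel, mul_assoc, Phi_io, ← mul_assoc, ← mul_assoc, (HProd_comm_is (Dd C i) r).eq]

lemma qel_Ep (j : I) : qel C n i * Ep C (n + 1) n j = Ep C (n + 1) 0 j * qel C n i := by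
  rw [qel, mul_assoc, ((Phi_ε (show n < n + 1 by omega) j).2.1).eq, ← mul_assoc, ← mul_assoc]
  congr 1
  exact (HProd_comm_gen (Dd C i) _ n le_rfl fun a h1 h2 => HE_comm_Ep (Dd C i) (by omega) (by omega) j).eq.symm

variable {S : Type} [Ring S] (π : KA C n →+* S)

lemma psi'_cm [Nonempty I] (hL : 0 < n → π (X C n 0 ^ N * Ep C n 0 i) = 0) (m : ℕ) (hm : m ≤ n) :
    ∀ w a, psi' i π (evs C n (HProd C n i (Dd C i) m) * Phi C (n + 1) m * Vv C (n + 1) i N m * w) a =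
      (HProd C n i (Dg C i) m * Polynomial.X ^ N).map π * psi' i π w a := by
  induction m with
  | zero =>
    intro w a
    rw [HProd, HProd, Phi, Vv, map_one, one_mul, one_mul, one_mul, ← psi'_evs, map_pow, evs_X, mul_assoc,
      ← evs_X, ← map_pow, psi'_evs, psi'_evs, psi'_Ep]
  | succ m ih =>
    intro w a
    have e1 : HE C n i (Dd C i) (m + 1) * Phi C (n + 1) m = Phi C (n + 1) m *
        Hf C i (Dd C i) (fun j => Ep C (n + 1) (m + 1) j) (X C (n + 1) m) (X C (n + 1) (m + 1)) :=
      (Hf_sc (Dd C i) (fun j => (Phi_ε (show m < n + 1 by omega) j).2.2 (m + 1) (by omega) (by omega))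
        (Phi_x (by omega)).2.1 ((Phi_x (by omega)).2.2 (m + 1) (by omega) (by omega))).eq.symm
    have e2 : HE C n i (Dg C i) (m + 1) * Phi C (n + 1) m = Phi C (n + 1) m *
        Hf C i (Dg C i) (fun j => Ep C (n + 1) (m + 1) j) (X C (n + 1) m) (X C (n + 1) (m + 1)) :=
      (Hf_sc (Dg C i) (fun j => (Phi_ε (show m < n + 1 by omega) j).2.2 (m + 1) (by omega) (by omega))
        (Phi_x (by omega)).2.1 ((Phi_x (by omega)).2.2 (m + 1) (by omega) (by omega))).eq.symm
    have e3 : Phi C (n + 1) m * (X C (n + 1) m - X C (n + 1) (m + 1)) ^ Mt C i =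
        evs C n ((Polynomial.X - Polynomial.C (X C n m)) ^ Mt C i) * Phi C (n + 1) m := by
      rw [map_pow, map_sub, evs_X, evs_C, is_X C n hm]
      exact (((Phi_x (by omega)).2.1.sub_right ((Phi_x (by omega)).2.2 (m + 1) (by omega) (by omega))).pow_right _).eq
    have e4 : ∀ D, Commute (HE C n i D (m + 1)) (evs C n (HProd C n i (Dd C i) m)) := fun D =>
      HProd_comm_gen _ _ m (by omega) fun a h1 h2 => HE_comm_HE _ _ (by omega) (by omega)
    have e5 := key (C := C) (n := n + 1) (i := i) (m := m) (by omega)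
    have e6 : Vv C (n + 1) i N m = Ep C (n + 1) m i * Vv C (n + 1) i N m := (Vv_Ep (by omega)).symm
    have e7 : Ep C (n + 1) (m + 1) i * Vv C (n + 1) i N m = Vv C (n + 1) i N m * Ep C (n + 1) (m + 1) i :=
      (Vv_comm_Ep (by omega) (by omega) i).eq.symm
    have e8 := Phi_Vv (C := C) (i := i) (N := N) (show m < n by omega) m le_rfl
    set DD := evs C n (HProd C n i (Dd C i) m)
    have T : evs C n (HProd C n i (Dd C i) (m + 1)) * Phi C (n + 1) (m + 1) * Vv C (n + 1) i N (m + 1) * w =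
        evs C n (HP C n i (Dg C i) m) * (DD * Phi C (n + 1) m * Vv C (n + 1) i N m * w) -
        evs C n (HProd C n i (Dd C i) m * (Polynomial.X - Polynomial.C (X C n m)) ^ Mt C i) *
          (is C n (Vv C n i N m) * (Phi C (n + 1) (m + 1) * (Ep C (n + 1) (m + 1) i * w))) := by
      rw [evs_HProd_succ (Dd C i) (by omega), (e4 _).eq, Phi, Vv, evs_HP (Dg C i) (by omega), map_mul (evs C n)]
      calc _ = DD * (HE C n i (Dd C i) (m + 1) * Phi C (n + 1) m) * (Ph C (n + 1) m * Ta C (n + 1) m) * Vv C (n + 1) i N m * w := by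
              simp only [mul_assoc]
        _ = DD * Phi C (n + 1) m * (Hf C i (Dd C i) (fun j => Ep C (n + 1) (m + 1) j) (X C (n + 1) m) (X C (n + 1) (m + 1)) * (Ph C (n + 1) m * Ta C (n + 1) m) * Ep C (n + 1) m i) * Vv C (n + 1) i N m * w := by
              rw [e1]; nth_rewrite 1 [e6]; simp only [mul_assoc]
        _ = _ := by
              rw [e5, sub_mul, mul_sub, sub_mul, sub_mul]
              congr 1
              · rw [← mul_assoc, mul_assoc DD, ← e2, ← mul_assoc, ← (e4 _).eq]
                rw [mul_assoc _ (Ep C (n + 1) m i), ← e6]; simp only [mul_assoc]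
              · have : ∀ y z : KA C (n + 1), DD * Phi C (n + 1) m * ((X C (n + 1) m - X C (n + 1) (m + 1)) ^ Mt C i * y * z * Ep C (n + 1) m i) * Vv C (n + 1) i N m * w = DD * (Phi C (n + 1) m * (X C (n + 1) m - X C (n + 1) (m + 1)) ^ Mt C i) * y * (z * (Ep C (n + 1) m i * Vv C (n + 1) i N m)) * w := by
                  intro y z; simp only [mul_assoc]
                rw [this, ← e6, e7, e3]
                have e8' : Phi C (n + 1) m * Ph C (n + 1) m * Vv C (n + 1) i N m = is C n (Vv C n i N m) * Phi C (n + 1) (m + 1) := e8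
                have : ∀ y : KA C (n + 1), DD * (y * Phi C (n + 1) m) * Ph C (n + 1) m * (Vv C (n + 1) i N m * Ep C (n + 1) (m + 1) i) * w = DD * y * (Phi C (n + 1) m * Ph C (n + 1) m * Vv C (n + 1) i N m) * (Ep C (n + 1) (m + 1) i * w) := by
                  intro y; simp only [mul_assoc]
                rw [this, e8']
                simp only [Phi, mul_assoc]; rfl
    rw [T, map_sub, Pi.sub_apply, psi'_evs, psi'_evs, ih (by omega), psi'_is,
      pi_Vv π hL (by omega), map_zero, zero_mul, mul_zero, sub_zero, HProd]
    simp only [Polynomial.map_mul, mul_assoc]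

variable (C n i N) in
/-- the monic polynomial -/
noncomputable def Fp : Polynomial (KA C n) := HProd C n i (Dg C i) n * Polynomial.X ^ N

lemma Fp_monic : (Fp C n i N).Monic := (HProd_monic le_rfl).mul (Polynomial.monic_X_pow _)

lemma Fp_comm [Nonempty I] (r : KA C n) : Commute (Polynomial.C r) (Fp C n i N) :=
  (HProd_comm_C _ r).mul_right ((Polynomial.commute_X_pow _ _).symm)

lemma psi'_qp [Nonempty I] (hL : 0 < n → π (X C n 0 ^ N * Ep C n 0 i) = 0) (w a) :
    psi' i π (qel C n i * (pel C n i N * w)) a = (Fp C n i N).map π * psi' i π w a := by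
  rw [← mul_assoc]
  exact psi'_cm π hL n le_rfl w a

end Qel
end KLR


namespace KLR
open Finset

variable {k : Type} [Field k] {I : Type} [Fintype I] [DecidableEq I]

section divs
open Polynomial
variable {S : Type} [Ring S] {F : S[X]}

lemma dv_unique (hF : F.Monic) (q r : S[X]) (hr : degree r < degree F) : (r + F * q) /ₘ F = q :=
  (Polynomial.div_modByMonic_unique (f := r + F * q) q r hF ⟨rfl, hr⟩).1

lemma dv_add [Nontrivial S] (hF : F.Monic) (f g : S[X]) : (f + g) /ₘ F = f /ₘ F + g /ₘ F := by
  have h1 := Polynomial.modByMonic_add_div f F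
  have h2 := Polynomial.modByMonic_add_div g F
  have h3 : f + g = (f %ₘ F + g %ₘ F) + F * (f /ₘ F + g /ₘ F) := by
    nth_rewrite 1 [← h1, ← h2]; rw [mul_add]; abel
  rw [h3, dv_unique hF]
  · exact (degree_add_le _ _).trans_lt (max_lt (degree_modByMonic_lt f hF) (degree_modByMonic_lt g hF))

lemma dv_C [Nontrivial S] (hF : F.Monic) (f : S[X]) (s : S) (hs : Commute (Polynomial.C s) F) :
    (Polynomial.C s * f) /ₘ F = Polynomial.C s * (f /ₘ F) := by
  have h1 := Polynomial.modByMonic_add_div f F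
  have h3 : Polynomial.C s * f = Polynomial.C s * (f %ₘ F) + F * (Polynomial.C s * (f /ₘ F)) := by
    nth_rewrite 1 [← h1]
    rw [mul_add, ← mul_assoc _ F, hs.eq, mul_assoc]
  rw [h3, dv_unique hF]
  rw [← smul_eq_C_mul]
  exact (degree_smul_le _ _).trans_lt (degree_modByMonic_lt f hF)

lemma dv_mul [Nontrivial S] (hF : F.Monic) (f : S[X]) : (F * f) /ₘ F = f := by
  have := dv_unique hF f 0 (by rw [degree_zero]; exact bot_lt_iff_ne_bot.2 (degree_ne_bot.2 hF.ne_zero))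
  rwa [zero_add] at this
end divs

section G
variable {C : CartanDatum k I} {n : ℕ} {i : I} {N : ℕ}
variable {S : Type} [Ring S] (π : KA C n →+* S)

lemma pel_right : pel C n i N * Ep C (n + 1) 0 i = pel C n i N := Vv_right _ (by omega)

lemma P_wd (hL : 0 < n → π (X C n 0 ^ N * Ep C n 0 i) = 0) {w w'} (h : psi' i π w = psi' i π w') :
    psi i π (pel C n i N * w) = psi i π (pel C n i N * w') := by
  rw [← sub_eq_zero, ← map_sub, ← mul_sub]
  rw [← sub_eq_zero, ← map_sub] at h
  refine psi'_kill i π ((psi i π).comp (AddMonoidHom.mulLeft (pel C n i N))) ?_ ?_ h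
  · intro r z hr
    change psi i π (pel C n i N * (is C n r * z)) = 0
    rw [← mul_assoc, pel_is π hL, mul_assoc]
    exact psi_io_zero i π hr _
  · intro z
    change psi i π (pel C n i N * (_ * z)) = psi i π (pel C n i N * z)
    rw [← mul_assoc, pel_right]

lemma Q_wd [Nonempty I] {w w'} (h : psi i π w = psi i π w') :
    psi' i π (qel C n i * w) = psi' i π (qel C n i * w') := by
  rw [← sub_eq_zero, ← map_sub, ← mul_sub]
  rw [← sub_eq_zero, ← map_sub] at h
  refine psi_kill i π ((psi' i π).comp (AddMonoidHom.mulLeft (qel C n i))) ?_ ?_ h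
  · intro r z hr
    change psi' i π (qel C n i * (io C n r * z)) = 0
    rw [← mul_assoc, qel_io, mul_assoc]
    funext a
    rw [psi'_is, hr, map_zero, zero_mul]; rfl
  · intro z
    change psi' i π (qel C n i * (_ * z)) = psi' i π (qel C n i * z)
    rw [← mul_assoc, qel_Ep, mul_assoc, psi'_Ep]

/-- existence of the retraction -/
lemma exists_D [Nonempty I] [Nontrivial S] (hπ : Function.Surjective π)
    (hL : 0 < n → π (X C n 0 ^ N * Ep C n 0 i) = 0) :
    ∃ D : KA C (n + 1) →+ (Fin (n + 1) → Polynomial S),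
      (∀ r z a, D (io C n r * z) a = Polynomial.C (π r) * D z a) ∧
      (∀ z, D (Ep C (n + 1) n i * z) = D z) ∧
      (∀ z w, psi i π z = psi i π (pel C n i N * w) → D z = 0) ∧
      (∀ z, ∃ w, D z = psi i π z - psi i π (pel C n i N * w)) := by
  classical
  set F := (Fp C n i N).map π with hFdef
  have hF : F.Monic := Fp_monic.map π
  have hFc : ∀ s, Commute (Polynomial.C s) F := by
    intro s
    obtain ⟨r, rfl⟩ := hπ s
    have := congrArg (Polynomial.map π) (Fp_comm (C := C) (n := n) (i := i) (N := N) r).eq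
    rw [Polynomial.map_mul, Polynomial.map_mul, Polynomial.map_C] at this
    exact this
  set sec := Function.surjInv (psi'_surj (C := C) (n := n) i π hπ)
  have hsec : ∀ κ, psi' i π (sec κ) = κ := Function.surjInv_eq _
  -- T z = the element w
  let T : KA C (n + 1) → KA C (n + 1) := fun z => sec (fun a => psi' i π (qel C n i * z) a /ₘ F)
  have hT : ∀ z a, psi' i π (T z) a = psi' i π (qel C n i * z) a /ₘ F := fun z a => by rw [hsec]
  refine ⟨{ toFun := fun z => psi i π z - psi i π (pel C n i N * T z), map_zero' := ?_, map_add' := ?_ }, ?_, ?_, ?_, ?_⟩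
  · have : psi i π (pel C n i N * T 0) = psi i π (pel C n i N * 0) := by
      apply P_wd π hL; funext a; rw [hT]; simp [Polynomial.zero_divByMonic]
    rw [this]; simp
  · intro z w
    have : psi i π (pel C n i N * T (z + w)) = psi i π (pel C n i N * (T z + T w)) := by
      apply P_wd π hL; funext a
      rw [hT, map_add, Pi.add_apply, hT, hT, mul_add, map_add, Pi.add_apply, dv_add hF]
    rw [this, mul_add, map_add, map_add]; abel
  · intro r z a
    change psi i π (io C n r * z) a - psi i π (pel C n i N * T (io C n r * z)) a = _ * (psi i π z a - psi i π (pel C n i N * T z) a)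
    have : psi i π (pel C n i N * T (io C n r * z)) = psi i π (pel C n i N * (is C n r * T z)) := by
      apply P_wd π hL; funext a
      rw [hT, psi'_is, hT, ← mul_assoc, qel_io, mul_assoc, psi'_is, dv_C hF _ _ (hFc _)]
    rw [this, ← mul_assoc, pel_is π hL, mul_assoc, psi_io, psi_io, mul_sub]
  · intro z
    change psi i π (_ * z) - psi i π (pel C n i N * T (_ * z)) = psi i π z - psi i π (pel C n i N * T z)
    have : psi i π (pel C n i N * T (Ep C (n + 1) n i * z)) = psi i π (pel C n i N * T z) := by
      apply P_wd π hL; funext a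
      rw [hT, hT, ← mul_assoc, qel_Ep, mul_assoc, psi'_Ep]
    rw [this, psi_Ep]
  · intro z w h
    change psi i π z - psi i π (pel C n i N * T z) = 0
    have : psi i π (pel C n i N * T z) = psi i π (pel C n i N * w) := by
      apply P_wd π hL; funext a
      rw [hT, Q_wd π h, psi'_qp π hL, dv_mul hF]
    rw [this, h, sub_self]
  · intro z; exact ⟨T z, rfl⟩

lemma ev_pi {B : Type} [Ring B] (πB : KA C (n + 1) →+* B) (φ : S →+ B)
    (hφ : ∀ r, φ (π r) = πB (io C n r * Ep C (n + 1) n i)) {K : ℕ} (hK : πB (X C (n + 1) n) ^ K = 0)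
    (c : Polynomial (KA C n)) (y : B) :
    πB (ev C n c * Ep C (n + 1) n i) * y =
      ∑ m ∈ range K, φ ((c.map π).coeff m) * (πB (X C (n + 1) n) ^ m * y) := by
  induction c using Polynomial.induction_on' with
  | add p q hp hq =>
    rw [map_add, add_mul, map_add, add_mul, hp, hq, ← Finset.sum_add_distrib]
    refine Finset.sum_congr rfl fun m _ => ?_
    rw [Polynomial.map_add, Polynomial.coeff_add, map_add, add_mul]
  | monomial m r =>
    have h1 : πB (ev C n (Polynomial.monomial m r) * Ep C (n + 1) n i) * y =
        φ (π r) * (πB (X C (n + 1) n) ^ m * y) := by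
      rw [← Polynomial.C_mul_X_pow_eq_monomial, map_mul (ev C n), map_pow, ev_C, ev_X, hφ, mul_assoc]
      have : Commute (X C (n + 1) n ^ m) (Ep C (n + 1) n i) :=
        Commute.pow_left ((canon C (n + 1)).xε n (by omega) n (by omega) i) m
      rw [this.eq, ← mul_assoc, map_mul πB, map_pow πB, mul_assoc]
    rw [h1, Polynomial.map_monomial]
    simp only [Polynomial.coeff_monomial]
    by_cases hm : m < K
    · rw [Finset.sum_eq_single m]
      · rw [if_pos rfl]
      · intro b _ hb; rw [if_neg (Ne.symm hb), map_zero, zero_mul]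
      · intro h; exact absurd (Finset.mem_range.2 hm) h
    · rw [Finset.sum_eq_zero]
      · have : πB (X C (n + 1) n) ^ m = 0 := pow_eq_zero_of_le (not_lt.mp hm) hK
        rw [this]; simp
      · intro b hb
        rw [if_neg (by rintro rfl; exact hm (Finset.mem_range.1 hb)), map_zero, zero_mul]

/-- the dual basis -/
theorem dual_basis [Nonempty I] [Nontrivial S] (hπ : Function.Surjective π)
    (hL : 0 < n → π (X C n 0 ^ N * Ep C n 0 i) = 0)
    {B : Type} [Ring B] (πB : KA C (n + 1) →+* B) (hπB : Function.Surjective πB) (φ : S →+ B)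
    (hφ : ∀ r, φ (π r) = πB (io C n r * Ep C (n + 1) n i)) {K : ℕ} (hK : πB (X C (n + 1) n) ^ K = 0)
    (hp : πB (X C (n + 1) 0 ^ N * Ep C (n + 1) 0 i) = 0)
    (hker : ∀ z, πB z = 0 → ∃ w, psi i π z = psi i π (pel C n i N * w)) :
    ∃ (b : Fin (n + 1) × Fin K → B) (f : Fin (n + 1) × Fin K → B →+ S),
      (∀ j t x, f j (φ t * x) = t * f j x) ∧ ∀ x, φ 1 * x = ∑ j, φ (f j x) * b j := by
  obtain ⟨D, h1, h2, h3, h4⟩ := exists_D (i := i) π hπ hL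
  set sec := Function.surjInv hπB
  have hsec : ∀ x, πB (sec x) = x := Function.surjInv_eq hπB
  have hD : ∀ {z w}, πB z = πB w → D z = D w := by
    intro z w h
    rw [← sub_eq_zero, ← map_sub]
    obtain ⟨w', hw'⟩ := hker (z - w) (by rw [map_sub, h, sub_self])
    exact h3 _ _ hw'
  have hpB : πB (pel C n i N) = 0 := by
    have : ∀ b, πB (Vv C (n + 1) i N b) = 0 := by
      intro b
      induction b with
      | zero => exact hp
      | succ b ih => rw [Vv, map_mul, ih, mul_zero]
    exact this n
  have hrec : ∀ z, πB (Ep C (n + 1) n i * z) = ∑ a : Fin (n + 1), ∑ m : Fin K,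
      φ ((psi i π z a).coeff m) * (πB (X C (n + 1) n) ^ (m : ℕ) * πB (tb C n a)) := by
    intro z
    rw [th_spec i z, map_sum]
    refine Finset.sum_congr rfl fun a _ => ?_
    rw [← mul_assoc, map_mul πB, ev_pi π πB φ hφ hK, Finset.sum_range]
    rfl
  refine ⟨fun j => πB (X C (n + 1) n) ^ (j.2 : ℕ) * πB (tb C n j.1), fun j =>
    { toFun := fun x => (D (sec x) j.1).coeff j.2, map_zero' := ?_, map_add' := ?_ }, ?_, ?_⟩
  · rw [hD (z := sec 0) (w := 0) (by rw [hsec, map_zero])]; simp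
  · intro x y
    rw [hD (z := sec (x + y)) (w := sec x + sec y) (by rw [map_add, hsec, hsec, hsec]), map_add]; simp
  · intro j t x
    change (D (sec _) j.1).coeff j.2 = t * (D (sec x) j.1).coeff j.2
    obtain ⟨r, rfl⟩ := hπ t
    rw [hD (z := sec _) (w := io C n r * (Ep C (n + 1) n i * sec x)) (by
      rw [hsec, hφ, ← mul_assoc, map_mul πB _ (sec x), hsec]), h1, h2, Polynomial.coeff_C_mul]
  · intro x
    change _ = ∑ j : Fin (n + 1) × Fin K, φ ((D (sec x) j.1).coeff j.2) * _
    rw [Fintype.sum_prod_type]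
    obtain ⟨w, hw⟩ := h4 (sec x)
    rw [← map_one π, hφ, map_one, one_mul]
    have e1 : πB (Ep C (n + 1) n i) * x = πB (Ep C (n + 1) n i * sec x) := by rw [map_mul, hsec]
    have e2 : πB (Ep C (n + 1) n i * (pel C n i N * w)) = 0 := by
      rw [map_mul, map_mul πB, hpB, zero_mul, mul_zero]
    rw [e1, ← sub_zero (πB _), ← e2, hrec, hrec, hw, ← Finset.sum_sub_distrib]
    refine Finset.sum_congr rfl fun a _ => ?_
    rw [← Finset.sum_sub_distrib]
    refine Finset.sum_congr rfl fun m _ => ?_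
    rw [Pi.sub_apply, Polynomial.coeff_sub, map_sub, sub_mul]
end G
end KLR


namespace KLR
open Finset

variable {k : Type} [Field k] {I : Type} [Fintype I] [DecidableEq I]

section eg
variable (C : CartanDatum k I) (n : ℕ)

/-- `e(γ)` -/
noncomputable def eg (γ : I → ℕ) : KA C n := ∑ ν ∈ seqs γ n, kE C ν

variable {C n}

lemma mem_seqs {γ : I → ℕ} {ν : Fin n → I} : ν ∈ seqs γ n ↔ content ν = γ := by simp [seqs]

lemma eg_kE (γ : I → ℕ) (ν : Fin n → I) :
    eg C n γ * kE C ν = if content ν = γ then kE C ν else 0 := by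
  unfold eg
  rw [Finset.sum_mul]
  simp only [Ee_mul]
  rw [Finset.sum_ite_eq' (seqs γ n) ν (fun ν => kE C ν)]
  simp only [mem_seqs]

lemma kE_eg (γ : I → ℕ) (ν : Fin n → I) :
    kE C ν * eg C n γ = if content ν = γ then kE C ν else 0 := by
  unfold eg
  rw [Finset.mul_sum]
  simp only [Ee_mul]
  rw [Finset.sum_ite_eq (seqs γ n) ν (fun _ => kE C ν)]
  simp only [mem_seqs]

lemma content_perm (ν : Fin n → I) (σ : Equiv.Perm (Fin n)) : content (ν ∘ σ) = content ν := by
  funext j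
  unfold content
  refine Finset.card_bij (fun a _ => σ a) ?_ ?_ ?_
  · intro a ha; simpa using ha
  · intro a _ b _ h; exact σ.injective h
  · intro b hb; exact ⟨σ.symm b, by simpa using hb, by simp⟩

lemma content_snoc (ν : Fin n → I) (i : I) :
    content (Fin.snoc ν i : Fin (n + 1) → I) = addA (content ν) i := by
  funext j
  unfold content addA
  beta_reduce
  rw [Finset.card_filter, Fin.sum_univ_castSucc, Finset.card_filter]
  simp only [Fin.snoc_castSucc, Fin.snoc_last]
  congr 1
  by_cases h : i = j
  · simp [h]
  · rw [if_neg h, if_neg (Ne.symm h)]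

lemma addA_inj {β β' : I → ℕ} {i : I} : addA β i = addA β' i ↔ β = β' := by
  constructor
  · intro h; funext j; have := congrFun h j; unfold addA at this; omega
  · rintro rfl; rfl

lemma eg_comm (γ : I → ℕ) (z : KA C n) : Commute (eg C n γ) z := by
  let S' : Subalgebra k (KA C n) := Subalgebra.centralizer k {eg C n γ}
  have : z ∈ S' := by
    refine KA_top C S' ?_ ?_ ?_ z
    · intro a ha j
      rw [Subalgebra.mem_centralizer_iff]
      rintro _ rfl
      unfold eg
      rw [Finset.sum_mul, Finset.mul_sum]
      exact Finset.sum_congr rfl fun ν _ => (Ep_comm_Ee C a ha j ν).symm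
    · intro a ha
      rw [Subalgebra.mem_centralizer_iff]
      rintro _ rfl
      unfold eg
      rw [Finset.sum_mul, Finset.mul_sum]
      exact Finset.sum_congr rfl fun ν _ => (X_Ee C a ν).symm
    · intro l hl
      rw [Subalgebra.mem_centralizer_iff]
      rintro _ rfl
      refine alg_ext C fun ν => ?_
      rw [mul_assoc, mul_assoc, eg_kE, Ta_eq C hl, Tt_Ee, ← mul_assoc, eg_kE, content_perm]
      split_ifs
      · rw [Tt_Ee]
      · rw [mul_zero, zero_mul]
  rw [Subalgebra.mem_centralizer_iff] at this
  exact this _ rfl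

lemma io_kE_mul (ν : Fin n → I) (i : I) (μ : Fin (n + 1) → I) :
    io C n (kE C ν) * (Ep C (n + 1) n i * kE C μ) =
      if μ = Fin.snoc ν i then kE C μ else 0 := by
  have h0 : ∀ (ν' : Fin n → I) , (∃ a : Fin n, μ a.castSucc ≠ ν' a) →
      io C n (kE C ν') * kE C μ = 0 := by
    rintro ν' ⟨a, ha⟩
    have : kE C ν' = kE C ν' * Ep C n a (ν' a) := by rw [Ee_mul_Ep C a.2, if_pos rfl]
    rw [this, map_mul, mul_assoc, io_Ep C n a.2, Ep_mul_Ee C (by omega), if_neg, mul_zero]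
    exact ha
  rw [Ep_mul_Ee C (by omega)]
  by_cases hi : μ ⟨n, by omega⟩ = i
  · rw [if_pos hi]
    by_cases hν : ∃ a : Fin n, μ a.castSucc ≠ ν a
    · rw [h0 ν hν, if_neg]
      rintro rfl
      obtain ⟨a, ha⟩ := hν
      simp at ha
    · push Not at hν
      have hμ : μ = Fin.snoc ν i := by
        funext a
        refine Fin.lastCases ?_ (fun a => ?_) a
        · rw [Fin.snoc_last]; exact hi
        · rw [Fin.snoc_castSucc]; exact hν a
      rw [if_pos hμ]
      have h1 : (1 : KA C (n + 1)) * kE C μ = io C n (∑ ν', kE C ν') * kE C μ := by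
        rw [Ee_sum, map_one]
      rw [map_sum, Finset.sum_mul, Finset.sum_eq_single ν, one_mul] at h1
      · exact h1.symm
      · intro ν' _ hne
        apply h0
        obtain ⟨a, ha⟩ := Function.ne_iff.mp hne
        exact ⟨a, by rw [hν a]; exact ha.symm⟩
      · simp
  · rw [if_neg hi, mul_zero, if_neg]
    rintro rfl
    apply hi
    exact Fin.snoc_last (α := fun _ => I) i ν

lemma io_kE (ν : Fin n → I) (i : I) :
    io C n (kE C ν) * Ep C (n + 1) n i = kE C (Fin.snoc ν i : Fin (n + 1) → I) := by
  refine alg_ext C fun μ => ?_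
  rw [mul_assoc, io_kE_mul, Ee_mul]
  by_cases h : μ = Fin.snoc ν i
  · rw [if_pos h, if_pos h.symm, h]
  · rw [if_neg h, if_neg (Ne.symm h)]

lemma io_eg (β : I → ℕ) (i : I) :
    io C n (eg C n β) * Ep C (n + 1) n i = eg C (n + 1) (addA β i) * Ep C (n + 1) n i := by
  have h1 : Ep C (n + 1) n i = ∑ ν : Fin n → I, kE C (Fin.snoc ν i : Fin (n + 1) → I) := by
    rw [← one_mul (Ep C (n + 1) n i), ← map_one (io C n), ← Ee_sum C, map_sum, Finset.sum_mul]
    exact Finset.sum_congr rfl fun ν _ => io_kE ν i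
  conv_rhs => rw [h1, Finset.mul_sum]
  simp only [eg_kE, content_snoc, addA_inj]
  unfold eg
  rw [map_sum, Finset.sum_mul]
  simp only [io_kE]
  unfold seqs
  rw [Finset.sum_filter]

end eg

section ker
variable {C : CartanDatum k I} {n : ℕ} {i : I} {N : ℕ}
variable {S : Type} [Ring S] (π : KA C n →+* S)

lemma X_pel (hL : 0 < n → π (X C n 0 ^ N * Ep C n 0 i) = 0) (w) :
    psi i π (X C (n + 1) n * (pel C n i N * w)) = psi i π (pel C n i N * (X C (n + 1) 0 * w)) := by
  have key : ∀ b, b ≤ n → psi i π (X C (n + 1) n * (pel C n i N * w)) =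
      psi i π (tb C n b * (X C (n + 1) b * (Vv C (n + 1) i N b * w))) := by
    intro b hb
    induction hb using Nat.decreasingInduction with
    | self => rw [tb_n, one_mul]; rfl
    | of_succ b hb ih =>
      rw [ih]
      have h2 : X C (n + 1) (b + 1) * Ta C (n + 1) b =
          Ta C (n + 1) b * X C (n + 1) b + (canon C (n + 1)).E b := by
        have : Ta C (n + 1) b * X C (n + 1) b =
          X C (n + 1) (b + 1) * Ta C (n + 1) b - (canon C (n + 1)).E b :=
          (canon C (n + 1)).τx0' (by omega)
        rw [this, sub_add_cancel]
      have hpol := Sb_pol (C := C) (i := i) (show b + 1 ≤ n from hb)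
      have h3 : tb C n (b + 1) * (X C (n + 1) (b + 1) * (Vv C (n + 1) i N (b + 1) * w)) =
          tb C n b * (X C (n + 1) b * (Vv C (n + 1) i N b * w)) +
          tb C n (b + 1) * (canon C (n + 1)).E b * Vv C (n + 1) i N b * w := by
        rw [Vv, mul_assoc (Ta _ _ _), ← mul_assoc (X _ _ _) (Ta _ _ _), h2, tb_succ C n hb]
        simp only [add_mul, mul_add, mul_assoc]
      rw [h3, map_add, err_kill π hL hb ((canon C (n + 1)).E_mem _ (by omega) hpol.1), add_zero]
  rw [key 0 (Nat.zero_le _), ← mul_assoc (X _ _ _)]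
  have : Commute (X C (n + 1) 0) (Vv C (n + 1) i N 0) := by
    refine Commute.mul_right ((Commute.refl _).pow_right _) ?_
    exact (canon C (n + 1)).xε 0 (by omega) 0 (by omega) i
  rw [this.eq, mul_assoc, ← mul_assoc, tb_Vv (Nat.zero_le _)]
  rfl

lemma Xpow_pel (hL : 0 < n → π (X C n 0 ^ N * Ep C n 0 i) = 0) (m : ℕ) : ∀ w,
    psi i π (X C (n + 1) n ^ m * (pel C n i N * w)) = psi i π (pel C n i N * (X C (n + 1) 0 ^ m * w)) := by
  induction m with
  | zero => intro w; simp
  | succ m ih =>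
    intro w
    have h1 : psi i π (ev C n Polynomial.X * (X C (n + 1) n ^ m * (pel C n i N * w))) =
        psi i π (ev C n Polynomial.X * (pel C n i N * (X C (n + 1) 0 ^ m * w))) := by
      funext a
      rw [psi_ev, ih, psi_ev]
    rw [ev_X] at h1
    rw [pow_succ', mul_assoc, pow_succ', mul_assoc, h1, X_pel π hL]

lemma ev_pel (hL : 0 < n → π (X C n 0 ^ N * Ep C n 0 i) = 0) (c : Polynomial (KA C n)) (w) :
    ∃ w', psi i π (ev C n c * (pel C n i N * w)) = psi i π (pel C n i N * w') := by
  induction c using Polynomial.induction_on' with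
  | add p q hp hq =>
    obtain ⟨w1, h1⟩ := hp
    obtain ⟨w2, h2⟩ := hq
    exact ⟨w1 + w2, by rw [map_add, add_mul, map_add, h1, h2, mul_add, map_add]⟩
  | monomial m r =>
    refine ⟨is C n r * (X C (n + 1) 0 ^ m * w), ?_⟩
    rw [← Polynomial.C_mul_X_pow_eq_monomial, map_mul (ev C n), map_pow, ev_C, ev_X, mul_assoc,
      ← mul_assoc (pel C n i N), pel_is π hL, mul_assoc]
    funext a
    rw [psi_io, Xpow_pel π hL, psi_io]

/-- one summand -/
lemma J_sum {ι : Type} (s : Finset ι) (f : ι → KA C (n + 1))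
    (h : ∀ a ∈ s, ∃ w, psi i π (f a) = psi i π (pel C n i N * w)) :
    ∃ w, psi i π (∑ a ∈ s, f a) = psi i π (pel C n i N * w) := by
  classical
  induction s using Finset.induction_on with
  | empty => exact ⟨0, by simp⟩
  | insert a s ha ih =>
    obtain ⟨w1, h1⟩ := h a (Finset.mem_insert_self _ _)
    obtain ⟨w2, h2⟩ := ih fun b hb => h b (Finset.mem_insert_of_mem hb)
    exact ⟨w1 + w2, by rw [Finset.sum_insert ha, map_add, h1, h2, mul_add, map_add]⟩

lemma Ep_tb0 : Ep C (n + 1) n i * tb C n 0 = tb C n 0 * Ep C (n + 1) 0 i := by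
  have : ∀ b, b ≤ n → Ep C (n + 1) n i * tb C n b = tb C n b * Ep C (n + 1) b i := by
    intro b hb
    induction hb using Nat.decreasingInduction with
    | self => rw [tb_n, one_mul, mul_one]
    | of_succ b hb ih =>
      have h2 : Ta C (n + 1) b * Ep C (n + 1) b i = Ep C (n + 1) (b + 1) i * Ta C (n + 1) b := by
        have := ((canon C (n + 1)).sc b (by omega) b (by omega) i).eq
        rwa [Equiv.swap_apply_left] at this
      rw [tb_succ C n hb, ← mul_assoc, ih, mul_assoc, mul_assoc, h2]
  exact this 0 (Nat.zero_le _)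

lemma J_cyc (Λ : I → ℕ) (hL : 0 < n → ∀ j, π (X C n 0 ^ Λ j * Ep C n 0 j) = 0) (u w) (j : I) :
    ∃ w', psi i π (u * (X C (n + 1) 0 ^ Λ j * Ep C (n + 1) 0 j) * w) =
      psi i π (pel C n i (Λ i) * w') := by
  have hL' : 0 < n → π (X C n 0 ^ Λ i * Ep C n 0 i) = 0 := fun h => hL h i
  rw [← psi_Ep, ← mul_assoc, ← mul_assoc, th_spec i u, Finset.sum_mul, Finset.sum_mul]
  refine J_sum π _ _ fun a _ => ?_
  by_cases ha : (a : ℕ) = 0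
  · rw [ha, Ep_tb0]
    have hc : Commute (Ep C (n + 1) 0 i) (X C (n + 1) 0 ^ Λ j) :=
      Commute.pow_right ((canon C (n + 1)).xε 0 (by omega) 0 (by omega) i).symm _
    by_cases hj : i = j
    · subst hj
      obtain ⟨w', hw'⟩ := ev_pel π hL' (th i u a) w
      refine ⟨w', ?_⟩
      rw [← hw']
      congr 1
      rw [pel, ← tb_Vv (Nat.zero_le n), Vv]
      have : Ep C (n + 1) 0 i * (X C (n + 1) 0 ^ Λ i * Ep C (n + 1) 0 i) =
          X C (n + 1) 0 ^ Λ i * Ep C (n + 1) 0 i := by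
        rw [← mul_assoc, hc.eq, mul_assoc, Ep_idem i (by omega)]
      rw [mul_assoc (ev _ _ _), mul_assoc (tb _ _ _), this, mul_assoc]
    · refine ⟨0, ?_⟩
      have h0 : Ep C (n + 1) 0 i * Ep C (n + 1) 0 j = 0 := by
        have := (canon C (n + 1)).εmul 0 (by omega) i j
        rw [if_neg hj] at this; exact this
      have : Ep C (n + 1) 0 i * (X C (n + 1) 0 ^ Λ j * Ep C (n + 1) 0 j) = 0 := by
        rw [← mul_assoc, hc.eq, mul_assoc, h0, mul_zero]
      rw [mul_assoc (ev _ _ _), mul_assoc (tb _ _ _), this]; simp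
  · refine ⟨0, ?_⟩
    have ha' : 0 < (a : ℕ) := Nat.pos_of_ne_zero ha
    have hn : 0 < n := by omega
    have hc : Commute (tb C n a) (X C (n + 1) 0 ^ Λ j * Ep C (n + 1) 0 j) :=
      Commute.mul_right ((tb_comm_X (by omega) ha').pow_right _) (tb_comm_Ep (by omega) ha' j)
    have hio : io C n (X C n 0 ^ Λ j * Ep C n 0 j) = X C (n + 1) 0 ^ Λ j * Ep C (n + 1) 0 j := by
      rw [map_mul, map_pow, io_X C n hn, io_Ep C n hn]
    have hc2 := (io_comm_Ep C n i (X C n 0 ^ Λ j * Ep C n 0 j)).eq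
    rw [hio] at hc2
    rw [mul_zero, map_zero, mul_assoc (ev _ _ _), mul_assoc (Ep _ _ _ _), hc.eq,
      ← mul_assoc (Ep _ _ _ _), hc2, ← hio, mul_assoc, mul_assoc, mul_assoc]
    exact psi_ev_zero i π (psi_io_zero i π (hL hn j) _) _

lemma J_unit (β : I → ℕ) (hβ : π (eg C n β) = 1) (u w) :
    psi i π (u * (eg C (n + 1) (addA β i) - 1) * w) = 0 := by
  have h1 : Commute (eg C (n + 1) (addA β i) - 1) u := (eg_comm _ u).sub_left (Commute.one_left _)
  have h2 : Ep C (n + 1) n i * (eg C (n + 1) (addA β i) - 1) =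
      io C n (eg C n β - 1) * Ep C (n + 1) n i := by
    rw [map_sub, sub_mul, io_eg, map_one, mul_sub, (eg_comm _ _).eq, mul_one, one_mul]
  rw [← psi_Ep, ← h1.eq, mul_assoc, ← mul_assoc, h2, mul_assoc]
  exact psi_io_zero i π (by rw [map_sub, hβ, map_one, sub_self]) _

variable (i N) in
/-- the two-sided ideal of elements killed -/
noncomputable def Jt : TwoSidedIdeal (KA C (n + 1)) :=
  TwoSidedIdeal.mk' {z | ∀ u w, ∃ w', psi i π (u * z * w) = psi i π (pel C n i N * w')}
    (fun u w => ⟨0, by simp⟩)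
    (by
      intro x y hx hy u w
      obtain ⟨w1, h1⟩ := hx u w
      obtain ⟨w2, h2⟩ := hy u w
      exact ⟨w1 + w2, by rw [mul_add, add_mul, map_add, h1, h2, mul_add, map_add]⟩)
    (by
      intro x hx u w
      obtain ⟨w1, h1⟩ := hx u w
      exact ⟨-w1, by rw [mul_neg, neg_mul, map_neg, h1, mul_neg, map_neg]⟩)
    (by
      intro x y hy u w
      obtain ⟨w1, h1⟩ := hy (u * x) w
      exact ⟨w1, by rw [← h1, mul_assoc u x y]⟩)
    (by
      intro x y hx u w
      obtain ⟨w1, h1⟩ := hx u (y * w)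
      exact ⟨w1, by rw [← h1]; simp only [mul_assoc]⟩)

lemma mem_Jt {z : KA C (n + 1)} : z ∈ Jt i N π ↔
    ∀ u w, ∃ w', psi i π (u * z * w) = psi i π (pel C n i N * w') := by
  unfold Jt; rw [TwoSidedIdeal.mem_mk']; rfl

end ker
end KLR


namespace KLR
open Finset

variable {k : Type} [Field k] {I : Type} [Fintype I] [DecidableEq I]

section nil
variable {C : CartanDatum k I} {n : ℕ}

namespace Rep
variable {A : Type} [Ring A] [Algebra k A] (r : Rep C n A)

lemma ph_sq {l : ℕ} (h : l + 1 < n) (i : I) :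
    r.ph l * (r.ph l * (r.ε l i * r.ε (l + 1) i)) = r.ε l i * r.ε (l + 1) i := by
  set e := r.ε l i * r.ε (l + 1) i with he
  have hE : r.E l * e = e := by rw [he, r.E_mul h, if_pos rfl]
  have hτ : r.τ l * (r.τ l * e) = 0 := by
    rw [← mul_assoc, he, r.τsq l h]
    unfold Qel
    rw [if_pos rfl, zero_mul]
  have hEτ : r.E l * (r.τ l * e) = r.τ l * e := by
    rw [← mul_assoc, ← (r.E_comm_τ h).eq, mul_assoc, hE]
  set d := r.x l - r.x (l + 1) with hd
  have hdE : Commute d (r.E l) := (r.E_comm_x h (by omega)).sub_left (r.E_comm_x h h)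
  have hτd : r.τ l * d = -(d * r.τ l) - 2 * r.E l := by
    rw [hd, mul_sub, r.τx0' h, r.τx1' h]; noncomm_ring
  have h1 : r.ph l * e = d * (r.τ l * e) + e := by
    rw [r.ph_eq h, add_mul, hE, mul_assoc]
  have h2 : r.τ l * (d * (r.τ l * e)) = -(2 * (r.τ l * e)) := by
    rw [← mul_assoc, hτd, sub_mul, neg_mul, mul_assoc, hτ, mul_zero, mul_assoc, hEτ]; simp
  rw [h1, mul_add, h1, r.ph_eq h, add_mul, mul_assoc, h2, ← mul_assoc (r.E l), ← hdE.eq, mul_assoc d,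
    hEτ]
  rw [← hd]
  clear_value d
  noncomm_ring

lemma x_τ_pow {l : ℕ} (h : l + 1 < n) {i j : I} (hij : i ≠ j) (m : ℕ) :
    r.x (l + 1) ^ m * (r.τ l * (r.ε l i * r.ε (l + 1) j)) =
      r.τ l * (r.x l ^ m * (r.ε l i * r.ε (l + 1) j)) := by
  induction m with
  | zero => simp
  | succ m ih =>
    have hc : Commute (r.x l) (r.ε l i * r.ε (l + 1) j) :=
      Commute.mul_right (r.xε l (by omega) l (by omega) i) (r.xε l (by omega) (l + 1) h j)
    have h1 : r.x (l + 1) * (r.τ l * (r.ε l i * r.ε (l + 1) j)) =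
        r.τ l * (r.ε l i * r.ε (l + 1) j) * r.x l := by
      have h3 : r.x (l + 1) * r.τ l = r.τ l * r.x l + r.E l := by rw [r.τx0' h, sub_add_cancel]
      rw [← mul_assoc, h3, add_mul, r.E_mul h, if_neg hij, add_zero, mul_assoc, hc.eq, ← mul_assoc]
    rw [pow_succ, mul_assoc, h1, ← mul_assoc, ih, mul_assoc, mul_assoc, ← hc.eq,
      pow_succ, mul_assoc]

end Rep

lemma ph_pow {l : ℕ} (h : l + 1 < n) (m : ℕ) :
    X C n (l + 1) ^ m * Ph C n l = Ph C n l * X C n l ^ m := by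
  have : SemiconjBy (Ph C n l) (X C n l) (X C n (l + 1)) := (canon C n).ph_x0 h
  exact (this.pow_right m).eq.symm

lemma Qlow_dvd (i j : I) {A : Type} [Ring A] [Algebra k A] {u v : A} (huv : Commute u v) (hij : i ≠ j) :
    ∃ w, Commute u w ∧ Commute v w ∧ Qlow C i j u v = v * w := by
  classical
  have huv' := huv.eq
  have hS : ∀ w ∈ Algebra.adjoin k ({u, v} : Set A), Commute u w ∧ Commute v w := by
    intro w hw
    refine Algebra.adjoin_induction (p := fun w _ => Commute u w ∧ Commute v w) ?_ ?_ ?_ ?_ hw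
    · rintro x (rfl | rfl)
      · exact ⟨Commute.refl _, huv.symm⟩
      · exact ⟨huv, Commute.refl _⟩
    · intro r; exact ⟨Algebra.commutes r u |>.symm, Algebra.commutes r v |>.symm⟩
    · intro x y _ _ hx hy; exact ⟨hx.1.add_right hy.1, hx.2.add_right hy.2⟩
    · intro x y _ _ hx hy; exact ⟨hx.1.mul_right hy.1, hx.2.mul_right hy.2⟩
  suffices ∃ w ∈ Algebra.adjoin k ({u, v} : Set A), Qlow C i j u v = v * w by
    obtain ⟨w, hw, h⟩ := this
    exact ⟨w, (hS w hw).1, (hS w hw).2, h⟩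
  have hu : u ∈ Algebra.adjoin k ({u, v} : Set A) := Algebra.subset_adjoin (by simp)
  have hv : v ∈ Algebra.adjoin k ({u, v} : Set A) := Algebra.subset_adjoin (by simp)
  have hsum : ∀ (s : Finset ℕ) (f : ℕ → A),
      (∀ p ∈ s, ∃ w ∈ Algebra.adjoin k ({u, v} : Set A), f p = v * w) →
      ∃ w ∈ Algebra.adjoin k ({u, v} : Set A), ∑ p ∈ s, f p = v * w := by
    intro s f hf
    choose! g hg hg' using hf
    exact ⟨∑ p ∈ s, g p, Subalgebra.sum_mem _ hg, by
      rw [Finset.mul_sum]; exact Finset.sum_congr rfl hg'⟩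
  unfold Qlow
  refine hsum _ _ fun p hp => hsum _ _ fun q _ => ?_
  split_ifs with hc
  · cases q with
    | zero =>
      exfalso
      have h1 := dg_cast C hij
      have h2 := C.d_pos i
      rw [Finset.mem_range] at hp
      have h3 : (p : ℤ) < dg C i j := by exact_mod_cast hp
      push_cast at hc
      nlinarith
    | succ q =>
      refine ⟨C.t i j p (q + 1) • (u ^ p * v ^ q), ?_, ?_⟩
      · exact Subalgebra.smul_mem _ (Subalgebra.mul_mem _ (Subalgebra.pow_mem _ hu _) (Subalgebra.pow_mem _ hv _)) _
      · rw [mul_smul_comm, ← mul_assoc, ← (huv.pow_left p).eq, mul_assoc, ← pow_succ']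
  · exact ⟨0, Subalgebra.zero_mem _, by simp⟩

lemma nil_ne {B : Type} [Ring B] (πB : KA C n →+* B) {l : ℕ} (h : l + 1 < n) {K : ℕ}
    (hK : πB (X C n l) ^ K = 0) {i j : I} (hij : i ≠ j) :
    ∃ K', πB (X C n (l + 1) ^ K' * (Ep C n l i * Ep C n (l + 1) j)) = 0 := by
  set e := Ep C n l i * Ep C n (l + 1) j with he
  set x := X C n l with hx
  set y := X C n (l + 1) with hy
  have hxy : Commute x y := (canon C n).xx l (by omega) (l + 1) h
  have h1 : πB (y ^ K * (Qel C i j x y * e)) = 0 := by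
    have e1 : Ta C n l * Ta C n l * e = Qel C i j x y * e := (canon C n).τsq l h i j
    have e2 : Ta C n l * e = (Ep C n l j * Ep C n (l + 1) i) * (Ta C n l) := by
      have a1 : Ta C n l * Ep C n l i = Ep C n (l + 1) i * Ta C n l := (canon C n).τε0 l h i
      have a2 : Ta C n l * Ep C n (l + 1) j = Ep C n l j * Ta C n l := (canon C n).τε1 l h j
      have a3 : Ep C n (l + 1) i * Ep C n l j = Ep C n l j * Ep C n (l + 1) i :=
        (canon C n).εε (l + 1) h l (by omega) i j
      rw [he, ← mul_assoc, a1, mul_assoc, a2, ← mul_assoc, a3]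
    have e3 : y ^ K * (Ta C n l * (Ep C n l j * Ep C n (l + 1) i)) =
      Ta C n l * (x ^ K * (Ep C n l j * Ep C n (l + 1) i)) := (canon C n).x_τ_pow h (Ne.symm hij) K
    rw [← e1, mul_assoc, e2, ← mul_assoc (Ta C n l), ← mul_assoc, e3, map_mul, map_mul, map_mul,
      map_pow, hK]
    simp
  obtain ⟨w, hw1, hw2, hw⟩ := Qlow_dvd (C := C) j i hxy.symm (Ne.symm hij)
  rw [Qel_symm' C i j hxy, Qel_eq C (Ne.symm hij), hw] at h1
  set d := dg C j i
  set t := C.t j i d 0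
  have ht : kap C j i * t = 1 := kap_mul C (Ne.symm hij)
  -- y^(K+d) e = -(κ x w) y^K e
  set c := -(kap C j i • w) with hc
  have hcy : Commute c y := ((hw1.symm.smul_left (kap C j i))).neg_left
  have hcx : Commute x c := ((hw2.smul_right (kap C j i))).neg_right
  have h2 : πB (y ^ d * (y ^ K * e)) = πB (x * c * (y ^ K * e)) := by
    rw [← sub_eq_zero, ← map_sub]
    have : y ^ d * (y ^ K * e) - x * c * (y ^ K * e) =
        algebraMap k _ (kap C j i) * (y ^ K * ((t • y ^ d + x * w) * e)) := by
      have a1 : x * c * (y ^ K * e) = y ^ K * (x * c * e) := by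
        rw [← mul_assoc, ((hxy.mul_left hcy).pow_right K).eq, mul_assoc]
      rw [a1, ← mul_assoc, ← pow_add, add_comm d K, pow_add, mul_assoc, ← mul_sub, ← sub_mul,
        ← Algebra.smul_def, ← mul_smul_comm, ← smul_mul_assoc, smul_add, smul_smul, ht, one_smul, hc,
        mul_neg, sub_neg_eq_add, mul_smul_comm]
    rw [this, map_mul, h1, mul_zero]
  have h3 : ∀ m, πB (y ^ (d * m) * (y ^ K * e)) = πB ((x * c) ^ m * (y ^ K * e)) := by
    intro m
    induction m with
    | zero => simp
    | succ m ih =>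
      have a1 : Commute (x * c) (y ^ (d * m)) := (hxy.mul_left hcy).pow_right _
      rw [mul_add, mul_one, pow_add, mul_assoc, map_mul, h2, ← map_mul, ← mul_assoc, ← a1.eq,
        mul_assoc, map_mul, ih, ← map_mul, pow_succ', mul_assoc (x * c)]
  refine ⟨d * K + K, ?_⟩
  rw [pow_add, mul_assoc, h3, hcx.mul_pow, map_mul, map_mul, map_pow, hK]
  simp

lemma nil_eq {B : Type} [Ring B] (πB : KA C n →+* B) {l : ℕ} (h : l + 1 < n) {K : ℕ}
    (hK : πB (X C n l) ^ K = 0) (i : I) :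
    πB (X C n (l + 1) ^ K * (Ep C n l i * Ep C n (l + 1) i)) = 0 := by
  have : Ph C n l * (Ph C n l * (Ep C n l i * Ep C n (l + 1) i)) =
    Ep C n l i * Ep C n (l + 1) i := (canon C n).ph_sq h i
  rw [← this, ← mul_assoc, ph_pow h, map_mul, map_mul, map_pow, hK]
  simp

lemma nil_step {B : Type} [Ring B] (πB : KA C n →+* B) {l : ℕ} (h : l + 1 < n) {K : ℕ}
    (hK : πB (X C n l) ^ K = 0) : ∃ K', πB (X C n (l + 1)) ^ K' = 0 := by
  have hall : ∀ p : I × I, ∃ K', πB (X C n (l + 1) ^ K' * (Ep C n l p.1 * Ep C n (l + 1) p.2)) = 0 := by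
    rintro ⟨i, j⟩
    by_cases hij : i = j
    · subst hij; exact ⟨K, nil_eq πB h hK i⟩
    · exact nil_ne πB h hK hij
  choose Kf hKf using hall
  refine ⟨∑ p, Kf p, ?_⟩
  have h1 : (1 : KA C n) = ∑ i, ∑ j, Ep C n l i * Ep C n (l + 1) j := by
    rw [← Finset.sum_mul_sum]
    have a1 : ∑ j, Ep C n l j = 1 := (canon C n).εsum l (by omega)
    have a2 : ∑ j, Ep C n (l + 1) j = 1 := (canon C n).εsum (l + 1) h
    rw [a1, a2, one_mul]
  rw [← map_pow, ← mul_one (X C n (l + 1) ^ _), h1, Finset.mul_sum, map_sum]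
  refine Finset.sum_eq_zero fun i _ => ?_
  rw [Finset.mul_sum, map_sum]
  refine Finset.sum_eq_zero fun j _ => ?_
  have hle : Kf (i, j) ≤ ∑ p, Kf p := Finset.single_le_sum (fun _ _ => Nat.zero_le _) (Finset.mem_univ (i, j))
  obtain ⟨m, hm⟩ := Nat.exists_eq_add_of_le' hle
  rw [hm, pow_add, mul_assoc, map_mul, hKf (i, j), mul_zero]

lemma nil_all {B : Type} [Ring B] (πB : KA C n →+* B) (Λ : I → ℕ)
    (h0 : 0 < n → ∀ j, πB (X C n 0 ^ Λ j * Ep C n 0 j) = 0) {l : ℕ} (h : l < n) :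
    ∃ K, πB (X C n l) ^ K = 0 := by
  induction l with
  | zero =>
    refine ⟨∑ p, Λ p, ?_⟩
    have a1 : ∑ j, Ep C n 0 j = 1 := (canon C n).εsum 0 h
    rw [← map_pow, ← mul_one (X C n 0 ^ _), ← a1, Finset.mul_sum, map_sum]
    refine Finset.sum_eq_zero fun j _ => ?_
    have hle : Λ j ≤ ∑ p, Λ p := Finset.single_le_sum (fun _ _ => Nat.zero_le _) (Finset.mem_univ j)
    obtain ⟨m, hm⟩ := Nat.exists_eq_add_of_le' hle
    rw [hm, pow_add, mul_assoc, map_mul, h0 h j, mul_zero]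
  | succ l ih =>
    obtain ⟨K, hK⟩ := ih (by omega)
    exact nil_step πB h hK
end nil
end KLR


namespace KLR
open Finset

variable {k : Type} [Field k] {I : Type} [Fintype I] [DecidableEq I]

section cyc
variable (C : CartanDatum k I)

/-- the cyclotomic element `a^Λ(x_1)` -/
noncomputable def aK (Λ : I → ℕ) (n : ℕ) (β : I → ℕ) : KA C n :=
  if h : 0 < n then ∑ ν ∈ seqs β n, X C n 0 ^ Λ (ν ⟨0, h⟩) * kE C ν else 0

/-- a surjection presenting the cyclotomic quotient -/
structure Cyc (Λ : I → ℕ) {n : ℕ} (β : I → ℕ) {S : Type} [Ring S] (π : KA C n →+* S) : Prop where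
  surj : Function.Surjective π
  one : π (eg C n β) = 1
  cyc : π (aK C Λ n β) = 0
  ker : ∀ J : TwoSidedIdeal (KA C n), eg C n β - 1 ∈ J → aK C Λ n β ∈ J → ∀ z, π z = 0 → z ∈ J

variable {C} {n : ℕ}

lemma Ep_aK (Λ : I → ℕ) (β : I → ℕ) (h : 0 < n) (j : I) :
    Ep C n 0 j * aK C Λ n β = X C n 0 ^ Λ j * Ep C n 0 j * eg C n β := by
  unfold aK eg
  rw [dif_pos h, Finset.mul_sum, Finset.mul_sum]
  refine Finset.sum_congr rfl fun ν _ => ?_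
  have hc : Commute (Ep C n 0 j) (X C n 0 ^ Λ (ν ⟨0, h⟩)) :=
    Commute.pow_right ((canon C n).xε 0 h 0 h j).symm _
  rw [← mul_assoc, hc.eq, mul_assoc, mul_assoc, Ep_mul_Ee C h]
  split_ifs with hj
  · rw [hj]
  · simp

lemma aK_eq (Λ : I → ℕ) (β : I → ℕ) (h : 0 < n) :
    aK C Λ n β = ∑ j, X C n 0 ^ Λ j * Ep C n 0 j * eg C n β := by
  have a1 : ∑ j, Ep C n 0 j = 1 := (canon C n).εsum 0 h
  rw [← one_mul (aK C Λ n β), ← a1, Finset.sum_mul]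
  exact Finset.sum_congr rfl fun j _ => Ep_aK Λ β h j

namespace Cyc
variable {Λ : I → ℕ} {β : I → ℕ} {S : Type} [Ring S] {π : KA C n →+* S} (H : Cyc C Λ β π)
variable {B : Type} [Ring B]

lemma kill (H : Cyc C Λ β π) (h : 0 < n) (j : I) : π (X C n 0 ^ Λ j * Ep C n 0 j) = 0 := by
  have := congrArg π (Ep_aK (C := C) Λ β h j)
  rw [map_mul, H.cyc, mul_zero, map_mul π _ (eg C n β), H.one, mul_one] at this
  exact this.symm

theorem dual (H : Cyc C Λ β π) {i : I} {πB : KA C (n + 1) →+* B}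
    (HB : Cyc C Λ (addA β i) πB) (φ : S →+ B)
    (hφ : ∀ r, φ (π r) = πB (io C n r * Ep C (n + 1) n i)) :
    ∃ (m : ℕ) (b : Fin m → B) (f : Fin m → B →+ S),
      (∀ j t x, f j (φ t * x) = t * f j x) ∧ ∀ x, φ 1 * x = ∑ j, φ (f j x) * b j := by
  haveI : Nonempty I := ⟨i⟩
  rcases subsingleton_or_nontrivial S with hS | hS
  · refine ⟨0, Fin.elim0, Fin.elim0, fun j => j.elim0, fun x => ?_⟩
    rw [Subsingleton.elim (1 : S) 0, map_zero, zero_mul]; simp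
  obtain ⟨K, hK⟩ := nil_all πB Λ (fun h => HB.kill h) (show n < n + 1 by omega)
  obtain ⟨b, f, h1, h2⟩ := dual_basis (i := i) (N := Λ i) π H.surj (fun h => H.kill h i) πB HB.surj φ hφ hK
    (HB.kill (by omega) i) (by
      intro z hz
      have := HB.ker (Jt i (Λ i) π) ?_ ?_ z hz
      · rw [mem_Jt] at this
        obtain ⟨w, hw⟩ := this 1 1
        exact ⟨w, by rw [← hw]; simp⟩
      · rw [mem_Jt]
        intro u w
        exact ⟨0, by rw [J_unit π β H.one]; simp⟩
      · rw [aK_eq _ _ (by omega)]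
        refine sum_mem fun j _ => ?_
        refine TwoSidedIdeal.mul_mem_right _ _ _ ?_
        rw [mem_Jt]
        intro u w
        exact J_cyc π Λ (fun h => H.kill h) u w j)
  let e := Fintype.equivFin (Fin (n + 1) × Fin K)
  refine ⟨_, fun j => b (e.symm j), fun j => f (e.symm j), fun j => h1 _, fun x => ?_⟩
  rw [h2 x]
  exact (Equiv.sum_comp e.symm (fun j => φ (f j x) * b j)).symm

end Cyc
end cyc

section opp
open MulOpposite
variable {C : CartanDatum k I} {n : ℕ}

lemma st_kE (ν : Fin n → I) : st C n (kE C ν) = op (kE C ν) := by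
  apply unop_injective
  rw [unop_op]
  have h0 : ∀ ν' μ : Fin n → I, ν' ≠ μ → unop (st C n (kE C ν')) * kE C μ = 0 := by
    intro ν' μ hne
    obtain ⟨a, ha⟩ := Function.ne_iff.mp hne
    have : kE C ν' = Ep C n a (ν' a) * kE C ν' := by rw [Ep_mul_Ee C a.2, if_pos rfl]
    rw [this, map_mul, unop_mul, st_Ep C n a.2, unop_op, mul_assoc, Ep_mul_Ee C a.2, if_neg, mul_zero]
    exact ha.symm
  refine alg_ext C fun μ => ?_
  rw [Ee_mul]
  by_cases h : ν = μ
  · subst h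
    rw [if_pos rfl]
    have h1 : (1 : KA C n) * kE C ν = unop (st C n (∑ ν', kE C ν')) * kE C ν := by
      rw [Ee_sum, map_one, unop_one]
    rw [map_sum, unop_sum, Finset.sum_mul, Finset.sum_eq_single ν, one_mul] at h1
    · exact h1.symm
    · intro ν' _ hne; exact h0 _ _ hne
    · simp
  · rw [if_neg h, h0 _ _ h]

lemma st_eg (β : I → ℕ) : st C n (eg C n β) = op (eg C n β) := by
  unfold eg
  rw [map_sum, Finset.op_sum]
  exact Finset.sum_congr rfl fun ν _ => st_kE ν

lemma st_aK (Λ : I → ℕ) (β : I → ℕ) : st C n (aK C Λ n β) = op (aK C Λ n β) := by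
  unfold aK
  split_ifs with h
  · rw [map_sum, Finset.op_sum]
    refine Finset.sum_congr rfl fun ν _ => ?_
    rw [map_mul, map_pow, st_X C n h, st_kE, ← op_pow, ← op_mul]
    congr 1
    have : Commute (X C n 0) (kE C ν) := X_Ee C 0 ν
    exact (this.pow_left _).eq.symm
  · simp

lemma st_st (z : KA C n) : unop (st C n (unop (st C n z))) = z := by
  let S' : Subalgebra k (KA C n) :=
    { carrier := {z | unop (st C n (unop (st C n z))) = z}
      mul_mem' := by
        intro a b ha hb
        change unop (st C n (unop (st C n (a * b)))) = a * b
        rw [map_mul, unop_mul, map_mul, unop_mul, ha, hb]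
      add_mem' := by
        intro a b ha hb
        change unop (st C n (unop (st C n (a + b)))) = a + b
        rw [map_add, unop_add, map_add, unop_add, ha, hb]
      algebraMap_mem' := by
        intro c
        change unop (st C n (unop (st C n (algebraMap k _ c)))) = algebraMap k _ c
        rw [AlgHom.commutes, MulOpposite.algebraMap_apply, unop_op, AlgHom.commutes,
          MulOpposite.algebraMap_apply, unop_op] }
  refine KA_top C S' ?_ ?_ ?_ z
  · intro a ha j
    change unop (st C n (unop (st C n _))) = _
    rw [st_Ep C n ha, unop_op, st_Ep C n ha, unop_op]
  · intro a ha
    change unop (st C n (unop (st C n _))) = _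
    rw [st_X C n ha, unop_op, st_X C n ha, unop_op]
  · intro a ha
    change unop (st C n (unop (st C n _))) = _
    rw [st_Ta C n ha, unop_op, st_Ta C n ha, unop_op]

lemma st_io (z : KA C n) : unop (st C (n + 1) (io C n z)) = io C n (unop (st C n z)) := by
  let S' : Subalgebra k (KA C n) :=
    { carrier := {z | unop (st C (n + 1) (io C n z)) = io C n (unop (st C n z))}
      mul_mem' := by
        intro a b ha hb
        change unop (st C (n + 1) (io C n (a * b))) = io C n (unop (st C n (a * b)))
        rw [map_mul (io C n), map_mul, unop_mul, map_mul, unop_mul, ha, hb, map_mul]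
      add_mem' := by
        intro a b ha hb
        change unop (st C (n + 1) (io C n (a + b))) = io C n (unop (st C n (a + b)))
        rw [map_add (io C n), map_add, unop_add, map_add, unop_add, ha, hb, map_add]
      algebraMap_mem' := by
        intro c
        change unop (st C (n + 1) (io C n (algebraMap k _ c))) = io C n (unop (st C n (algebraMap k _ c)))
        rw [AlgHom.commutes, AlgHom.commutes, AlgHom.commutes, MulOpposite.algebraMap_apply, unop_op,
          MulOpposite.algebraMap_apply, unop_op, AlgHom.commutes] }
  refine KA_top C S' ?_ ?_ ?_ z
  · intro a ha j
    change unop (st C (n + 1) (io C n _)) = io C n (unop (st C n _))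
    rw [io_Ep C n ha, st_Ep C n ha, unop_op, st_Ep C _ (by omega), unop_op, io_Ep C n ha]
  · intro a ha
    change unop (st C (n + 1) (io C n _)) = io C n (unop (st C n _))
    rw [io_X C n ha, st_X C n ha, unop_op, st_X C _ (by omega), unop_op, io_X C n ha]
  · intro a ha
    change unop (st C (n + 1) (io C n _)) = io C n (unop (st C n _))
    rw [io_Ta C n ha, st_Ta C n ha, unop_op, st_Ta C _ (by omega), unop_op, io_Ta C n ha]

/-- the opposite presentation -/
noncomputable def piop {S : Type} [Ring S] (π : KA C n →+* S) : KA C n →+* Sᵐᵒᵖ :=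
  (RingHom.op π).comp (st C n).toRingHom

lemma piop_apply {S : Type} [Ring S] (π : KA C n →+* S) (z) : piop π z = op (π (unop (st C n z))) := rfl

/-- pulling back an ideal -/
noncomputable def Jop (J : TwoSidedIdeal (KA C n)) : TwoSidedIdeal (KA C n) :=
  TwoSidedIdeal.mk' {z | unop (st C n z) ∈ J}
    (by change unop (st C n 0) ∈ J; rw [map_zero]; exact J.zero_mem)
    (by intro x y hx hy; change unop (st C n (x + y)) ∈ J; rw [map_add]; exact J.add_mem hx hy)
    (by intro x hx; change unop (st C n (-x)) ∈ J; rw [map_neg]; exact J.neg_mem hx)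
    (by intro x y hx; change unop (st C n (x * y)) ∈ J; rw [map_mul]; exact J.mul_mem_right _ _ hx)
    (by intro x y hx; change unop (st C n (x * y)) ∈ J; rw [map_mul]; exact J.mul_mem_left _ _ hx)

lemma mem_Jop (J : TwoSidedIdeal (KA C n)) (z) : z ∈ Jop J ↔ unop (st C n z) ∈ J := by
  unfold Jop; rw [TwoSidedIdeal.mem_mk']; rfl

lemma Cyc.op' {Λ : I → ℕ} {β : I → ℕ} {S : Type} [Ring S] {π : KA C n →+* S} (H : Cyc C Λ β π) :
    Cyc C Λ β (piop π) where
  surj s := by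
    obtain ⟨z, hz⟩ := H.surj (unop s)
    exact ⟨unop (st C n z), by rw [piop_apply, st_st, hz, op_unop]⟩
  one := by rw [piop_apply, st_eg, unop_op, H.one, op_one]
  cyc := by rw [piop_apply, st_aK, unop_op, H.cyc, op_zero]
  ker J h1 h2 z hz := by
    have := H.ker (Jop J) ?_ ?_ (unop (st C n z)) ?_
    · rwa [mem_Jop, st_st] at this
    · rwa [mem_Jop, map_sub, st_eg, map_one, unop_sub, unop_op, unop_one]
    · rwa [mem_Jop, st_aK, unop_op]
    · rw [piop_apply] at hz; exact op_injective hz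

theorem Cyc.dual' {Λ : I → ℕ} {β : I → ℕ} {S : Type} [Ring S] {π : KA C n →+* S} (H : Cyc C Λ β π)
    {B : Type} [Ring B] {i : I} {πB : KA C (n + 1) →+* B}
    (HB : Cyc C Λ (addA β i) πB) (φ : S →+ B)
    (hφ : ∀ r, φ (π r) = πB (io C n r * Ep C (n + 1) n i)) :
    ∃ (m : ℕ) (b : Fin m → B) (f : Fin m → B →+ S),
      (∀ j t x, f j (x * φ t) = f j x * t) ∧ ∀ x, x * φ 1 = ∑ j, b j * φ (f j x) := by
  let φ' : Sᵐᵒᵖ →+ Bᵐᵒᵖ := opAddEquiv.toAddMonoidHom.comp (φ.comp opAddEquiv.symm.toAddMonoidHom)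
  have hφ' : ∀ s, φ' s = op (φ (unop s)) := fun _ => rfl
  obtain ⟨m, b, f, h1, h2⟩ := H.op'.dual HB.op' φ' (by
    intro r
    rw [hφ', piop_apply, piop_apply, unop_op, hφ, map_mul (st C (n + 1)), unop_mul, st_io,
      st_Ep C (n + 1) (by omega), unop_op, (io_comm_Ep C n i _).eq])
  refine ⟨m, fun j => unop (b j),
    fun j => opAddEquiv.symm.toAddMonoidHom.comp ((f j).comp opAddEquiv.toAddMonoidHom), ?_, ?_⟩
  · intro j t x
    have := congrArg unop (h1 j (op t) (op x))
    rw [unop_mul] at this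
    exact this
  · intro x
    have := congrArg unop (h2 (op x))
    rw [unop_sum, unop_mul, hφ'] at this
    exact this

end opp
end KLR


namespace KLR
open Finset
open scoped TensorProduct

section formal
variable {k : Type} [Field k]
variable {S B : Type} [Ring S] [Algebra k S] [Ring B] [Algebra k B] (φ : S →ₙₐ[k] B)

section F
variable (M : Type) [AddCommGroup M] [Module k M] [Module S M] [IsScalarTower k S M]

lemma OT_bal (b : B) (r : S) (m : M) :
    OTmk k S B M φ ((b * φ r) ⊗ₜ[k] m) = OTmk k S B M φ (b ⊗ₜ[k] (r • m)) := by
  refine (Submodule.Quotient.eq _).2 (Submodule.subset_span ⟨b, r, m, rfl⟩)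

/-- the quotient map, `k`-linear -/
noncomputable def OTl : (B ⊗[k] M) →ₗ[k] OT k S B M φ :=
  (TRel k S B M φ).mkQ.restrictScalars k

lemma OTl_apply (z : B ⊗[k] M) : OTl φ M z = OTmk k S B M φ z := rfl

lemma OTl_surj : Function.Surjective (OTl φ M) := by
  intro x
  obtain ⟨z, rfl⟩ := Submodule.Quotient.mk_surjective _ x
  exact ⟨z, rfl⟩

/-- coordinate maps -/
noncomputable def Gm (f : B →ₗ[k] S) : (B ⊗[k] M) →ₗ[k] M :=
  TensorProduct.lift ((Algebra.lsmul k k M).toLinearMap ∘ₗ f)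

variable {M} in
lemma Gm_tmul (f : B →ₗ[k] S) (b : B) (m : M) : Gm M f (b ⊗ₜ[k] m) = f b • m := by
  simp [Gm]

lemma Gm_rel (f : B →ₗ[k] S) (hf : ∀ t x, f (x * φ t) = f x * t) {z : B ⊗[k] M}
    (hz : z ∈ TRel k S B M φ) : ∀ b : B, Gm M f (b • z) = 0 := by
  unfold TRel at hz
  induction hz using Submodule.span_induction with
  | mem x h =>
    obtain ⟨b', r, m, rfl⟩ := h
    intro b
    rw [smul_sub, TensorProduct.smul_tmul', TensorProduct.smul_tmul', map_sub, Gm_tmul, Gm_tmul,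
      smul_eq_mul, smul_eq_mul, ← mul_assoc, hf, mul_smul, sub_self]
  | zero => intro b; simp
  | add x y _ _ hx hy => intro b; rw [smul_add, map_add, hx, hy, add_zero]
  | smul a x _ hx => intro b; rw [← mul_smul, hx]

lemma OT_exp {m : ℕ} (b : Fin m → B) (f : Fin m → B →ₗ[k] S)
    (h : ∀ x, x * φ 1 = ∑ j, b j * φ (f j x)) (z : B ⊗[k] M) :
    OTl φ M z = ∑ j, OTl φ M (b j ⊗ₜ[k] Gm M (f j) z) := by
  induction z with
  | zero => simp
  | add x y hx hy =>
    rw [map_add, hx, hy, ← Finset.sum_add_distrib]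
    refine Finset.sum_congr rfl fun j _ => ?_
    rw [map_add, TensorProduct.tmul_add, map_add]
  | tmul x y =>
    have e1 : OTl φ M (x ⊗ₜ[k] y) = OTl φ M ((x * φ 1) ⊗ₜ[k] y) := by
      rw [OTl_apply, OTl_apply, OT_bal, one_smul]
    rw [e1, h, TensorProduct.sum_tmul, map_sum]
    refine Finset.sum_congr rfl fun j _ => ?_
    rw [OTl_apply, OTl_apply, OT_bal, Gm_tmul]

end F

/-- existence of a right dual basis -/
def RDual : Prop := ∃ (m : ℕ) (b : Fin m → B) (f : Fin m → B →+ S),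
  (∀ j t x, f j (x * φ t) = f j x * t) ∧ ∀ x, x * φ 1 = ∑ j, b j * φ (f j x)

/-- existence of a left dual basis -/
def LDual : Prop := ∃ (m : ℕ) (b : Fin m → B) (f : Fin m → B →+ S),
  (∀ j t x, f j (φ t * x) = t * f j x) ∧ ∀ x, φ 1 * x = ∑ j, φ (f j x) * b j

variable {φ}

lemma RDual.lin (h : RDual φ) : ∃ (m : ℕ) (b : Fin m → B) (f : Fin m → B →ₗ[k] S),
    (∀ j t x, f j (x * φ t) = f j x * t) ∧ ∀ x, x * φ 1 = ∑ j, b j * φ (f j x) := by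
  obtain ⟨m, b, f, h1, h2⟩ := h
  refine ⟨m, b, fun j => { f j with map_smul' := ?_ }, h1, h2⟩
  intro c x
  have e : ∀ y, f j y = f j (y * φ 1) := fun y => by rw [h1, mul_one]
  show f j (c • x) = c • f j x
  rw [e (c • x), smul_mul_assoc, ← mul_smul_comm, ← map_smul, h1, mul_smul_comm, mul_one]

theorem F_exact (h : RDual φ) (M₁ M₂ M₃ : Type)
    [AddCommGroup M₁] [Module k M₁] [Module S M₁] [IsScalarTower k S M₁]
    [AddCommGroup M₂] [Module k M₂] [Module S M₂] [IsScalarTower k S M₂]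
    [AddCommGroup M₃] [Module k M₃] [Module S M₃] [IsScalarTower k S M₃]
    (f : M₁ →ₗ[S] M₂) (g : M₂ →ₗ[S] M₃)
    (hf : Function.Injective f) (hg : Function.Surjective g)
    (hfg : LinearMap.range f = LinearMap.ker g)
    (Ff : OT k S B M₁ φ →ₗ[k] OT k S B M₂ φ) (Fg : OT k S B M₂ φ →ₗ[k] OT k S B M₃ φ)
    (hFf : ∀ (b : B) (m : M₁), Ff (OTmk k S B M₁ φ (b ⊗ₜ[k] m)) = OTmk k S B M₂ φ (b ⊗ₜ[k] f m))
    (hFg : ∀ (b : B) (m : M₂), Fg (OTmk k S B M₂ φ (b ⊗ₜ[k] m)) = OTmk k S B M₃ φ (b ⊗ₜ[k] g m)) :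
    Function.Injective Ff ∧ Function.Surjective Fg ∧ LinearMap.range Ff = LinearMap.ker Fg := by
  obtain ⟨m, b, c, h1, h2⟩ := h.lin
  set f' := f.restrictScalars k
  set g' := g.restrictScalars k
  have kf : ∀ z, Ff (OTl φ M₁ z) = OTl φ M₂ (f'.lTensor B z) := by
    intro z
    have : Ff ∘ₗ OTl φ M₁ = OTl φ M₂ ∘ₗ f'.lTensor B := TensorProduct.ext' fun x y => hFf x y
    exact LinearMap.congr_fun this z
  have kg : ∀ z, Fg (OTl φ M₂ z) = OTl φ M₃ (g'.lTensor B z) := by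
    intro z
    have : Fg ∘ₗ OTl φ M₂ = OTl φ M₃ ∘ₗ g'.lTensor B := TensorProduct.ext' fun x y => hFg x y
    exact LinearMap.congr_fun this z
  have Gf : ∀ j z, Gm M₂ (c j) (f'.lTensor B z) = f (Gm M₁ (c j) z) := by
    intro j z
    have : Gm M₂ (c j) ∘ₗ f'.lTensor B = f' ∘ₗ Gm M₁ (c j) :=
      TensorProduct.ext' fun x y => by simp [Gm_tmul, f']
    exact LinearMap.congr_fun this z
  have Gg : ∀ j z, Gm M₃ (c j) (g'.lTensor B z) = g (Gm M₂ (c j) z) := by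
    intro j z
    have : Gm M₃ (c j) ∘ₗ g'.lTensor B = g' ∘ₗ Gm M₂ (c j) :=
      TensorProduct.ext' fun x y => by simp [Gm_tmul, g']
    exact LinearMap.congr_fun this z
  refine ⟨?_, ?_, ?_⟩
  · rw [injective_iff_map_eq_zero]
    intro a ha
    obtain ⟨z, rfl⟩ := OTl_surj φ M₁ a
    rw [kf] at ha
    have hz : f'.lTensor B z ∈ TRel k S B M₂ φ := (Submodule.Quotient.mk_eq_zero _).1 ha
    rw [OT_exp φ M₁ b c h2]
    refine Finset.sum_eq_zero fun j _ => ?_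
    have := Gm_rel φ M₂ (c j) (h1 j) hz 1
    rw [one_smul, Gf] at this
    rw [(injective_iff_map_eq_zero f).1 hf _ this, TensorProduct.tmul_zero, map_zero]
  · intro a
    obtain ⟨z, rfl⟩ := OTl_surj φ M₃ a
    obtain ⟨w, rfl⟩ := LinearMap.lTensor_surjective B (g := g') hg z
    exact ⟨OTl φ M₂ w, kg w⟩
  · ext a
    obtain ⟨z, rfl⟩ := OTl_surj φ M₂ a
    constructor
    · rintro ⟨a, ha⟩
      obtain ⟨w, rfl⟩ := OTl_surj φ M₁ a
      rw [← ha, LinearMap.mem_ker, kf, kg, ← LinearMap.lTensor_comp_apply]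
      have : g' ∘ₗ f' = 0 := by
        ext x
        have : f x ∈ LinearMap.ker g := hfg ▸ LinearMap.mem_range_self f x
        exact this
      rw [this]; simp
    · intro ha
      rw [LinearMap.mem_ker, kg] at ha
      have hz : g'.lTensor B z ∈ TRel k S B M₃ φ := (Submodule.Quotient.mk_eq_zero _).1 ha
      rw [OT_exp φ M₂ b c h2]
      refine Submodule.sum_mem _ fun j _ => ?_
      have := Gm_rel φ M₃ (c j) (h1 j) hz 1
      rw [one_smul, Gg] at this
      have hk : Gm M₂ (c j) z ∈ LinearMap.range f := hfg ▸ this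
      obtain ⟨y, hy⟩ := hk
      rw [← hy]
      exact ⟨OTmk k S B M₁ φ (b j ⊗ₜ[k] y), hFf _ _⟩

theorem E_exact {e : B} (he : e * e = e) (N₁ N₂ N₃ : Type)
    [AddCommGroup N₁] [Module k N₁] [Module B N₁] [IsScalarTower k B N₁]
    [AddCommGroup N₂] [Module k N₂] [Module B N₂] [IsScalarTower k B N₂]
    [AddCommGroup N₃] [Module k N₃] [Module B N₃] [IsScalarTower k B N₃]
    (f : N₁ →ₗ[B] N₂) (g : N₂ →ₗ[B] N₃)
    (hf : Function.Injective f) (hg : Function.Surjective g)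
    (hfg : LinearMap.range f = LinearMap.ker g)
    (Ef : ↥(eSub k B N₁ e) →ₗ[k] ↥(eSub k B N₂ e)) (Eg : ↥(eSub k B N₂ e) →ₗ[k] ↥(eSub k B N₃ e))
    (hEf : ∀ x, (Ef x).val = f x.val) (hEg : ∀ x, (Eg x).val = g x.val) :
    Function.Injective Ef ∧ Function.Surjective Eg ∧ LinearMap.range Ef = LinearMap.ker Eg := by
  refine ⟨?_, ?_, ?_⟩
  · intro x y hxy
    apply Subtype.ext
    apply hf
    rw [← hEf, ← hEf, hxy]
  · rintro ⟨_, y, rfl⟩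
    obtain ⟨x, rfl⟩ := hg y
    refine ⟨⟨e • x, x, rfl⟩, Subtype.ext ?_⟩
    rw [hEg]
    exact map_smul g e x
  · ext x
    constructor
    · rintro ⟨y, rfl⟩
      rw [LinearMap.mem_ker]
      apply Subtype.ext
      rw [hEg, hEf]
      have : f y.val ∈ LinearMap.ker g := hfg ▸ LinearMap.mem_range_self f y.val
      exact this
    · intro hx
      have h0 : g x.val = 0 := by rw [← hEg, LinearMap.mem_ker.1 hx]; rfl
      have : x.val ∈ LinearMap.range f := hfg ▸ h0
      obtain ⟨y, hy⟩ := this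
      refine ⟨⟨e • y, y, rfl⟩, Subtype.ext ?_⟩
      rw [hEf]
      show f (e • y) = _
      rw [map_smul, hy]
      obtain ⟨_, w, rfl⟩ := x
      show e • e • w = e • w
      rw [← mul_smul, he]

theorem F_proj (M : Type) [AddCommGroup M] [Module k M] [Module S M] [IsScalarTower k S M]
    (h1 : Module.Finite S M) (h2 : Module.Projective S M) :
    Module.Finite B (OT k S B M φ) ∧ Module.Projective B (OT k S B M φ) := by
  obtain ⟨n, p, q, -, -, hpq⟩ := Module.Finite.exists_comp_eq_id_of_projective S M
  let Q0 : Fin n → (B ⊗[k] M) →ₗ[B] B := fun j =>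
    TensorProduct.AlgebraTensorModule.lift
      (LinearMap.mk₂' B k (fun (b : B) (m : M) => b * φ (q m j))
        (fun a b m => add_mul _ _ _)
        (fun a b m => mul_assoc _ _ _)
        (fun a b m => by simp [mul_add])
        (fun c a m => by
          have : q (c • m) = c • q m := (q.restrictScalars k).map_smul c m
          rw [this, Pi.smul_apply, map_smul, mul_smul_comm]))
  have hQ0 : ∀ j b m, Q0 j (b ⊗ₜ[k] m) = b * φ (q m j) := fun j b m => rfl
  let Q : OT k S B M φ →ₗ[B] (Fin n → B) := LinearMap.pi fun j =>
    (TRel k S B M φ).liftQ (Q0 j) (by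
      unfold TRel
      rw [Submodule.span_le]
      rintro _ ⟨b, r, m, rfl⟩
      show Q0 j _ = 0
      rw [map_sub, hQ0, hQ0, map_smul, Pi.smul_apply, smul_eq_mul, map_mul, mul_assoc, sub_self])
  have hQ : ∀ j b m, Q (OTmk k S B M φ (b ⊗ₜ[k] m)) j = b * φ (q m j) := fun j b m => rfl
  let P : (Fin n → B) →ₗ[B] OT k S B M φ :=
    ∑ j, ((LinearMap.toSpanSingleton B _
      (OTmk k S B M φ (1 ⊗ₜ[k] p (Pi.single j 1)))).comp (LinearMap.proj j))
  have hP : ∀ c, P c = ∑ j, OTmk k S B M φ (c j ⊗ₜ[k] p (Pi.single j 1)) := by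
    intro c
    rw [LinearMap.sum_apply]
    refine Finset.sum_congr rfl fun j _ => ?_
    rw [LinearMap.comp_apply, LinearMap.proj_apply, LinearMap.toSpanSingleton_apply]
    have : c j ⊗ₜ[k] p (Pi.single j 1) = c j • ((1 : B) ⊗ₜ[k] p (Pi.single j 1)) := by
      rw [TensorProduct.smul_tmul', smul_eq_mul, mul_one]
    rw [this]; rfl
  have hPQ : ∀ x, P (Q x) = x := by
    intro x
    obtain ⟨z, rfl⟩ := OTl_surj φ M x
    induction z with
    | zero => simp
    | add x y hx hy => rw [map_add, map_add, map_add, hx, hy]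
    | tmul b m =>
      rw [hP]
      have : ∀ j, OTmk k S B M φ (Q (OTl φ M (b ⊗ₜ[k] m)) j ⊗ₜ[k] p (Pi.single j 1)) =
          OTl φ M (b ⊗ₜ[k] (q m j • p (Pi.single j 1))) := by
        intro j
        rw [OTl_apply, OTl_apply, hQ, OT_bal]
      rw [Finset.sum_congr rfl fun j _ => this j, ← map_sum, ← TensorProduct.tmul_sum]
      congr 2
      have e : ∑ j, q m j • p (Pi.single j 1) = p (q m) := by
        conv_rhs => rw [pi_eq_sum_univ' (q m)]
        rw [map_sum]
        refine Finset.sum_congr rfl fun j _ => ?_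
        rw [← map_smul]
      rw [e]
      exact LinearMap.congr_fun hpq m
  exact ⟨Module.Finite.of_surjective P fun x => ⟨Q x, hPQ x⟩,
    Module.Projective.of_split Q P (LinearMap.ext hPQ)⟩

theorem E_proj (h : LDual φ) {e : B} (he : φ 1 = e) (N : Type) [AddCommGroup N] [Module k N]
    [Module B N] [IsScalarTower k B N] (h1 : Module.Finite B N) (h2 : Module.Projective B N)
    (inst : Module S ↥(eSub k B N e)) (hi : IsEAction k e φ inst) :
    letI := inst
    Module.Finite S ↥(eSub k B N e) ∧ Module.Projective S ↥(eSub k B N e) := by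
  letI := inst
  have hi' : ∀ (r : S) (x : ↥(eSub k B N e)), ((r • x : ↥(eSub k B N e)) : N) = φ r • (x : N) := hi
  obtain ⟨n, p, q, -, -, hpq⟩ := Module.Finite.exists_comp_eq_id_of_projective B N
  obtain ⟨m, b, f, hf1, hf2⟩ := h
  let Q : ↥(eSub k B N e) →ₗ[S] (Fin m × Fin n → S) :=
    { toFun := fun x t => f t.1 (q x.val t.2)
      map_add' := fun x y => by ext t; simp
      map_smul' := fun r x => by
        ext t
        simp only [RingHom.id_apply, Pi.smul_apply]
        rw [hi', map_smul, Pi.smul_apply, smul_eq_mul, hf1, smul_eq_mul] }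
  let P : (Fin m × Fin n → S) →ₗ[S] ↥(eSub k B N e) :=
    { toFun := fun s => ⟨∑ t, (φ (s t) * b t.1) • p (Pi.single t.2 1),
        ∑ t, (φ (s t) * b t.1) • p (Pi.single t.2 1), by
          show e • (∑ t, (φ (s t) * b t.1) • p (Pi.single t.2 1) : N) = _
          rw [Finset.smul_sum]
          refine Finset.sum_congr rfl fun t _ => ?_
          rw [← mul_smul, ← mul_assoc, ← he, ← map_mul, one_mul]⟩
      map_add' := fun x y => by
        apply Subtype.ext
        simp [add_mul, add_smul, Finset.sum_add_distrib]
      map_smul' := fun r x => by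
        apply Subtype.ext
        rw [RingHom.id_apply, hi']
        simp only [Pi.smul_apply, smul_eq_mul, map_mul]
        rw [Finset.smul_sum]
        refine Finset.sum_congr rfl fun t _ => ?_
        rw [← mul_smul, mul_assoc] }
  have hPQ : ∀ x, P (Q x) = x := by
    intro x
    apply Subtype.ext
    show ∑ t : Fin m × Fin n, (φ (f t.1 (q x.val t.2)) * b t.1) • p (Pi.single t.2 1) = x.val
    rw [Fintype.sum_prod_type_right]
    have e1 : ∀ l : Fin n, ∑ j, (φ (f j (q x.val l)) * b j) • p (Pi.single l 1) =
        e • (q x.val l • p (Pi.single l 1)) := by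
      intro l
      rw [← Finset.sum_smul, ← hf2, mul_smul, he]
    rw [Finset.sum_congr rfl fun l _ => e1 l, ← Finset.smul_sum]
    have e2 : ∑ j, q x.val j • p (Pi.single j 1) = p (q x.val) := by
      conv_rhs => rw [pi_eq_sum_univ' (q x.val)]
      rw [map_sum]
      refine Finset.sum_congr rfl fun j _ => ?_
      rw [← map_smul]
    rw [e2]
    have e3 : p (q x.val) = x.val := LinearMap.congr_fun hpq x.val
    rw [e3]
    obtain ⟨_, w, rfl⟩ := x
    show e • e • w = e • w
    rw [← mul_smul, ← he, ← map_mul, one_mul]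
  exact ⟨Module.Finite.of_surjective P fun x => ⟨Q x, hPQ x⟩,
    Module.Projective.of_split Q P (LinearMap.ext hPQ)⟩

end formal
end KLR


namespace KLR
open Finset

variable {k : Type} [Field k] {I : Type} [Fintype I] [DecidableEq I]

section inst
variable {C : CartanDatum k I} {n : ℕ}

lemma qK_aLamF (Λ : I → ℕ) (β : I → ℕ) : qK C n (aLamF Λ n β) = aK C Λ n β := by
  unfold aLamF aK
  split_ifs with h
  · rw [map_sum]
    refine Finset.sum_congr rfl fun ν _ => ?_
    rw [map_mul, map_pow, X_eq C h]; rfl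
  · simp

lemma qK_unit (β : I → ℕ) : qK C n (∑ ν ∈ seqs β n, ge k ν) = eg C n β := by
  rw [map_sum]; rfl

theorem Cyc.mk_of {Λ : I → ℕ} {β : I → ℕ} {S : Type} [Ring S] [Algebra k S]
    (π : KA C n →ₐ[k] S) (hs : Function.Surjective π)
    (hrel : ∀ x y, CRel C Λ n β x y → π (qK C n x) = π (qK C n y))
    (huni : ∀ (T : Type) [Ring T] [Algebra k T] (g : FA k I n →ₐ[k] T),
      (∀ x y, CRel C Λ n β x y → g x = g y) → ∀ w, π (qK C n w) = 0 → g w = 0) :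
    Cyc C Λ β (π : KA C n →+* S) where
  surj := hs
  one := by
    have := hrel _ _ (CRel.unit)
    rw [qK_unit, map_one, map_one] at this
    exact this
  cyc := by
    have := hrel _ _ (CRel.cyc)
    rw [qK_aLamF, map_zero, map_zero] at this
    exact this
  ker := by
    intro J h1 h2 z hz
    obtain ⟨w, rfl⟩ := qK_surj C z
    have key : ∀ u, (RingCon.mk' J.ringCon) u = 0 ↔ u ∈ J := by
      intro u
      rw [TwoSidedIdeal.mem_iff]
      exact RingCon.eq J.ringCon
    have := huni J.ringCon.Quotient ((RingCon.mkₐ k J.ringCon).comp (qK C n)) ?_ w hz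
    · exact (key _).1 this
    · intro x y h
      cases h with
      | base hb => simp only [AlgHom.comp_apply, qK_rel C hb]
      | unit =>
        simp only [AlgHom.comp_apply]
        rw [qK_unit, map_one]
        refine sub_eq_zero.1 ?_
        rw [← map_sub]
        exact (key _).2 h1
      | cyc =>
        simp only [AlgHom.comp_apply]
        rw [qK_aLamF, map_zero, map_zero]
        exact (key _).2 h2

/-- the idempotent `e(β, α_i)` -/
noncomputable def eRK (C : CartanDatum k I) (n : ℕ) (β : I → ℕ) (i : I) : KA C (n + 1) :=
  ∑ ν ∈ (seqs (addA β i) (n + 1)).filter (fun ν => ν (Fin.last n) = i), kE C ν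

lemma eRK_eq (β : I → ℕ) (i : I) :
    eRK C n β i = Ep C (n + 1) n i * eg C (n + 1) (addA β i) := by
  unfold eRK eg
  rw [Finset.mul_sum, Finset.sum_filter]
  refine Finset.sum_congr rfl fun ν _ => ?_
  rw [Ep_mul_Ee C (Nat.lt_succ_self n)]
  rfl

theorem up_gen {β : I → ℕ} {i : I} {S B : Type} [Ring S] [Algebra k S] [Ring B] [Algebra k B]
    (π : KA C n →ₐ[k] S) (πB : KA C (n + 1) →ₐ[k] B)
    (H : π (eg C n β) = 1) (HB : πB (eg C (n + 1) (addA β i)) = 1) (φ : S →ₙₐ[k] B)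
    (hE : ∀ ν, φ (π (kE C ν)) = πB (kE C (Fin.snoc ν i)))
    (hX : ∀ a : Fin n, φ (π (kX C a)) = πB (kX C a.castSucc * eRK C n β i))
    (hT : ∀ (l : ℕ) (h : l + 1 < n),
      φ (π (kT C l h)) = πB (kT C l (Nat.lt_succ_of_lt h) * eRK C n β i)) (r : KA C n) :
    φ (π r) = πB (io C n r * Ep C (n + 1) n i) := by
  have hR : πB (eRK C n β i) = πB (Ep C (n + 1) n i) := by
    rw [eRK_eq, map_mul, HB, mul_one]
  have hsum : ∀ s : Finset (Fin n → I), φ (π (∑ ν ∈ s, kE C ν)) =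
      πB (io C n (∑ ν ∈ s, kE C ν) * Ep C (n + 1) n i) := by
    intro s
    simp only [map_sum, Finset.sum_mul, hE, io_kE]
  have hone : φ 1 = πB (Ep C (n + 1) n i) := by
    rw [← H]
    have := hsum (seqs β n)
    rw [← eg, io_eg, map_mul, HB, one_mul] at this
    exact this
  let S' : Subalgebra k (KA C n) :=
    { carrier := {r | φ (π r) = πB (io C n r * Ep C (n + 1) n i)}
      mul_mem' := by
        intro a b ha hb
        simp only [Set.mem_setOf_eq] at *
        rw [map_mul, map_mul, ha, hb, ← map_mul, map_mul (io C n)]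
        congr 1
        rw [mul_assoc, ← mul_assoc (Ep C (n + 1) n i), (io_comm_Ep C n i b).eq, mul_assoc (io C n b),
          Ep_idem i (Nat.lt_succ_self n), ← mul_assoc]
      add_mem' := by
        intro a b ha hb
        simp only [Set.mem_setOf_eq] at *
        rw [map_add, map_add, ha, hb, ← map_add, map_add (io C n), add_mul]
      algebraMap_mem' := by
        intro c
        simp only [Set.mem_setOf_eq]
        rw [Algebra.algebraMap_eq_smul_one, map_smul, map_smul, map_one, hone, map_smul, map_one,
          smul_mul_assoc, one_mul, map_smul] }
  refine KA_top C S' ?_ ?_ ?_ r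
  · intro a ha j
    show φ _ = _
    have : Ep C n a j = ∑ ν ∈ Finset.univ.filter (fun ν : Fin n → I => ν ⟨a, ha⟩ = j), kE C ν := by
      unfold Ep
      simp only [dif_pos ha, Finset.sum_filter]
    rw [this]; exact hsum _
  · intro a ha
    show φ _ = _
    rw [io_X C n ha, X_eq C ha, hX, map_mul, hR, X_eq C (show a < n + 1 by omega), map_mul]
    rfl
  · intro l hl
    show φ _ = _
    rw [io_Ta C n hl, Ta_eq C hl, hT, map_mul, hR, Ta_eq C (show l + 1 < n + 1 by omega), map_mul]

/-- the projection -/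
noncomputable def qC (C : CartanDatum k I) (Λ : I → ℕ) (n : ℕ) (β : I → ℕ) :
    KA C n →ₐ[k] cAlg C Λ n β := toCB C Λ

lemma qC_qK (Λ : I → ℕ) (β : I → ℕ) (w : FA k I n) :
    qC C Λ n β (qK C n w) = RingQuot.mkAlgHom k (CRel C Λ n β) w := by
  show toC C (toB C (RingQuot.mkAlgHom k (Rel C n) w)) = _
  unfold toB toC
  rw [RingQuot.liftAlgHom_mkAlgHom_apply, RingQuot.liftAlgHom_mkAlgHom_apply]

theorem cyc_qC (Λ : I → ℕ) (β : I → ℕ) : Cyc C Λ β (qC C Λ n β : KA C n →+* cAlg C Λ n β) := by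
  refine Cyc.mk_of (qC C Λ n β) ?_ ?_ ?_
  · intro y
    obtain ⟨w, rfl⟩ := RingQuot.mkAlgHom_surjective k (CRel C Λ n β) y
    exact ⟨qK C n w, qC_qK Λ β w⟩
  · intro x y h
    rw [qC_qK, qC_qK]
    exact RingQuot.mkAlgHom_rel k h
  · intro T _ _ g hg w hw
    rw [qC_qK] at hw
    have := RingQuot.liftAlgHom_mkAlgHom_apply k g (fun x y h => hg x y h) w
    rw [← this, hw, map_zero]

theorem up_qC {Λ : I → ℕ} {β : I → ℕ} {i : I}
    (φ : cAlg C Λ n β →ₙₐ[k] cAlg C Λ (n + 1) (addA β i)) (hφ : IsUpRc C Λ i φ) (r : KA C n) :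
    φ (qC C Λ n β r) = qC C Λ (n + 1) (addA β i) (io C n r * Ep C (n + 1) n i) :=
  up_gen (qC C Λ n β) (qC C Λ (n + 1) (addA β i)) (cyc_qC Λ β).one (cyc_qC Λ (addA β i)).one φ
    hφ.1 hφ.2.1 hφ.2.2 r

theorem phi_one {Λ : I → ℕ} {β : I → ℕ} {i : I}
    (φ : cAlg C Λ n β →ₙₐ[k] cAlg C Λ (n + 1) (addA β i)) (hφ : IsUpRc C Λ i φ) :
    φ 1 = eRc C Λ n β i := by
  have h1 := up_qC φ hφ 1
  have hB : qC C Λ (n + 1) (addA β i) (eg C (n + 1) (addA β i)) = 1 := (cyc_qC Λ (addA β i)).one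
  have e : eRc C Λ n β i = qC C Λ (n + 1) (addA β i) (eRK C n β i) := rfl
  rw [e, eRK_eq, map_mul, hB, mul_one]
  rw [map_one (qC C Λ n β), map_one (io C n), one_mul] at h1
  exact h1

theorem ldual {Λ : I → ℕ} {β : I → ℕ} {i : I}
    (φ : cAlg C Λ n β →ₙₐ[k] cAlg C Λ (n + 1) (addA β i)) (hφ : IsUpRc C Λ i φ) : LDual φ :=
  Cyc.dual (cyc_qC Λ β) (cyc_qC Λ (addA β i)) (φ : cAlg C Λ n β →+ cAlg C Λ (n + 1) (addA β i))
    (up_qC φ hφ)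

theorem rdual {Λ : I → ℕ} {β : I → ℕ} {i : I}
    (φ : cAlg C Λ n β →ₙₐ[k] cAlg C Λ (n + 1) (addA β i)) (hφ : IsUpRc C Λ i φ) : RDual φ :=
  Cyc.dual' (cyc_qC Λ β) (cyc_qC Λ (addA β i)) (φ : cAlg C Λ n β →+ cAlg C Λ (n + 1) (addA β i))
    (up_qC φ hφ)

end inst
end KLR

open KLR TensorProduct in
set_option maxHeartbeats 1000000 in
/-- The functors `E_i^Λ` and `F_i^Λ` are exact, and both send finitely generated
projective modules to finitely generated projective modules. -/
theorem EiLambda_FiLambda_exact_and_projective {k : Type} [Field k] {I : Type}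
    [Fintype I] [DecidableEq I] (C : CartanDatum k I) (Λ : I → ℕ) (β : I → ℕ) (i : I)
    (n : ℕ) (hn : ht I β = n)
    (φ : cAlg C Λ n β →ₙₐ[k] cAlg C Λ (n + 1) (addA β i)) (hφ : IsUpRc C Λ i φ) :
    -- (1) `F_i^Λ` is exact
    (∀ (M₁ M₂ M₃ : Type)
      [AddCommGroup M₁] [Module k M₁] [Module (cAlg C Λ n β) M₁]
        [IsScalarTower k (cAlg C Λ n β) M₁]
      [AddCommGroup M₂] [Module k M₂] [Module (cAlg C Λ n β) M₂]
        [IsScalarTower k (cAlg C Λ n β) M₂]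
      [AddCommGroup M₃] [Module k M₃] [Module (cAlg C Λ n β) M₃]
        [IsScalarTower k (cAlg C Λ n β) M₃]
      (f : M₁ →ₗ[cAlg C Λ n β] M₂) (g : M₂ →ₗ[cAlg C Λ n β] M₃),
      Function.Injective f → Function.Surjective g →
      LinearMap.range f = LinearMap.ker g →
      ∀ (Ff : OT k (cAlg C Λ n β) (cAlg C Λ (n + 1) (addA β i)) M₁ φ →ₗ[k]
              OT k (cAlg C Λ n β) (cAlg C Λ (n + 1) (addA β i)) M₂ φ)
        (Fg : OT k (cAlg C Λ n β) (cAlg C Λ (n + 1) (addA β i)) M₂ φ →ₗ[k]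
              OT k (cAlg C Λ n β) (cAlg C Λ (n + 1) (addA β i)) M₃ φ),
        (∀ (b : cAlg C Λ (n + 1) (addA β i)) (m : M₁),
          Ff (OTmk k (cAlg C Λ n β) (cAlg C Λ (n + 1) (addA β i)) M₁ φ (b ⊗ₜ[k] m))
            = OTmk k (cAlg C Λ n β) (cAlg C Λ (n + 1) (addA β i)) M₂ φ (b ⊗ₜ[k] f m)) →
        (∀ (b : cAlg C Λ (n + 1) (addA β i)) (m : M₂),
          Fg (OTmk k (cAlg C Λ n β) (cAlg C Λ (n + 1) (addA β i)) M₂ φ (b ⊗ₜ[k] m))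
            = OTmk k (cAlg C Λ n β) (cAlg C Λ (n + 1) (addA β i)) M₃ φ (b ⊗ₜ[k] g m)) →
        (Function.Injective Ff ∧ Function.Surjective Fg ∧
          LinearMap.range Ff = LinearMap.ker Fg)) ∧
    -- (2) `E_i^Λ` is exact
    (∀ (N₁ N₂ N₃ : Type)
      [AddCommGroup N₁] [Module k N₁] [Module (cAlg C Λ (n + 1) (addA β i)) N₁]
        [IsScalarTower k (cAlg C Λ (n + 1) (addA β i)) N₁]
      [AddCommGroup N₂] [Module k N₂] [Module (cAlg C Λ (n + 1) (addA β i)) N₂]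
        [IsScalarTower k (cAlg C Λ (n + 1) (addA β i)) N₂]
      [AddCommGroup N₃] [Module k N₃] [Module (cAlg C Λ (n + 1) (addA β i)) N₃]
        [IsScalarTower k (cAlg C Λ (n + 1) (addA β i)) N₃]
      (f : N₁ →ₗ[cAlg C Λ (n + 1) (addA β i)] N₂)
      (g : N₂ →ₗ[cAlg C Λ (n + 1) (addA β i)] N₃),
      Function.Injective f → Function.Surjective g →
      LinearMap.range f = LinearMap.ker g →
      ∀ (Ef : ↥(eSub k (cAlg C Λ (n + 1) (addA β i)) N₁ (eRc C Λ n β i)) →ₗ[k]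
              ↥(eSub k (cAlg C Λ (n + 1) (addA β i)) N₂ (eRc C Λ n β i)))
        (Eg : ↥(eSub k (cAlg C Λ (n + 1) (addA β i)) N₂ (eRc C Λ n β i)) →ₗ[k]
              ↥(eSub k (cAlg C Λ (n + 1) (addA β i)) N₃ (eRc C Λ n β i))),
        (∀ x, (Ef x).val = f x.val) → (∀ x, (Eg x).val = g x.val) →
        (Function.Injective Ef ∧ Function.Surjective Eg ∧
          LinearMap.range Ef = LinearMap.ker Eg)) ∧
    -- (3) `F_i^Λ` preserves finitely generated projectives
    (∀ (M : Type) [AddCommGroup M] [Module k M] [Module (cAlg C Λ n β) M]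
        [IsScalarTower k (cAlg C Λ n β) M],
      Module.Finite (cAlg C Λ n β) M → Module.Projective (cAlg C Λ n β) M →
      (Module.Finite (cAlg C Λ (n + 1) (addA β i))
          (OT k (cAlg C Λ n β) (cAlg C Λ (n + 1) (addA β i)) M φ) ∧
        Module.Projective (cAlg C Λ (n + 1) (addA β i))
          (OT k (cAlg C Λ n β) (cAlg C Λ (n + 1) (addA β i)) M φ))) ∧
    -- (4) `E_i^Λ` preserves finitely generated projectives
    (∀ (N : Type) [AddCommGroup N] [Module k N]
        [Module (cAlg C Λ (n + 1) (addA β i)) N]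
        [IsScalarTower k (cAlg C Λ (n + 1) (addA β i)) N],
      Module.Finite (cAlg C Λ (n + 1) (addA β i)) N →
      Module.Projective (cAlg C Λ (n + 1) (addA β i)) N →
      ∀ inst : Module (cAlg C Λ n β)
          ↥(eSub k (cAlg C Λ (n + 1) (addA β i)) N (eRc C Λ n β i)),
        IsEAction k (eRc C Λ n β i) φ inst →
        (letI := inst;
          Module.Finite (cAlg C Λ n β)
            ↥(eSub k (cAlg C Λ (n + 1) (addA β i)) N (eRc C Λ n β i)) ∧
          Module.Projective (cAlg C Λ n β)
            ↥(eSub k (cAlg C Λ (n + 1) (addA β i)) N (eRc C Λ n β i)))) := by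
  have hone := phi_one φ hφ
  refine ⟨?_, ?_, ?_, ?_⟩
  · intro M₁ M₂ M₃ _ _ _ _ _ _ _ _ _ _ _ _ f g hf hg hfg Ff Fg hFf hFg
    exact F_exact (rdual φ hφ) M₁ M₂ M₃ f g hf hg hfg Ff Fg hFf hFg
  · intro N₁ N₂ N₃ _ _ _ _ _ _ _ _ _ _ _ _ f g hf hg hfg Ef Eg hEf hEg
    have he : eRc C Λ n β i * eRc C Λ n β i = eRc C Λ n β i := by
      rw [← hone, ← map_mul φ, one_mul]
    exact E_exact he N₁ N₂ N₃ f g hf hg hfg Ef Eg hEf hEg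
  · intro M _ _ _ _ h1 h2
    exact F_proj M h1 h2
  · intro N _ _ _ _ h1 h2 inst hi
    exact E_proj (ldual φ hφ) hone N h1 h2 inst hi
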